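/- Let K be an algebraically closed field of characteristic 0, and let k and t be integers with 0 ≤ k ≤ min{2t+1, m+n−2t} and 1 ≤ t ≤ m ≤ n. Let R = K[x_1,…,x_{mn−k}] and let X be an (m×n)-matrix with exactly k zero entries, whose positions can be enumerated as (r_1,s_1),…,(r_k,s_k) (1-based indices) with r_h + s_h ≤ h+1 for every h = 1,…,k (i.e., the zeros lie on consecutive antidiagonals starting from the upper-left corner), and whose remaining mn−k entries are exactly the pairwise distinct indeterminates x_1,…,x_{mn−k}. Then ara I_t(X) = cd I_t(X) = mn − t² − k + 1. -/

import Mathlib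

/-- The ideal generated by the `t × t` minors of a matrix. -/
def minorsIdeal {R : Type*} [CommRing R] {m n : ℕ} (t : ℕ)
    (X : Matrix (Fin m) (Fin n) R) : Ideal R :=
  Ideal.span { d | ∃ (r : Fin t → Fin m) (c : Fin t → Fin n),
    Function.Injective r ∧ Function.Injective c ∧ d = (X.submatrix r c).det }

/-- The arithmetical rank of an ideal: the least number of elements generating it
up to radical. -/
noncomputable def araRank {R : Type*} [CommRing R] (I : Ideal R) : ℕ :=
  sInf { r | ∃ f : Fin r → R, (Ideal.span (Set.range f)).radical = I.radical }

/-- The cohomological dimension of an ideal: the largest `i` such that the local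
cohomology module `H^i_I(R)` is nonzero. -/
noncomputable def cohDim {R : Type*} [CommRing R] (I : Ideal R) : ℕ :=
  sSup { i | Nontrivial ((localCohomology I i).obj (ModuleCat.of R R)) }

section
universe u
open CategoryTheory Limits Opposite

namespace LCB

section opc
variable {R : Type u} [CommRing R]

lemma unop_surj {X Y : (ModuleCat.{u} R)ᵒᵖ} (f : X ⟶ Y) [Mono f] :
    Function.Surjective f.unop.hom := by
  have : Epi f.unop := inferInstance
  exact (ModuleCat.epi_iff_surjective _).1 this

lemma unop_inj {X Y : (ModuleCat.{u} R)ᵒᵖ} (f : X ⟶ Y) [Epi f] :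
    Function.Injective f.unop.hom := by
  have : Mono f.unop := inferInstance
  exact (ModuleCat.mono_iff_injective _).1 this

lemma opc_exact (A : ChainComplex (ModuleCat.{u} R)ᵒᵖ ℕ) (n : ℕ) (z : (A.X n).unop)
    (hz : (A.d (n+1) n).unop.hom z = 0) : ∃ y, (A.pOpcycles n).unop.hom y = z := by
  have h : (ShortComplex.mk (A.d (n+1) n) (A.pOpcycles n) (by simp)).Exact :=
    ShortComplex.exact_of_g_is_cokernel _ (A.opcyclesIsCokernel (n+1) n (by simp))
  exact (ShortComplex.moduleCat_exact_iff _).1 h.unop z hz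

lemma hom_exact (A : ChainComplex (ModuleCat.{u} R)ᵒᵖ ℕ) (n : ℕ) (y : (A.opcycles n).unop)
    (hz : (A.homologyι n).unop.hom y = 0) :
      ∃ w, (A.fromOpcycles n (n-1)).unop.hom w = y := by
  by_cases hn : n = 0
  · subst hn
    refine ⟨0, ?_⟩
    have : IsIso (A.homologyι 0) := ChainComplex.isIso_homologyι₀ A
    have h2 := (unop_inj (A.homologyι 0)) (a₁ := y) (a₂ := 0) (by simpa using hz)
    simp [h2]
  · have h : (ShortComplex.mk (A.homologyι n) (A.fromOpcycles n (n-1)) (by simp)).Exact :=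
      ShortComplex.exact_of_f_is_kernel _ (A.homologyIsKernel n (n-1) (by
        simp only [ComplexShape.next_eq' (ComplexShape.down ℕ) (j := n - 1) (i := n) (by simp; omega)]))
    exact (ShortComplex.moduleCat_exact_iff _).1 h.unop y hz

end opc

section rep
variable {R : Type u} [CommRing R]

/-- the yoneda functor -/
noncomputable abbrev FF (M : ModuleCat.{u} R) : ModuleCat.{u} R ⥤ (ModuleCat.{u} R)ᵒᵖ :=
  ((linearYoneda R (ModuleCat.{u} R)).obj M).rightOp

noncomputable abbrev AA (M : ModuleCat.{u} R) (K : ChainComplex (ModuleCat.{u} R) ℕ) :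
   ChainComplex (ModuleCat.{u} R)ᵒᵖ ℕ := ((FF M).mapHomologicalComplex _).obj K

noncomputable abbrev EE (n : ℕ) (X M : ModuleCat.{u} R) : ModuleCat.{u} R :=
  (((FF M).leftDerived n).obj X).unop

def Rep {M X : ModuleCat.{u} R} (P : ProjectiveResolution X) (n : ℕ)
   (x : EE n X M) (φ : P.complex.X n ⟶ M) : Prop :=
   ∃ y : ((AA M P.complex).opcycles n).unop,
     ((AA M P.complex).pOpcycles n).unop.hom y = φ ∧
     x = (P.isoLeftDerivedObj (FF M) n).hom.unop.hom
        (((AA M P.complex).homologyι n).unop.hom y)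

variable {M X : ModuleCat.{u} R} (P : ProjectiveResolution X) (n : ℕ)

lemma rep_exists (x : EE n X M) :
    ∃ φ : P.complex.X n ⟶ M, P.complex.d (n+1) n ≫ φ = 0 ∧ Rep P n x φ := by
  obtain ⟨x', rfl⟩ := unop_surj (P.isoLeftDerivedObj (FF M) n).hom x
  obtain ⟨y, rfl⟩ := unop_surj ((AA M P.complex).homologyι n) x'
  refine ⟨((AA M P.complex).pOpcycles n).unop.hom y, ?_, y, rfl, rfl⟩
  have h : (AA M P.complex).d (n+1) n ≫ (AA M P.complex).pOpcycles n = 0 :=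
    HomologicalComplex.d_pOpcycles _ _ _
  have h2 := congrArg (fun f => f.unop.hom y) h
  exact h2

lemma rep_of_cocycle (φ : P.complex.X n ⟶ M) (h : P.complex.d (n+1) n ≫ φ = 0) :
    ∃ x : EE n X M, Rep P n x φ := by
  obtain ⟨y, hy⟩ := opc_exact (AA M P.complex) n φ h
  exact ⟨_, y, hy, rfl⟩

lemma rep_zero_iff (x : EE n X M) (φ : P.complex.X n ⟶ M) (h : Rep P n x φ) :
    x = 0 ↔ ∃ ψ : P.complex.X (n-1) ⟶ M, φ = P.complex.d n (n-1) ≫ ψ := by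
  obtain ⟨y, hy, rfl⟩ := h
  have hinj := unop_inj (P.isoLeftDerivedObj (FF M) n).hom
  refine (map_eq_zero_iff (P.isoLeftDerivedObj (FF M) n).hom.unop.hom hinj).trans ?_
  have hpd : (AA M P.complex).pOpcycles n ≫ (AA M P.complex).fromOpcycles n (n-1) =
      (AA M P.complex).d n (n-1) := HomologicalComplex.p_fromOpcycles _ _ _
  constructor
  · intro h0
    obtain ⟨w, hw⟩ := hom_exact _ _ _ h0
    refine ⟨w, ?_⟩
    rw [← hy, ← hw]
    exact congrArg (fun f => f.unop.hom w) hpd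
  · rintro ⟨ψ, hψ⟩
    have : y = ((AA M P.complex).fromOpcycles n (n-1)).unop.hom ψ := by
      apply unop_inj ((AA M P.complex).pOpcycles n)
      rw [hy, hψ]
      exact (congrArg (fun f => f.unop.hom ψ) hpd).symm
    rw [this]
    have h3 : (AA M P.complex).homologyι n ≫ (AA M P.complex).fromOpcycles n (n-1) = 0 :=
      HomologicalComplex.homologyι_comp_fromOpcycles _ _ _
    exact congrArg (fun f => f.unop.hom ψ) h3

lemma rep_nat {Y : ModuleCat.{u} R} (Q : ProjectiveResolution Y) (f : X ⟶ Y)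
    (g : P.complex ⟶ Q.complex) (w : g.f 0 ≫ Q.π.f 0 = P.π.f 0 ≫ f)
    (x : EE n Y M) (φ : Q.complex.X n ⟶ M) (h : Rep Q n x φ) :
    Rep P n (((FF M).leftDerived n).map f |>.unop.hom x) (g.f n ≫ φ) := by
  obtain ⟨y, hy, rfl⟩ := h
  let G := ((FF M).mapHomologicalComplex (ComplexShape.down ℕ)).map g
  refine ⟨(HomologicalComplex.opcyclesMap G n).unop.hom y, ?_, ?_⟩
  · have := HomologicalComplex.p_opcyclesMap G n
    have h2 := congrArg (fun f => f.unop.hom y) this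
    rw [← hy]
    exact h2
  · have h1 := ProjectiveResolution.isoLeftDerivedObj_hom_naturality f P Q g w (FF M) n
    have h2 := HomologicalComplex.homologyι_naturality G n
    have h1' := congrArg (fun f => f.unop.hom (((AA M Q.complex).homologyι n).unop.hom y)) h1
    have h2' := congrArg (fun f => f.unop.hom y) h2
    refine h1'.trans ?_
    exact congrArg (P.isoLeftDerivedObj (FF M) n).hom.unop.hom h2'
end rep
end LCB
end

section
universe u
open CategoryTheory Limits Opposite

namespace LCB
section col
variable {R : Type u} [CommRing R] (I : Ideal R)

/-- quotient by a power -/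
noncomputable abbrev QQ (k : ℕ) : ModuleCat.{u} R := ModuleCat.of R (R ⧸ I ^ k)

/-- the projection -/
noncomputable def qq {k l : ℕ} (h : k ≤ l) : QQ I l ⟶ QQ I k :=
  ModuleCat.ofHom (Submodule.mapQ _ _ LinearMap.id (Ideal.pow_le_pow_right h))

noncomputable abbrev PP (k : ℕ) : ProjectiveResolution (QQ I k) := projectiveResolution _

/-- vanishing of local cohomology -/
def V (i : ℕ) (M : ModuleCat.{u} R) : Prop := Subsingleton ((localCohomology I i).obj M)

lemma V_iff' (i : ℕ) (M : ModuleCat.{u} R) : V I i M ↔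
    ∀ (k : ℕ) (x : EE i (QQ I k) M), ∃ (l : ℕ) (h : k ≤ l),
      (((FF M).leftDerived i).map (qq I h)).unop.hom x = 0 := by
  let D := localCohomology.diagram (localCohomology.idealPowersDiagram I) i
  have e : (localCohomology I i).obj M ≅ colimit (D ⋙ (evaluation _ _).obj M) :=
    colimitObjIsoColimitCompEvaluation D M
  have e' : Subsingleton ((localCohomology I i).obj M) ↔
      Subsingleton (colimit (D ⋙ (evaluation _ _).obj M) : ModuleCat R) :=
    (e.toLinearEquiv.toEquiv).subsingleton_congr
  rw [V, e']
  have : PreservesFilteredColimitsOfSize.{0, 0} (forget (ModuleCat.{u} R)) :=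
    preservesFilteredColimitsOfSize_shrink.{0, u, 0, u} _
  constructor
  · intro hs k x
    obtain ⟨l, f, hl⟩ := Limits.Concrete.colimit_rep_eq_zero R (D ⋙ (evaluation _ _).obj M) (op (op k)) x
      (Subsingleton.elim _ _)
    exact ⟨l.unop.unop, f.unop.unop.down.down, hl⟩
  · intro H
    refine ⟨fun a b => ?_⟩
    suffices hh : ∀ a : (colimit (D ⋙ (evaluation _ _).obj M) : ModuleCat R), a = 0 by
      rw [hh a, hh b]
    intro a
    obtain ⟨k, x, rfl⟩ := Limits.Concrete.colimit_exists_rep (D ⋙ (evaluation _ _).obj M) a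
    obtain ⟨l, h, hl⟩ := H k.unop.unop x
    have hw := colimit.w (D ⋙ (evaluation _ _).obj M) (j' := k) (j := op (op l)) (homOfLE h).op.op
    rw [← hw]
    have h0 : ((D ⋙ (evaluation _ _).obj M).map ((homOfLE h).op.op : k ⟶ op (op l))).hom x = 0 := hl
    rw [ModuleCat.comp_apply]
    erw [h0]
    simp

lemma qq_comp {k l p : ℕ} (h : k ≤ l) (h' : l ≤ p) :
    qq I h' ≫ qq I h = qq I (h.trans h') := by
  apply ConcreteCategory.hom_ext; intro x
  obtain ⟨x, rfl⟩ := Submodule.Quotient.mk_surjective _ x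
  rfl

/-- chain lift of the projection -/
noncomputable def gg {k l : ℕ} (h : k ≤ l) : (PP I l).complex ⟶ (PP I k).complex :=
  ProjectiveResolution.lift (qq I h) _ _

lemma gg_w {k l : ℕ} (h : k ≤ l) :
    (gg I h).f 0 ≫ (PP I k).π.f 0 = (PP I l).π.f 0 ≫ qq I h := by
  exact ProjectiveResolution.lift_commutes_zero (qq I h) (PP I l) (PP I k)

variable {I} in
lemma V_use {i : ℕ} {M : ModuleCat.{u} R} (hV : V I i M) {k : ℕ} (φ : (PP I k).complex.X i ⟶ M)
    (hφ : (PP I k).complex.d (i+1) i ≫ φ = 0) :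
    ∃ (l : ℕ) (h : k ≤ l) (ψ : (PP I l).complex.X (i-1) ⟶ M),
      (gg I h).f i ≫ φ = (PP I l).complex.d i (i-1) ≫ ψ := by
  obtain ⟨x, hx⟩ := rep_of_cocycle (PP I k) i φ hφ
  obtain ⟨l, h, h0⟩ := (V_iff' I i M).1 hV k x
  have := rep_nat (PP I l) i (PP I k) (qq I h) (gg I h) (gg_w I h) x φ hx
  exact ⟨l, h, (rep_zero_iff _ _ _ _ this).1 h0⟩

variable {I} in
lemma V_of {i : ℕ} {M : ModuleCat.{u} R}
    (H : ∀ (k : ℕ) (φ : (PP I k).complex.X i ⟶ M), (PP I k).complex.d (i+1) i ≫ φ = 0 →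
    ∃ (l : ℕ) (h : k ≤ l) (g : (PP I l).complex ⟶ (PP I k).complex),
      g.f 0 ≫ (PP I k).π.f 0 = (PP I l).π.f 0 ≫ qq I h ∧
      ∃ (ψ : (PP I l).complex.X (i-1) ⟶ M), g.f i ≫ φ = (PP I l).complex.d i (i-1) ≫ ψ) :
    V I i M := by
  rw [V_iff']
  intro k x
  obtain ⟨φ, hφ, hr⟩ := rep_exists (PP I k) i x
  obtain ⟨l, h, g, w, hψ⟩ := H k φ hφ
  exact ⟨l, h, (rep_zero_iff _ _ _ _ (rep_nat (PP I l) i (PP I k) (qq I h) g w x φ hr)).2 hψ⟩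

lemma gg_comp_w {k l p : ℕ} (h : k ≤ l) (h' : l ≤ p) :
    (gg I h' ≫ gg I h).f 0 ≫ (PP I k).π.f 0 = (PP I p).π.f 0 ≫ qq I (h.trans h') := by
  rw [HomologicalComplex.comp_f, Category.assoc, gg_w, ← qq_comp I h h']
  have := congrArg (· ≫ qq I h) (gg_w I h')
  exact this

variable {I}

section ses
variable {S : ShortComplex (ModuleCat.{u} R)} (hS : S.ShortExact)
include hS

lemma V_mid {i : ℕ} (h1 : V I i S.X₁) (h3 : V I i S.X₃) : V I i S.X₂ := by
  have := hS.mono_f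
  have := hS.epi_g
  apply V_of
  intro k φ hφ
  obtain ⟨l, h, ψ, hψ⟩ := V_use h3 (φ ≫ S.g) (by rw [reassoc_of% hφ, zero_comp])
  let ψ' := Projective.factorThru ψ S.g
  have hψ' : ψ' ≫ S.g = ψ := Projective.factorThru_comp _ _
  let χ := hS.exact.lift ((gg I h).f i ≫ φ - (PP I l).complex.d i (i-1) ≫ ψ') (by
    rw [Preadditive.sub_comp, Category.assoc, Category.assoc, hψ', hψ, sub_self])
  have hχ : χ ≫ S.f = _ := hS.exact.lift_f _ _
  obtain ⟨p, h', ξ, hξ⟩ := V_use h1 χ (by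
    rw [← cancel_mono S.f, Category.assoc, hχ, Preadditive.comp_sub, zero_comp,
      HomologicalComplex.d_comp_d_assoc, zero_comp, sub_zero,
      ← HomologicalComplex.Hom.comm_assoc, hφ, comp_zero])
  refine ⟨p, h.trans h', gg I h' ≫ gg I h, gg_comp_w I h h', ξ ≫ S.f + (gg I h').f _ ≫ ψ', ?_⟩
  have h5 := congrArg (· ≫ S.f) hξ
  simp only [Category.assoc, hχ, Preadditive.comp_sub] at h5
  rw [HomologicalComplex.comp_f, Category.assoc, Preadditive.comp_add, ← h5,
    HomologicalComplex.Hom.comm_assoc]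
  abel

lemma V_left {i : ℕ} (h2 : V I (i+1) S.X₂) (h3 : V I i S.X₃) : V I (i+1) S.X₁ := by
  have := hS.mono_f
  have := hS.epi_g
  apply V_of
  intro k φ hφ
  obtain ⟨l, h, ψ, hψ⟩ := V_use h2 (φ ≫ S.f) (by rw [reassoc_of% hφ, zero_comp])
  change (PP I l).complex.X i ⟶ _ at ψ
  change _ = (PP I l).complex.d (i+1) i ≫ ψ at hψ
  obtain ⟨p, h', ξ, hξ⟩ := V_use h3 (ψ ≫ S.g) (by
    rw [← reassoc_of% hψ, S.zero]; simp)
  let ξ' := Projective.factorThru ξ S.g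
  have hξ' : ξ' ≫ S.g = ξ := Projective.factorThru_comp _ _
  let χ := hS.exact.lift ((gg I h').f i ≫ ψ - (PP I p).complex.d i (i-1) ≫ ξ') (by
    rw [Preadditive.sub_comp, Category.assoc, Category.assoc, hξ', hξ, sub_self])
  have hχ : χ ≫ S.f = _ := hS.exact.lift_f _ _
  refine ⟨p, h.trans h', gg I h' ≫ gg I h, gg_comp_w I h h', χ, ?_⟩
  change _ = (PP I p).complex.d (i+1) i ≫ _
  rw [← cancel_mono S.f, Category.assoc _ χ, hχ, Preadditive.comp_sub,
    HomologicalComplex.d_comp_d_assoc, zero_comp, sub_zero, HomologicalComplex.comp_f,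
    Category.assoc, Category.assoc, hψ, HomologicalComplex.Hom.comm_assoc]

lemma V_right {i : ℕ} (h2 : V I i S.X₂) (h3 : V I (i+1) S.X₁) : V I i S.X₃ := by
  have := hS.mono_f
  have := hS.epi_g
  apply V_of
  intro k φ hφ
  let χ := Projective.factorThru φ S.g
  have hχ : χ ≫ S.g = φ := Projective.factorThru_comp _ _
  let ξ := hS.exact.lift ((PP I k).complex.d (i+1) i ≫ χ) (by
    rw [Category.assoc, hχ, hφ])
  have hξ : ξ ≫ S.f = _ := hS.exact.lift_f _ _
  obtain ⟨l, h, ψ, hψ⟩ := V_use h3 ξ (by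
    rw [← cancel_mono S.f, Category.assoc, hξ, HomologicalComplex.d_comp_d_assoc, zero_comp, zero_comp])
  change (PP I l).complex.X i ⟶ _ at ψ
  change _ = (PP I l).complex.d (i+1) i ≫ ψ at hψ
  obtain ⟨p, h', η, hη⟩ := V_use h2 ((gg I h).f i ≫ χ - ψ ≫ S.f) (by
    rw [Preadditive.comp_sub, ← reassoc_of% hψ, hξ, HomologicalComplex.Hom.comm_assoc, sub_self])
  refine ⟨p, h.trans h', gg I h' ≫ gg I h, gg_comp_w I h h', η ≫ S.g, ?_⟩
  have h5 := congrArg (· ≫ S.g) hη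
  simp only [Category.assoc, Preadditive.comp_sub, Preadditive.sub_comp, S.zero, comp_zero,
    sub_zero, hχ] at h5
  rw [HomologicalComplex.comp_f, Category.assoc, h5]
end ses

lemma V_inj {i : ℕ} (E : ModuleCat.{u} R) [Injective E] : V I (i+1) E := by
  apply V_of
  intro k φ hφ
  refine ⟨k, le_rfl, gg I le_rfl, gg_w I _, ?_⟩
  have hex := (PP I k).exact_succ i
  have : (gg I (le_refl k)).f (i+1) ≫ φ = (gg I (le_refl k)).f (i+1) ≫ (PP I k).complex.d (i+1) i ≫ hex.descToInjective φ hφ := by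
    rw [hex.comp_descToInjective]
  rw [this, HomologicalComplex.Hom.comm_assoc]
  exact ⟨_, rfl⟩

/-- scalar multiplication on a complex -/
noncomputable def smulC (r : R) (C : ChainComplex (ModuleCat.{u} R) ℕ) : C ⟶ C where
  f i := r • 𝟙 _
  comm' i j _ := by simp

lemma V_bij {i : ℕ} (M : ModuleCat.{u} R) (f : R) (hf : f ∈ I)
    (hb : Function.Bijective (fun x : M => f • x)) : V I i M := by
  apply V_of
  intro k φ hφ
  let e : M ⟶ M := ModuleCat.ofHom (LinearMap.lsmul R M (f ^ k))
  have he : Function.Bijective e.hom := by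
    have : (e.hom : M → M) = (fun x : M => f • x)^[k] := by
      rw [smul_iterate]; rfl
    rw [this]; exact hb.iterate k
  have : IsIso e := (ConcreteCategory.isIso_iff_bijective e).2 he
  obtain ⟨x, hx⟩ := rep_of_cocycle (PP I k) i φ hφ
  have h1 := rep_nat (PP I k) i (PP I k) 0 (smulC (f^k) _) (by
    apply ConcreteCategory.hom_ext
    intro y
    change (((f ^ k) • 𝟙 ((PP I k).complex.X 0)) ≫ (PP I k).π.f 0).hom y = 0
    rw [Linear.smul_comp, Category.id_comp]
    have : ∀ z : R ⧸ I ^ k, f ^ k • z = 0 := by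
      intro z
      obtain ⟨z, rfl⟩ := Ideal.Quotient.mk_surjective z
      rw [← Ideal.Quotient.mk_eq_mk, ← Submodule.Quotient.mk_smul, Submodule.Quotient.mk_eq_zero]
      exact Ideal.mul_mem_right _ _ (Ideal.pow_mem_pow hf k)
    exact this _) x φ hx
  obtain ⟨ψ, hψ⟩ := (rep_zero_iff _ _ _ _ h1).1 (by
    have h0 : ((FF M).leftDerived i).map (0 : QQ I k ⟶ QQ I k) = 0 := by
      rw [Functor.leftDerived_map_eq (FF M) i 0 (P := PP I k) (Q := PP I k) 0
        (by ext1; simp; rfl)]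
      simp
      exact zero_comp
    rw [h0]; rfl)
  refine ⟨k, le_rfl, gg I le_rfl, gg_w I _, (gg I le_rfl).f _ ≫ ψ ≫ inv e, ?_⟩
  have h3 : φ ≫ e = (PP I k).complex.d i (i-1) ≫ ψ := by
    rw [← hψ]
    simp only [smulC]
    rw [Linear.smul_comp, Category.id_comp]
    apply ConcreteCategory.hom_ext
    intro y
    rfl
  rw [← HomologicalComplex.Hom.comm_assoc, ← reassoc_of% h3, IsIso.hom_inv_id, Category.comp_id]

end col
end LCB
end

section
universe u
open CategoryTheory Limits Opposite

namespace LCB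
section tors
variable {R : Type u} [CommRing R]

/-- torsion submodule -/
def Gam (I : Ideal R) (E : Type*) [AddCommGroup E] [Module R E] : Submodule R E where
  carrier := {x | ∃ k, ∀ r ∈ I ^ k, r • x = 0}
  add_mem' := by
    rintro a b ⟨k, hk⟩ ⟨l, hl⟩
    refine ⟨k + l, fun r hr => ?_⟩
    rw [smul_add, hk r (Ideal.pow_le_pow_right (by omega) hr),
      hl r (Ideal.pow_le_pow_right (by omega) hr), add_zero]
  zero_mem' := ⟨0, fun _ _ => smul_zero _⟩
  smul_mem' := by
    rintro c x ⟨k, hk⟩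
    exact ⟨k, fun r hr => by rw [smul_comm, hk r hr, smul_zero]⟩

/-- being torsion -/
def Tors (I : Ideal R) (E : Type*) [AddCommGroup E] [Module R E] : Prop :=
  ∀ x : E, x ∈ Gam I E

lemma gam_bound (I : Ideal R) {E : Type*} [AddCommGroup E] [Module R E] {J : Type*}
    [AddCommGroup J] [Module R J] [Module.Finite R J] (f : J →ₗ[R] Gam I E) :
    ∃ N, ∀ r ∈ I ^ N, ∀ j, r • f j = 0 := by
  classical
  obtain ⟨s, hs⟩ := Module.Finite.fg_top (R := R) (M := J)
  have : ∃ N, ∀ r ∈ I ^ N, ∀ j ∈ s, r • f j = 0 := by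
    clear hs
    induction s using Finset.induction with
    | empty => exact ⟨0, by simp⟩
    | insert a s ha ih =>
      obtain ⟨N, hN⟩ := ih
      obtain ⟨k, hk⟩ := (f a).2
      refine ⟨N + k, fun r hr j hj => ?_⟩
      rcases Finset.mem_insert.1 hj with rfl | hj
      · exact Subtype.ext (hk r (Ideal.pow_le_pow_right (by omega) hr))
      · exact hN r (Ideal.pow_le_pow_right (by omega) hr) j hj
  obtain ⟨N, hN⟩ := this
  refine ⟨N, fun r hr j => ?_⟩
  have hj : j ∈ Submodule.span R (s : Set J) := by rw [hs]; trivial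
  induction hj using Submodule.span_induction with
  | mem x h => exact hN r hr x h
  | zero => simp
  | add x y _ _ hx hy => rw [map_add, smul_add, hx, hy, add_zero]
  | smul a x _ hx => rw [map_smul, smul_comm, hx, smul_zero]

lemma gam_baer [IsNoetherianRing R] (I : Ideal R) (E : Type u) [AddCommGroup E] [Module R E]
    [Module.Injective R E] : Module.Baer R (Gam I E) := by
  intro J f
  obtain ⟨N, hN⟩ := gam_bound I f
  obtain ⟨k, hk⟩ := Ideal.exists_pow_inf_eq_pow_smul I J
  have h1 := hk (N + k) (by omega)
  rw [Nat.add_sub_cancel] at h1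
  have hle : I ^ (N+k) ⊓ J ≤ I ^ N • J := by
    have : I ^ (N + k) • (⊤ : Submodule R R) = I ^ (N+k) := by simp
    rw [this] at h1
    rw [h1]
    exact Submodule.smul_mono le_rfl inf_le_right
  have h0 : ∀ j : J, (j : R) ∈ I ^ (N+k) → f j = 0 := by
    intro j hj
    have hj' : (j : R) ∈ I ^ N • J := hle ⟨hj, j.2⟩
    have : ∀ x ∈ I ^ N • J, ∃ hx : x ∈ J, f ⟨x, hx⟩ = 0 := by
      intro x hx
      refine Submodule.smul_induction_on hx ?_ ?_
      · intro r hr n hn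
        refine ⟨J.smul_mem r hn, ?_⟩
        have : (⟨r • n, J.smul_mem r hn⟩ : J) = r • ⟨n, hn⟩ := rfl
        rw [this, map_smul]; exact hN r hr _
      · intro x y hx hy
        obtain ⟨hx, h1⟩ := hx
        obtain ⟨hy, h2⟩ := hy
        refine ⟨J.add_mem hx hy, ?_⟩
        have : (⟨x + y, J.add_mem hx hy⟩ : J) = ⟨x, hx⟩ + ⟨y, hy⟩ := rfl
        rw [this, map_add, h1, h2, add_zero]
    exact (this j hj').2
  let U : Submodule R J := Submodule.comap J.subtype (I ^ (N+k))
  let i : (J ⧸ U) →ₗ[R] (R ⧸ I ^ (N+k)) := Submodule.mapQ U (I ^ (N+k)) J.subtype le_rfl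
  have hi : Function.Injective i := by
    rw [← LinearMap.ker_eq_bot, LinearMap.ker_eq_bot']
    intro x hx
    obtain ⟨x, rfl⟩ := Submodule.Quotient.mk_surjective _ x
    rw [Submodule.mapQ_apply, Submodule.Quotient.mk_eq_zero] at hx
    rwa [Submodule.Quotient.mk_eq_zero]
  let f' : (J ⧸ U) →ₗ[R] E := U.liftQ ((Gam I E).subtype ∘ₗ f) (by
    intro j hj
    simp only [LinearMap.mem_ker, LinearMap.comp_apply]
    rw [h0 j hj]; simp)
  obtain ⟨h, hh⟩ := Module.Injective.out i hi f'
  refine ⟨LinearMap.codRestrict _ (h ∘ₗ (I ^ (N+k)).mkQ) ?_, ?_⟩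
  · intro x
    refine ⟨N+k, fun r hr => ?_⟩
    rw [LinearMap.comp_apply, ← map_smul, ← map_smul]
    have : (I ^ (N+k)).mkQ (r • x) = 0 := by
      rw [Submodule.mkQ_apply, Submodule.Quotient.mk_eq_zero]
      exact Ideal.mul_mem_right _ _ hr
    rw [this, map_zero]
  · intro x hx
    apply Subtype.ext
    have := hh (Submodule.Quotient.mk ⟨x, hx⟩)
    exact this

/-- map from the quotient given by a killed element -/
noncomputable def ofKilled (I : Ideal R) (k : ℕ) (M : ModuleCat.{u} R) (a : M) (ha : ∀ r ∈ I ^ k, r • a = 0) :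
    QQ I k ⟶ M :=
  ModuleCat.ofHom (Submodule.liftQ _ (LinearMap.toSpanSingleton R M a) (fun r hr => ha r hr))

variable {I : Ideal R}

lemma V_zero_iff (A : ModuleCat.{u} R) (hA : Tors I A) : V I 0 A → ∀ a : A, a = 0 := by
  intro hV a
  obtain ⟨k, hk⟩ := hA a
  let π : (PP I k).complex.X 0 ⟶ QQ I k := (PP I k).π.f 0
  obtain ⟨l, h, ψ, hψ⟩ := V_use hV (π ≫ ofKilled I k A a hk) (by
    have := (PP I k).complex_d_comp_π_f_zero
    have h2 := congrArg (· ≫ ofKilled I k A a hk) this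
    exact (h2.trans zero_comp))
  let π' : (PP I l).complex.X 0 ⟶ QQ I l := (PP I l).π.f 0
  have hw : (gg I h).f 0 ≫ π = π' ≫ qq I h := gg_w I h
  have hz : (PP I l).complex.d 0 (0-1) = 0 := (PP I l).complex.shape _ _ (by simp)
  rw [← Category.assoc, hw, hz, zero_comp, Category.assoc] at hψ
  have : Epi π' := by
    change Epi ((PP I l).π.f 0)
    infer_instance
  have h3 : qq I h ≫ ofKilled I k A a hk = 0 := by
    rw [← cancel_epi π', hψ, comp_zero]
  have h4 := congrArg (fun f => f.hom (Submodule.Quotient.mk 1)) h3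
  have h5 : (qq I h ≫ ofKilled I k A a hk).hom (Submodule.Quotient.mk 1) = (1 : R) • a := rfl
  rw [one_smul] at h5
  exact h5.symm.trans h4

lemma tors_embed [IsNoetherianRing R] (T : ModuleCat.{u} R) (hT : Tors I T) :
    ∃ S : ShortComplex (ModuleCat.{u} R), S.ShortExact ∧ S.X₁ = T ∧ Injective S.X₂ ∧
      Tors I S.X₂ ∧ Tors I S.X₃ := by
  let E : ModuleCat.{u} R := Injective.under T
  let ι : T ⟶ E := Injective.ι T
  have hι : Function.Injective ι.hom := (ModuleCat.mono_iff_injective ι).1 inferInstance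
  have hEi : Injective (ModuleCat.of R E) := inferInstanceAs (Injective (Injective.under T))
  have : Module.Injective R E := Module.injective_module_of_injective_object R E
  have hG := gam_baer I E
  let E' : ModuleCat.{u} R := ModuleCat.of R (Gam I E)
  have hE' : Module.Injective R (Gam I E) := hG.injective
  have hE'' : Injective E' := Module.injective_object_of_injective_module R (Gam I E)
  let j : T →ₗ[R] Gam I E := LinearMap.codRestrict _ ι.hom (by
    intro x
    obtain ⟨k, hk⟩ := hT x
    exact ⟨k, fun r hr => by rw [← map_smul, hk r hr, map_zero]⟩)
  have hj : Function.Injective j := fun a b hab => hι (congrArg Subtype.val hab)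
  let q : Gam I E →ₗ[R] (Gam I E ⧸ LinearMap.range j) := (LinearMap.range j).mkQ
  refine ⟨ShortComplex.mk (X₂ := E') (X₃ := ModuleCat.of R (Gam I E ⧸ LinearMap.range j))
    (ModuleCat.ofHom j) (ModuleCat.ofHom q) ?_, ?_, rfl, hE'', ?_, ?_⟩
  · apply ConcreteCategory.hom_ext
    intro x
    exact (Submodule.Quotient.mk_eq_zero _).2 ⟨x, rfl⟩
  · refine @ShortComplex.ShortExact.mk _ _ _ _ ?_ ?_ ?_
    · rw [ShortComplex.moduleCat_exact_iff]
      intro x hx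
      exact (Submodule.Quotient.mk_eq_zero _).1 hx
    · exact (ModuleCat.mono_iff_injective _).2 hj
    · exact (ModuleCat.epi_iff_surjective _).2 (Submodule.mkQ_surjective _)
  · rintro ⟨x, k, hk⟩
    exact ⟨k, fun r hr => Subtype.ext (hk r hr)⟩
  · intro y
    obtain ⟨⟨x, k, hk⟩, rfl⟩ := Submodule.mkQ_surjective _ y
    refine ⟨k, fun r hr => ?_⟩
    rw [← map_smul]
    have : r • (⟨x, k, hk⟩ : Gam I E) = 0 := Subtype.ext (hk r hr)
    rw [this, map_zero]

lemma V_tors [IsNoetherianRing R] (i : ℕ) : ∀ (T : ModuleCat.{u} R), Tors I T → V I (i+1) T := by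
  induction i with
  | zero =>
    intro T hT
    obtain ⟨S, hS, rfl, hinj, h2, h3⟩ := tors_embed T hT
    have := hS.mono_f
    have := hS.epi_g
    apply V_of
    intro k φ hφ
    obtain ⟨l, h, ψ, hψ⟩ := V_use (V_inj (I := I) (i := 0) S.X₂) (φ ≫ S.f)
      (by rw [reassoc_of% hφ, zero_comp])
    change (PP I l).complex.X 0 ⟶ _ at ψ
    change _ = (PP I l).complex.d 1 0 ≫ ψ at hψ
    have hex := (PP I l).exact₀
    have hepi : Epi ((PP I l).π.f 0) := inferInstance
    obtain ⟨θ, hθ⟩ : ∃ θ : QQ I l ⟶ S.X₃, (PP I l).π.f 0 ≫ θ = ψ ≫ S.g :=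
      ShortComplex.Exact.desc' hex (ψ ≫ S.g) (by
      change (PP I l).complex.d 1 0 ≫ ψ ≫ S.g = 0
      rw [← reassoc_of% hψ, S.zero]; simp)
    obtain ⟨e, he⟩ := (ModuleCat.epi_iff_surjective S.g).1 inferInstance (θ.hom (Submodule.Quotient.mk 1))
    obtain ⟨p, hp⟩ := h2 e
    let p' := max l p
    have hlp : l ≤ p' := le_max_left _ _
    let χ : QQ I p' ⟶ S.X₂ := ofKilled I p' S.X₂ e (fun r hr => hp r (Ideal.pow_le_pow_right (le_max_right _ _) hr))
    have hχ : χ ≫ S.g = qq I hlp ≫ θ := by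
      apply ConcreteCategory.hom_ext
      intro x
      obtain ⟨x, rfl⟩ := Submodule.Quotient.mk_surjective _ x
      change S.g.hom (x • e) = θ.hom (Submodule.Quotient.mk x)
      rw [map_smul]
      have : (Submodule.Quotient.mk x : R ⧸ I ^ l) = x • Submodule.Quotient.mk 1 := by
        rw [← Submodule.Quotient.mk_smul, smul_eq_mul, mul_one]
      rw [this, map_smul]
      exact congrArg _ he
    let π' : (PP I p').complex.X 0 ⟶ QQ I p' := (PP I p').π.f 0
    let ξ := hS.exact.lift ((gg I hlp).f 0 ≫ ψ - π' ≫ χ) (by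
      rw [Preadditive.sub_comp, Category.assoc, Category.assoc, hχ, ← hθ]
      have := congrArg (· ≫ θ) (gg_w I hlp)
      exact sub_eq_zero.2 this)
    have hξ : ξ ≫ S.f = _ := hS.exact.lift_f _ _
    refine ⟨p', h.trans hlp, gg I hlp ≫ gg I h, gg_comp_w I h hlp, ξ, ?_⟩
    change _ = (PP I p').complex.d 1 0 ≫ ξ
    have hz : (PP I p').complex.d 1 0 ≫ π' = 0 := (PP I p').complex_d_comp_π_f_zero
    rw [← cancel_mono S.f, Category.assoc _ ξ, hξ, Preadditive.comp_sub, reassoc_of% hz, zero_comp,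
      sub_zero, HomologicalComplex.comp_f, Category.assoc, Category.assoc, hψ,
      HomologicalComplex.Hom.comm_assoc]
  | succ i ih =>
    intro T hT
    obtain ⟨S, hS, rfl, hinj, h2, h3⟩ := tors_embed T hT
    exact V_left hS (V_inj S.X₂) (ih _ h3)

end tors
end LCB
end

section
universe u
open CategoryTheory Limits Opposite

namespace LCB
section chase
variable {R : Type u} [CommRing R] {I : Ideal R}

/-- vanishing for plain modules -/
abbrev VM (I : Ideal R) (i : ℕ) (A : Type u) [AddCommGroup A] [Module R A] : Prop :=
  V I i (ModuleCat.of R A)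

section
variable {A B C : Type u} [AddCommGroup A] [Module R A] [AddCommGroup B] [Module R B]
  [AddCommGroup C] [Module R C] (f : A →ₗ[R] B) (g : B →ₗ[R] C)
  (h0 : ∀ a, g (f a) = 0) (hf : Function.Injective f) (hg : Function.Surjective g)
  (hx : ∀ b, g b = 0 → ∃ a, f a = b)

include h0 hf hg hx in
lemma ses : ∃ h, (ShortComplex.mk (ModuleCat.ofHom f) (ModuleCat.ofHom g) h).ShortExact := by
  refine ⟨ConcreteCategory.hom_ext _ _ (fun x => h0 x), ?_⟩
  refine @ShortComplex.ShortExact.mk _ _ _ _ ?_ ?_ ?_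
  · rw [ShortComplex.moduleCat_exact_iff]
    intro x hx'
    exact hx x hx'
  · exact (ModuleCat.mono_iff_injective _).2 hf
  · exact (ModuleCat.epi_iff_surjective _).2 hg

include f g h0 hf hg hx in
lemma VM_mid {i : ℕ} (h1 : VM I i A) (h3 : VM I i C) : VM I i B := by
  obtain ⟨_, h⟩ := ses f g h0 hf hg hx
  exact V_mid h h1 h3
include f g h0 hf hg hx in
lemma VM_left {i : ℕ} (h1 : VM I (i+1) B) (h3 : VM I i C) : VM I (i+1) A := by
  obtain ⟨_, h⟩ := ses f g h0 hf hg hx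
  exact V_left h h1 h3
include f g h0 hf hg hx in
lemma VM_right {i : ℕ} (h1 : VM I i B) (h3 : VM I (i+1) A) : VM I i C := by
  obtain ⟨_, h⟩ := ses f g h0 hf hg hx
  exact V_right h h1 h3
end

lemma VM_subsingleton {i : ℕ} {A : Type u} [AddCommGroup A] [Module R A] (h : ∀ a : A, a = 0) :
    VM I i A := by
  refine V_bij _ 0 (zero_mem _) ⟨fun a b _ => ?_, fun a => ⟨0, ?_⟩⟩
  · rw [h a, h b]
  · exact (h _).trans (h a).symm

lemma VM_equiv {i : ℕ} {A B : Type u} [AddCommGroup A] [Module R A] [AddCommGroup B] [Module R B]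
    (e : A ≃ₗ[R] B) (h : VM I i A) : VM I i B :=
  VM_mid (C := PUnit.{u+1}) e.toLinearMap 0 (fun _ => rfl) e.injective (fun _ => ⟨0, rfl⟩)
    (fun b _ => e.surjective b) h (VM_subsingleton (fun _ => rfl))

variable {M : Type u} [AddCommGroup M] [Module R M] (d : M →ₗ[R] M) (C : ℕ → Submodule R M)

/-- cocycles -/
def Zs (j : ℕ) : Submodule R M := C j ⊓ LinearMap.ker d
/-- boundaries in degree `j+1` -/
def Bs (j : ℕ) : Submodule R M := (C j).map d

section
variable {d C}

lemma ses1_mid {i j : ℕ} (h1 : VM I i (Zs d C j)) (h3 : VM I i (Bs d C j)) : VM I i (C j) :=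
  VM_mid (Submodule.inclusion inf_le_left) (d.submoduleMap (C j)) (fun a => Subtype.ext a.2.2)
    (Submodule.inclusion_injective _) (d.submoduleMap_surjective _)
    (fun b hb => ⟨⟨b, b.2, congrArg Subtype.val hb⟩, rfl⟩) h1 h3
lemma ses1_left {i j : ℕ} (h1 : VM I (i+1) (C j)) (h3 : VM I i (Bs d C j)) : VM I (i+1) (Zs d C j) :=
  VM_left (Submodule.inclusion inf_le_left) (d.submoduleMap (C j)) (fun a => Subtype.ext a.2.2)
    (Submodule.inclusion_injective _) (d.submoduleMap_surjective _)
    (fun b hb => ⟨⟨b, b.2, congrArg Subtype.val hb⟩, rfl⟩) h1 h3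
lemma ses1_right {i j : ℕ} (h1 : VM I i (C j)) (h3 : VM I (i+1) (Zs d C j)) : VM I i (Bs d C j) :=
  VM_right (Submodule.inclusion inf_le_left) (d.submoduleMap (C j)) (fun a => Subtype.ext a.2.2)
    (Submodule.inclusion_injective _) (d.submoduleMap_surjective _)
    (fun b hb => ⟨⟨b, b.2, congrArg Subtype.val hb⟩, rfl⟩) h1 h3

variable (hdC : ∀ j x, x ∈ C j → d x ∈ C (j+1)) (hdd : ∀ x, d (d x) = 0)
  (htors : ∀ j, ∀ z ∈ C (j+1), d z = 0 → ∃ k : ℕ, ∀ s ∈ I ^ k, ∃ y ∈ C j, d y = s • z)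

include hdC hdd in
lemma Bs_le (j : ℕ) : Bs d C j ≤ Zs d C (j+1) := by
  rintro _ ⟨x, hx, rfl⟩
  exact ⟨hdC j x hx, hdd x⟩

variable (d C) in
/-- cohomology in degree `j+1` -/
abbrev Hs (j : ℕ) : Type u := (Zs d C (j+1)) ⧸ (Submodule.comap (Zs d C (j+1)).subtype (Bs d C j))

include htors in
lemma Hs_tors (j : ℕ) : Tors I (Hs d C j) := by
  intro x
  obtain ⟨⟨z, hz, hz'⟩, rfl⟩ := Submodule.mkQ_surjective _ x
  obtain ⟨k, hk⟩ := htors j z hz hz'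
  refine ⟨k, fun s hs => ?_⟩
  rw [← map_smul, Submodule.mkQ_apply, Submodule.Quotient.mk_eq_zero]
  obtain ⟨y, hy, h⟩ := hk s hs
  exact ⟨y, hy, h⟩

section
variable {i j : ℕ}
include hdC hdd
lemma ses2_mid (h1 : VM I i (Bs d C j)) (h3 : VM I i (Hs d C j)) : VM I i (Zs d C (j+1)) :=
  VM_mid (Submodule.inclusion (Bs_le hdC hdd j)) (Submodule.mkQ (Submodule.comap (Zs d C (j+1)).subtype (Bs d C j)))
    (fun a => (Submodule.Quotient.mk_eq_zero _).2 a.2)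
    (Submodule.inclusion_injective _) (Submodule.mkQ_surjective _)
    (fun b hb => ⟨⟨b, (Submodule.Quotient.mk_eq_zero (Submodule.comap (Zs d C (j+1)).subtype (Bs d C j))).1 hb⟩, rfl⟩) h1 h3
lemma ses2_left (h1 : VM I (i+1) (Zs d C (j+1))) (h3 : VM I i (Hs d C j)) : VM I (i+1) (Bs d C j) :=
  VM_left (Submodule.inclusion (Bs_le hdC hdd j)) (Submodule.mkQ (Submodule.comap (Zs d C (j+1)).subtype (Bs d C j)))
    (fun a => (Submodule.Quotient.mk_eq_zero _).2 a.2)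
    (Submodule.inclusion_injective _) (Submodule.mkQ_surjective _)
    (fun b hb => ⟨⟨b, (Submodule.Quotient.mk_eq_zero (Submodule.comap (Zs d C (j+1)).subtype (Bs d C j))).1 hb⟩, rfl⟩) h1 h3
lemma ses2_right (h1 : VM I i (Zs d C (j+1))) (h3 : VM I (i+1) (Bs d C j)) : VM I i (Hs d C j) :=
  VM_right (Submodule.inclusion (Bs_le hdC hdd j)) (Submodule.mkQ (Submodule.comap (Zs d C (j+1)).subtype (Bs d C j)))
    (fun a => (Submodule.Quotient.mk_eq_zero _).2 a.2)
    (Submodule.inclusion_injective _) (Submodule.mkQ_surjective _)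
    (fun b hb => ⟨⟨b, (Submodule.Quotient.mk_eq_zero (Submodule.comap (Zs d C (j+1)).subtype (Bs d C j))).1 hb⟩, rfl⟩) h1 h3
end

variable (r : ℕ) (hr : ∀ x ∈ C (r+2), x = 0) (hC : ∀ i j, VM I i (C (j+1)))
  (hZ0 : ∀ x ∈ C 0, d x = 0 → x = 0)
include hdC hdd htors hr hC hZ0

/-- vanishing above the number of generators `r+1` -/
lemma chase_vanish [IsNoetherianRing R] (i : ℕ) (hi : r + 1 < i) : VM I i (C 0) := by
  have key : ∀ p j, p + j = r + 1 → ∀ i, p ≤ i → VM I (i + 1) (Bs d C j) := by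
    intro p
    induction p with
    | zero =>
      intro j hj i _
      refine VM_subsingleton ?_
      rintro ⟨_, x, hx, rfl⟩
      apply Subtype.ext
      exact hr _ (by have := hdC j x hx; rwa [show j + 1 = r + 2 by omega] at this)
    | succ p ih =>
      intro j hj i hi
      obtain ⟨i, rfl⟩ : ∃ i', i = i' + 1 := ⟨i - 1, by omega⟩
      refine ses2_left hdC hdd (ses1_left (hC _ _) ?_) (V_tors i _ (Hs_tors htors j))
      exact ih (j+1) (by omega) i (by omega)
  obtain ⟨i, rfl⟩ : ∃ i', i = i' + 1 := ⟨i - 1, by omega⟩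
  refine ses1_mid (VM_subsingleton ?_) (key (r+1) 0 (by omega) i (by omega))
  rintro ⟨x, hx, hx'⟩
  exact Subtype.ext (hZ0 x hx hx')

lemma chase_top [IsNoetherianRing R] (h : VM I (r+1) (C 0)) (z : M) (hz : z ∈ C (r+1)) :
    ∃ y ∈ C r, d y = z := by
  have key : ∀ j p, p + j = r → VM I (p + 1) (Bs d C j) := by
    intro j
    induction j with
    | zero =>
      intro p hp
      obtain rfl : p = r := by omega
      refine ses1_right h (VM_subsingleton ?_)
      rintro ⟨x, hx, hx'⟩
      exact Subtype.ext (hZ0 x hx hx')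
    | succ j ih =>
      intro p hp
      exact ses1_right (hC _ _) (ses2_mid hdC hdd (ih (p+1) (by omega)) (V_tors _ _ (Hs_tors htors j)))
  have h1 := key r 0 (by omega)
  have hZC : Zs d C (r+1) = C (r+1) := by
    refine le_antisymm inf_le_left (fun x hx => ⟨hx, ?_⟩)
    exact hr _ (hdC _ x hx)
  have h2 : VM I 0 (Hs d C r) := ses2_right hdC hdd (by rw [hZC]; exact hC 0 r) h1
  have h3 := V_zero_iff _ (Hs_tors htors r) h2 (Submodule.Quotient.mk ⟨z, by rw [hZC]; exact hz⟩)
  exact (Submodule.Quotient.mk_eq_zero _).1 h3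

end
end chase
end LCB
end

section
universe u v
set_option linter.unusedSectionVars false
set_option linter.unusedVariables false

/-- A ring `W` acting on the field `L ⊇ S`, containing `S` and preserving all localizations. -/
class WA (S : Type u) (L : Type u) (W : Type v) [CommRing S] [Field L] [Algebra S L] [Ring W]
    [Module W L] where
  j : S →+* W
  hj : ∀ s (x : L), j s • x = algebraMap S L s * x
  inj : ∀ s : S, algebraMap S L s = 0 → s = 0
  stab : ∀ (a : S) (r : W) (x : L), (∃ N : ℕ, ∃ s, algebraMap S L a ^ N * x = algebraMap S L s) →
    (∃ N : ℕ, ∃ s, algebraMap S L a ^ N * (r • x) = algebraMap S L s)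

namespace CH

variable {S L : Type u} {W : Type v} [CommRing S] [Field L] [Algebra S L] [Ring W] [Module W L]
  [hW : WA S L W]

/-- the localization at `a` inside `L` -/
def SS (S L : Type u) [CommRing S] [Field L] [Algebra S L] (a : S) : AddSubgroup L where
  carrier := {x | ∃ N : ℕ, ∃ s, algebraMap S L a ^ N * x = algebraMap S L s}
  zero_mem' := ⟨0, 0, by simp⟩
  add_mem' := by
    rintro x y ⟨N, s, hs⟩ ⟨M, r, hr⟩
    refine ⟨N + M, a ^ M * s + a ^ N * r, ?_⟩
    rw [map_add, map_mul, map_mul, ← hs, ← hr, map_pow, map_pow]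
    ring
  neg_mem' := by
    rintro x ⟨N, s, hs⟩
    exact ⟨N, -s, by rw [map_neg, ← hs]; ring⟩

lemma mem_SS {a : S} {x : L} : x ∈ SS S L a ↔ ∃ N : ℕ, ∃ s, algebraMap S L a ^ N * x = algebraMap S L s :=
  Iff.rfl

lemma SS_dvd {a b : S} {N : ℕ} (h : a ∣ b ^ N) : SS S L a ≤ SS S L b := by
  rintro x ⟨M, s, hs⟩
  obtain ⟨c, hc⟩ := h
  refine ⟨N * M, c ^ M * s, ?_⟩
  rw [map_mul, ← hs, pow_mul, ← map_pow, hc, map_mul, map_pow]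
  ring

variable (S L W) in
/-- complexes with an internal grading, indexed by `a : S` -/
structure Cx where
  M : Type u
  [ag : AddCommGroup M]
  [mod : Module W M]
  d : M →+ M
  G : S → ℤ → AddSubgroup M
  dG : ∀ {a i x}, x ∈ G a i → d x ∈ G a (i+1)
  mono : ∀ {a b : S} {N : ℕ} {i}, a ∣ b ^ N → G a i ≤ G b i
  stab : ∀ {a i x} (r : W), x ∈ G a i → r • x ∈ G a i
  clear : ∀ {a f i x}, x ∈ G (a * f) i → ∃ N : ℕ, hW.j f ^ N • x ∈ G a i
  div : ∀ {a b : S} {N : ℕ} {i x}, b ≠ 0 → b ∣ a ^ N → x ∈ G a i → ∃ y ∈ G a i, hW.j b • y = x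
  inj : ∀ {a : S} {x : M}, a ≠ 0 → hW.j a • x = 0 → x = 0
  neg : ∀ {a i x}, i < 0 → x ∈ G a i → x = 0

attribute [instance] Cx.ag Cx.mod

variable (S L W) in
/-- the base complex -/
def base : Cx S L W where
  M := L
  d := 0
  G := fun a i => if i = 0 then SS S L a else ⊥
  dG := by intro a i x _; simp only [AddMonoidHom.zero_apply]; exact zero_mem _
  mono := by
    intro a b N i h
    by_cases hi : i = 0
    · simp only [hi, if_true]; exact SS_dvd h
    · simp [hi]
  stab := by
    intro a i x r hx
    by_cases hi : i = 0
    · simp only [hi, if_true] at hx ⊢; exact hW.stab a r x hx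
    · simp only [hi, if_false, AddSubgroup.mem_bot] at hx ⊢; rw [hx, smul_zero]
  clear := by
    intro a f i x hx
    by_cases hi : i = 0
    · simp only [hi, if_true] at hx ⊢
      obtain ⟨N, s, hs⟩ := hx
      refine ⟨N, N, s, ?_⟩
      rw [← map_pow (hW.j), hW.hj, ← hs, map_pow, map_mul]; ring
    · simp only [hi, if_false, AddSubgroup.mem_bot] at hx ⊢; exact ⟨0, by rw [hx, smul_zero]⟩
  div := by
    intro a b N i x hb hab hx
    have ha' : algebraMap S L b ≠ 0 := fun h => hb (hW.inj b h)
    by_cases hi : i = 0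
    · simp only [hi, if_true] at hx ⊢
      obtain ⟨M, s, hs⟩ := hx
      obtain ⟨c, hc⟩ := hab
      refine ⟨(algebraMap S L b)⁻¹ * x, ⟨N + M, c * s, ?_⟩, ?_⟩
      · rw [map_mul, ← hs, pow_add, ← map_pow, hc, map_mul]; field_simp
      · rw [hW.hj]; field_simp
    · simp only [hi, if_false, AddSubgroup.mem_bot] at hx ⊢; exact ⟨0, rfl, by rw [hx, smul_zero]⟩
  inj := by
    intro a x ha hx
    have ha' : algebraMap S L a ≠ 0 := fun h => ha (hW.inj a h)
    rw [hW.hj] at hx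
    exact (mul_eq_zero.1 hx).resolve_left ha'
  neg := by
    intro a i x hi hx
    simpa [hi.ne] using hx

/-- multiplication by `r` as an additive map -/
abbrev sm (C : Cx S L W) (r : W) : C.M →+ C.M := (DistribSMul.toAddMonoidHom C.M r)

/-- the fibre of `r : C → C[f⁻¹]` -/
def fib (r : W) (f : S) (C : Cx S L W) : Cx S L W where
  M := C.M × C.M
  d := (C.d.comp (AddMonoidHom.fst _ _)).prod
    ((sm C r).comp (AddMonoidHom.fst _ _) - C.d.comp (AddMonoidHom.snd _ _))
  G := fun a i => (C.G a i).prod (C.G (a * f) (i - 1))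
  dG := by
    rintro a i ⟨x, y⟩ ⟨hx, hy⟩
    refine ⟨C.dG hx, ?_⟩
    refine AddSubgroup.sub_mem (C.G (a * f) (i + 1 - 1)) (C.stab r ?_) ?_
    · rw [add_sub_cancel_right]; exact C.mono (N := 1) ⟨f, by simp⟩ hx
    · have := C.dG hy
      rwa [show i - 1 + 1 = i + 1 - 1 by ring] at this
  mono := by
    rintro a b N i h ⟨x, y⟩ ⟨hx, hy⟩
    refine ⟨C.mono h hx, C.mono (N := N + 1) ?_ hy⟩
    rw [mul_pow, pow_succ f]
    exact mul_dvd_mul (h.trans (pow_dvd_pow _ (by omega))) (Dvd.intro_left _ rfl)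
  stab := by
    rintro a i ⟨x, y⟩ r ⟨hx, hy⟩
    exact ⟨C.stab r hx, C.stab r hy⟩
  clear := by
    rintro a g i ⟨x, y⟩ ⟨hx, hy⟩
    obtain ⟨N, hN⟩ := C.clear hx
    dsimp only at hy
    rw [show a * g * f = (a * f) * g by ring] at hy
    obtain ⟨N', hN'⟩ := C.clear hy
    refine ⟨N + N', ?_, ?_⟩
    · change hW.j g ^ (N + N') • x ∈ _
      rw [add_comm, pow_add, mul_smul]
      exact C.stab _ hN
    · change hW.j g ^ (N + N') • y ∈ _
      rw [pow_add, mul_smul]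
      exact C.stab _ hN'
  div := by
    rintro a b N i ⟨x, y⟩ hb hab ⟨hx, hy⟩
    obtain ⟨x', hx', rfl⟩ := C.div hb hab hx
    obtain ⟨y', hy', rfl⟩ := C.div hb (a := a * f) (N := N) (by rw [mul_pow]; exact hab.mul_right _) hy
    exact ⟨(x', y'), ⟨hx', hy'⟩, rfl⟩
  inj := by
    rintro a ⟨x, y⟩ ha hx
    exact Prod.ext (C.inj ha (congrArg Prod.fst hx)) (C.inj ha (congrArg Prod.snd hx))
  neg := by
    rintro a i ⟨x, y⟩ hi ⟨hx, hy⟩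
    exact Prod.ext (C.neg hi hx) (C.neg (by omega) hy)


lemma fib_d (r : W) (f : S) (C : Cx S L W) (x y : C.M) :
    (fib r f C).d (x, y) = (C.d x, r • x - C.d y) := rfl

lemma fib_G {r : W} {f : S} {C : Cx S L W} {a : S} {i : ℤ} {x y : C.M} :
    ((x, y) : C.M × C.M) ∈ (fib r f C).G a i ↔ x ∈ C.G a i ∧ y ∈ C.G (a * f) (i - 1) := Iff.rfl

/-- exactness -/
def Ex (C : Cx S L W) (a : S) (i : ℤ) : Prop :=
  ∀ x ∈ C.G a i, C.d x = 0 → ∃ y ∈ C.G a (i - 1), C.d y = x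

lemma L1 {r : W} {f : S} {C : Cx S L W} {a : S} {i : ℤ} (hr : ∀ x, C.d (r • x) = r • C.d x)
    (h1 : Ex C a i) (h2 : Ex C (a * f) (i - 1)) : Ex (fib r f C) a i := by
  rintro ⟨x, y⟩ ⟨hx, hy⟩ hd
  rw [fib_d] at hd
  have hd1 : C.d x = 0 := congrArg Prod.fst hd
  have hd2 : r • x - C.d y = 0 := congrArg Prod.snd hd
  obtain ⟨x', hx', rfl⟩ := h1 x hx hd1
  obtain ⟨y', hy', hyy⟩ := h2 (r • x' - y)
    (AddSubgroup.sub_mem _ (C.stab r (C.mono (N := 1) ⟨f, by simp⟩ hx')) hy)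
    (by rw [map_sub, hr, hd2])
  exact ⟨(x', y'), ⟨hx', hy'⟩, by rw [fib_d, hyy, sub_sub_cancel]⟩

lemma L2 {f : S} {C : Cx S L W} {a : S} {i : ℤ}
    (h1 : Ex (fib 1 f C) a i) (h2 : Ex C (a * f) i) : Ex C a i := by
  intro z hz hd
  obtain ⟨y, hy, hyz⟩ := h2 z (C.mono (N := 1) ⟨f, by simp⟩ hz) hd
  obtain ⟨⟨x', y'⟩, ⟨hx', hy'⟩, hxy⟩ := h1 (z, y) ⟨hz, hy⟩ (by
    rw [fib_d, hd, hyz, one_smul, sub_self]; rfl)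
  exact ⟨x', hx', congrArg Prod.fst hxy⟩

/-- total complex of a list -/
def tot : List (W × S) → Cx S L W
  | [] => base S L W
  | p :: l => fib p.1 p.2 (tot l)

/-- commutation -/
lemma tot_comm (l : List (W × S)) (r : W) (hr : ∀ p ∈ l, Commute p.1 r) (x : (tot (L := L) l).M) :
    (tot l).d (r • x) = r • (tot l).d x := by
  induction l with
  | nil => exact (smul_zero (A := L) r).symm
  | cons p l ih =>
    have ih' := fun y => ih (fun q hq => hr q (List.mem_cons_of_mem _ hq)) y
    obtain ⟨x, y⟩ := x
    change (fib p.1 p.2 (tot l)).d (r • x, r • y) = r • (fib p.1 p.2 (tot l)).d (x, y)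
    rw [fib_d, fib_d, ih', ih']
    have := (hr p (by simp))
    refine Prod.ext rfl ?_
    change p.1 • r • x - r • _ = r • (p.1 • x - _)
    rw [smul_sub, ← mul_smul, ← mul_smul, this.eq]

/-- isomorphism of complexes -/
structure CIso (C D : Cx S L W) where
  e : C.M ≃+ D.M
  lin : ∀ (r : W) x, e (r • x) = r • e x
  comm : ∀ x, e (C.d x) = D.d (e x)
  hG : ∀ a i x, e x ∈ D.G a i ↔ x ∈ C.G a i

def CIso.refl (C : Cx S L W) : CIso C C := ⟨AddEquiv.refl _, fun _ _ => rfl, fun _ => rfl, fun _ _ _ => Iff.rfl⟩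

def CIso.trans {C D E : Cx S L W} (f : CIso C D) (g : CIso D E) : CIso C E :=
  ⟨f.e.trans g.e, fun r x => by simp [f.lin, g.lin], fun x => by simp [f.comm, g.comm],
    fun a i x => by simp [g.hG, f.hG]⟩

def CIso.cons {C D : Cx S L W} (φ : CIso C D) (r : W) (f : S) : CIso (fib r f C) (fib r f D) where
  e := AddEquiv.prodCongr φ.e φ.e
  lin := fun s x => Prod.ext (φ.lin s x.1) (φ.lin s x.2)
  comm := by
    rintro ⟨x, y⟩
    refine Prod.ext (φ.comm x) ?_
    change φ.e (r • x - C.d y) = r • φ.e x - D.d (φ.e y)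
    rw [map_sub, φ.lin, φ.comm]
  hG := by
    rintro a i ⟨x, y⟩
    exact and_congr (φ.hG _ _ _) (φ.hG _ _ _)

/-- the swap isomorphism -/
def CIso.swap (C : Cx S L W) (r s : W) (f g : S) :
    CIso (fib r f (fib s g C)) (fib s g (fib r f C)) where
  e :=
    { toFun := fun x => ((x.1.1, x.2.1), (x.1.2, -x.2.2))
      invFun := fun x => ((x.1.1, x.2.1), (x.1.2, -x.2.2))
      left_inv := by rintro ⟨⟨x, y⟩, ⟨z, w⟩⟩; simp; rfl
      right_inv := by rintro ⟨⟨x, y⟩, ⟨z, w⟩⟩; simp; rfl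
      map_add' := by
        rintro ⟨⟨x, y⟩, ⟨z, w⟩⟩ ⟨⟨x', y'⟩, ⟨z', w'⟩⟩
        change (((_, _), (_, -(w + w'))) : (C.M × C.M) × (C.M × C.M)) = ((_, _), (_, -w + -w'))
        rw [neg_add]; rfl }
  lin := by
    rintro t ⟨⟨x, y⟩, ⟨z, w⟩⟩
    change (((_, _), (_, -(t • w))) : (C.M × C.M) × (C.M × C.M)) = ((_, _), (_, t • (-w)))
    rw [smul_neg]; rfl
  comm := by
    rintro ⟨⟨x, y⟩, ⟨z, w⟩⟩
    change (((C.d x, r • x - C.d z), (s • x - C.d y, -(r • y - (s • z - C.d w)))) :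
      (C.M × C.M) × (C.M × C.M)) = ((C.d x, r • x - C.d z), (s • x - C.d y, s • z - (r • y - C.d (-w))))
    rw [map_neg]
    congr 2
    abel
  hG := by
    rintro a i ⟨⟨x, y⟩, ⟨z, w⟩⟩
    change ((x ∈ C.G a i ∧ z ∈ C.G (a * f) (i-1)) ∧ (y ∈ C.G (a * g) (i - 1) ∧ -w ∈ C.G (a * g * f) (i-1-1))) ↔
      ((x ∈ C.G a i ∧ y ∈ C.G (a * g) (i-1)) ∧ (z ∈ C.G (a * f) (i - 1) ∧ w ∈ C.G (a * f * g) (i-1-1)))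
    rw [neg_mem_iff, mul_right_comm]
    tauto

lemma CIso.ex {C D : Cx S L W} (φ : CIso C D) {a : S} {i : ℤ} (h : Ex D a i) : Ex C a i := by
  intro x hx hd
  obtain ⟨y, hy, hyx⟩ := h (φ.e x) ((φ.hG _ _ _).2 hx) (by rw [← φ.comm, hd, map_zero])
  obtain ⟨y, rfl⟩ := φ.e.surjective y
  exact ⟨y, (φ.hG _ _ _).1 hy, φ.e.injective (by rw [φ.comm, hyx])⟩

lemma tot_perm {l l' : List (W × S)} (h : l.Perm l') : Nonempty (CIso (tot (L := L) l) (tot l')) := by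
  induction h with
  | nil => exact ⟨CIso.refl _⟩
  | cons p _ ih => obtain ⟨φ⟩ := ih; exact ⟨φ.cons p.1 p.2⟩
  | swap p q l => exact ⟨CIso.swap _ _ _ _ _⟩
  | trans _ _ ih1 ih2 => obtain ⟨φ⟩ := ih1; obtain ⟨ψ⟩ := ih2; exact ⟨φ.trans ψ⟩

/-- exactness of the total complex -/
def E (L : Type u) {S : Type u} {W : Type v} [CommRing S] [Field L] [Algebra S L] [Ring W] [Module W L]
    [hW : WA S L W] (l : List (W × S)) (a : S) (i : ℤ) : Prop := Ex (tot (L := L) l) a i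

lemma E_perm {l l' : List (W × S)} (h : l.Perm l') {a : S} {i : ℤ} : E L l a i ↔ E L l' a i := by
  obtain ⟨φ⟩ := tot_perm (L := L) h
  obtain ⟨ψ⟩ := tot_perm (L := L) h.symm
  exact ⟨ψ.ex, φ.ex⟩

/-- pure list -/
def pu (W : Type v) [Ring W] (fs : List S) : List (W × S) := fs.map (fun f => (1, f))
/-- operator list -/
def op (S : Type u) [CommRing S] (rs : List W) : List (W × S) := rs.map (fun r => (r, 1))

lemma pu_comm (fs : List S) (r : W) : ∀ p ∈ pu W fs, Commute p.1 r := by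
  intro p hp
  obtain ⟨f, _, rfl⟩ := List.mem_map.1 hp
  exact Commute.one_left r

lemma pu_d (fs : List S) (r : W) (x : (tot (L := L) (pu W fs)).M) :
    (tot (pu W fs)).d (r • x) = r • (tot (pu W fs)).d x := tot_comm _ _ (pu_comm fs r) x

/-- linearity of the differential -/
def Lin (C : Cx S L W) : Prop := ∀ (r : W) x, C.d (r • x) = r • C.d x

/-- a power of `f` kills cohomology -/
def Kl (C : Cx S L W) (f : S) : Prop := ∀ (a : S) (i : ℤ), ∀ z ∈ C.G a i, C.d z = 0 →
    ∃ N : ℕ, ∃ y ∈ C.G a (i-1), C.d y = hW.j f ^ N • z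

lemma Kl_head {C : Cx S L W} (hC : Lin C) (f : S) : Kl (fib 1 f C) f := by
  rintro a i ⟨x, y⟩ ⟨hx, hy⟩ hd
  rw [fib_d, one_smul] at hd
  have hd2 : x - C.d y = 0 := congrArg Prod.snd hd
  obtain ⟨N, hN⟩ := C.clear hy
  refine ⟨N, (hW.j f ^ N • y, 0), ⟨hN, zero_mem _⟩, ?_⟩
  rw [fib_d, hC, map_zero, sub_zero, one_smul, ← sub_eq_zero.1 hd2]
  rfl

lemma Kl_tail {C : Cx S L W} (hC : Lin C) (f g : S) (ih : Kl C f) : Kl (fib 1 g C) f := by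
  rintro a i ⟨x, y⟩ ⟨hx, hy⟩ hd
  rw [fib_d, one_smul] at hd
  have hd1 : C.d x = 0 := congrArg Prod.fst hd
  have hd2 : x - C.d y = 0 := congrArg Prod.snd hd
  obtain ⟨N, x', hx', hxx⟩ := ih a i x hx hd1
  obtain ⟨M, w, hw, hww⟩ := ih (a * g) (i - 1) (hW.j f ^ N • y - x')
    (AddSubgroup.sub_mem _ (Cx.stab _ _ hy) (Cx.mono _ (N := 1) ⟨g, by simp⟩ hx')) (by
      rw [map_sub, hC, hxx, ← smul_sub, ← sub_eq_zero.1 hd2, sub_self, smul_zero])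
  refine ⟨M + N, (hW.j f ^ M • x', -w), ⟨Cx.stab _ _ hx', AddSubgroup.neg_mem _ hw⟩, ?_⟩
  rw [fib_d, hC, hxx, map_neg, hww, pow_add, smul_sub, one_smul]
  refine Prod.ext ?_ ?_
  · exact (mul_smul _ _ _).symm
  · change hW.j f ^ M • x' - -(hW.j f ^ M • hW.j f ^ N • y - hW.j f ^ M • x') = (hW.j f ^ M * hW.j f ^ N) • y
    rw [mul_smul]
    abel

lemma pu_lin (fs : List S) : Lin (tot (L := L) (pu W fs)) := pu_d fs

lemma L3a (fs : List S) (f : S) (hf : f ∈ fs) : Kl (tot (L := L) (pu W fs)) f := by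
  induction fs with
  | nil => simp at hf
  | cons g fs ih =>
    by_cases hfg : f = g
    · subst hfg
      exact Kl_head (pu_lin fs) f
    · have hf' : f ∈ fs := by
        rcases List.mem_cons.1 hf with h | h
        · exact absurd h hfg
        · exact h
      exact Kl_tail (pu_lin fs) f g (ih hf')

lemma L3 (fs : List S) (a : S) (ha : a ≠ 0) (N : ℕ) (h : a ^ N ∈ Ideal.span {f | f ∈ fs}) (i : ℤ) :
    E L (pu W fs) a i := by
  intro z hz hd
  -- the ideal of elements killing z
  let J : Ideal S :=
    { carrier := {s | ∃ y ∈ (tot (L := L) (pu W fs)).G a (i-1), (tot (pu W fs)).d y = hW.j s • z}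
      zero_mem' := ⟨0, zero_mem _, by simp⟩
      add_mem' := by
        rintro s t ⟨y, hy, h⟩ ⟨y', hy', h'⟩
        exact ⟨y + y', add_mem hy hy', by rw [map_add, h, h', map_add, add_smul]⟩
      smul_mem' := by
        rintro c s ⟨y, hy, h⟩
        exact ⟨hW.j c • y, Cx.stab _ _ hy, by rw [pu_d, h, smul_eq_mul, map_mul, mul_smul]⟩ }
  have hJ : Ideal.span {f | f ∈ fs} ≤ J.radical := by
    rw [Ideal.span_le]
    intro f hf
    obtain ⟨M, y, hy, h⟩ := L3a (L := L) (W := W) fs f hf a i z hz hd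
    exact ⟨M, y, hy, by rw [map_pow]; exact h⟩
  obtain ⟨M, y, hy, hyz⟩ := hJ h
  have hb : (a ^ N) ^ M ≠ 0 := by
    intro h0
    have : algebraMap S L a ^ (N * M) = 0 := by rw [← map_pow, pow_mul, h0, map_zero]
    exact ha (hW.inj _ (eq_zero_of_pow_eq_zero this))
  obtain ⟨y', hy', rfl⟩ := Cx.div _ (a := a) (b := (a ^ N) ^ M) (N := N * M) hb (by rw [pow_mul]) hy
  refine ⟨y', hy', ?_⟩
  rw [pu_d, ← sub_eq_zero, ← smul_sub] at hyz
  exact sub_eq_zero.1 (Cx.inj _ hb hyz)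

lemma E_op1 {l : List (W × S)} {r : W} (hr : ∀ p ∈ l, Commute p.1 r) {a : S} {i : ℤ}
    (h1 : E L l a i) (h2 : E L l a (i - 1)) : E L ((r, 1) :: l) a i :=
  L1 (fun x => tot_comm l r hr x) h1 (by rw [mul_one]; exact h2)

lemma E_ops (rs : List W) (hrs : rs.Pairwise Commute) (fs : List S) (a : S)
    (h : ∀ i, E L (pu W fs) a i) : ∀ i, E L (op S rs ++ pu W fs) a i := by
  induction rs with
  | nil => exact h
  | cons r rs ih =>
    intro i
    rw [List.pairwise_cons] at hrs
    have := ih hrs.2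
    refine E_op1 ?_ (this i) (this _)
    intro p hp
    rcases List.mem_append.1 hp with hp | hp
    · obtain ⟨s, hs, rfl⟩ := List.mem_map.1 hp
      exact (hrs.1 s hs).symm
    · exact pu_comm fs r p hp

lemma E_add (l : List (W × S)) (g a : S) (h : ∀ i, E L l (a * g) i) (i : ℤ) :
    E L ((1, g) :: l) a i ↔ E L l a i :=
  ⟨fun h1 => L2 h1 (h i), fun h1 => L1 (fun x => by rw [one_smul, one_smul]) h1 (h _)⟩

lemma rad_le [IsDomain S] (rs : List W) (hrs : rs.Pairwise Commute) (fs gs : List S) (a : S) (ha : a ≠ 0)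
    (hg : ∀ g ∈ gs, g ≠ 0 ∧ a * g ∈ (Ideal.span {f | f ∈ fs}).radical) (i : ℤ) :
    E L (op S rs ++ pu W (gs ++ fs)) a i ↔ E L (op S rs ++ pu W fs) a i := by
  induction gs with
  | nil => rfl
  | cons g gs ih =>
    rw [← ih (fun g' hg' => hg g' (List.mem_cons_of_mem _ hg'))]
    obtain ⟨hg0, N, hN⟩ := hg g (by simp)
    rw [E_perm (l' := (1, g) :: (op S rs ++ pu W (gs ++ fs)))]
    · refine E_add _ g a ?_ i
      apply E_ops _ hrs
      refine L3 _ _ (mul_ne_zero ha hg0) N ?_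
      refine Ideal.span_mono ?_ hN
      intro f hf
      exact List.mem_append_right _ hf
    · exact List.perm_middle

lemma rad_change [IsDomain S] (rs : List W) (hrs : rs.Pairwise Commute) (fs gs : List S) (a : S) (ha : a ≠ 0)
    (hf : ∀ f ∈ fs, f ≠ 0 ∧ a * f ∈ (Ideal.span {f | f ∈ gs}).radical)
    (hg : ∀ g ∈ gs, g ≠ 0 ∧ a * g ∈ (Ideal.span {f | f ∈ fs}).radical) (i : ℤ) :
    E L (op S rs ++ pu W gs) a i ↔ E L (op S rs ++ pu W fs) a i := by
  rw [← rad_le rs hrs fs gs a ha hg, ← rad_le rs hrs gs fs a ha hf]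
  apply E_perm
  exact List.Perm.append_left _ (List.perm_append_comm.map _)

lemma tot_high (l : List (W × S)) : ∀ {a : S} {i : ℤ} {x : (tot (L := L) l).M}, (l.length : ℤ) < i →
    x ∈ (tot l).G a i → x = 0 := by
  induction l with
  | nil =>
    intro a i x hi hx
    have hx' : x ∈ (if i = 0 then SS S L a else ⊥) := hx
    have : i ≠ 0 := by simp at hi; omega
    rw [if_neg this] at hx'
    exact (AddSubgroup.mem_bot (G := L)).1 hx'
  | cons p l ih =>
    rintro a i ⟨x, y⟩ hi ⟨hx, hy⟩
    rw [List.length_cons] at hi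
    push_cast at hi
    exact Prod.ext (ih (by omega) hx) (ih (by omega) hy)

lemma E_high (l : List (W × S)) {a : S} {i : ℤ} (hi : (l.length : ℤ) < i) : E L l a i := by
  intro x hx _
  rw [tot_high l hi hx]
  exact ⟨0, zero_mem _, map_zero _⟩

/-- product of the second components -/
def pr (l : List (W × S)) : S := (l.map Prod.snd).prod

/-- top boundaries -/
def Bd (L : Type u) {S : Type u} {W : Type v} [CommRing S] [Field L] [Algebra S L] [Ring W] [Module W L] :
    List (W × S) → S → AddSubgroup L
  | [], _ => ⊥
  | p :: l, a => (SS S L (a * pr l)).map (DistribSMul.toAddMonoidHom L p.1) ⊔ Bd L l (a * p.2)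

/-- embedding of the top -/
def emb : (l : List (W × S)) → L →+ (tot (L := L) l).M
  | [] => AddMonoidHom.id L
  | p :: l => (AddMonoidHom.inr (tot (L := L) l).M (tot (L := L) l).M).comp (emb l)

lemma emb_cons (p : W × S) (l : List (W × S)) (x : L) :
    emb (p :: l) x = ((0, emb l x) : (tot (L := L) l).M × (tot (L := L) l).M) := rfl

lemma emb_inj (l : List (W × S)) : Function.Injective (emb (L := L) l) := by
  induction l with
  | nil => exact fun a b h => h
  | cons p l ih => exact fun a b h => ih (congrArg Prod.snd h)

lemma emb_smul (l : List (W × S)) (r : W) (x : L) : emb l (r • x) = r • emb l x := by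
  induction l with
  | nil => rfl
  | cons p l ih =>
    rw [emb_cons, emb_cons, ih]
    exact Prod.ext (smul_zero (A := (tot (L := L) l).M) r).symm rfl

lemma mem_top (l : List (W × S)) : ∀ {a : S} {z : (tot (L := L) l).M},
    z ∈ (tot l).G a l.length ↔ ∃ x ∈ SS S L (a * pr l), emb l x = z := by
  induction l with
  | nil =>
    intro a z
    have : z ∈ (tot (L := L) ([] : List (W × S))).G a (([] : List (W × S)).length) ↔ z ∈ SS S L a := by
      change z ∈ (if ((([] : List (W × S)).length : ℤ) = 0) then SS S L a else ⊥) ↔ _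
      simp
    rw [this]
    simp only [pr, List.map_nil, List.prod_nil, mul_one]
    constructor
    · intro h; exact ⟨z, h, rfl⟩
    · rintro ⟨x, hx, rfl⟩; exact hx
  | cons p l ih =>
    rintro a ⟨z, w⟩
    have hp : a * pr (p :: l) = a * p.2 * pr l := by simp [pr, mul_assoc]
    have hl : (((p :: l).length : ℤ) - 1) = l.length := by simp
    rw [hp]
    constructor
    · rintro ⟨hz, hw⟩
      have hz' : z = 0 := tot_high l (by simp) hz
      subst hz'
      have hw' : w ∈ (tot (L := L) l).G (a * p.2) ((p :: l).length - 1) := hw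
      rw [hl] at hw'
      obtain ⟨x, hx, rfl⟩ := ih.1 hw'
      exact ⟨x, hx, rfl⟩
    · rintro ⟨x, hx, h⟩
      rw [emb_cons] at h
      have h1 : 0 = z := congrArg Prod.fst h
      have h2 : emb l x = w := congrArg Prod.snd h
      subst h1 h2
      refine ⟨zero_mem _, ?_⟩
      change emb l x ∈ (tot (L := L) l).G (a * p.2) ((p :: l).length - 1)
      rw [hl]
      exact ih.2 ⟨x, hx, rfl⟩

lemma bd_iff (l : List (W × S)) : ∀ {a : S} {x : L},
    (∃ y ∈ (tot l).G a (l.length - 1), (tot l).d y = emb l x) ↔ x ∈ Bd L l a := by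
  induction l with
  | nil =>
    intro a x
    simp only [Bd, AddSubgroup.mem_bot]
    constructor
    · rintro ⟨y, _, h⟩; exact h.symm
    · rintro rfl; exact ⟨0, zero_mem _, by simp⟩
  | cons p l ih =>
    intro a x
    have hl : (((p :: l).length : ℤ) - 1) = l.length := by simp
    rw [hl]
    simp only [Bd, AddSubgroup.mem_sup]
    constructor
    · rintro ⟨⟨y, z⟩, ⟨hy, hz⟩, h⟩
      change (fib p.1 p.2 (tot l)).d (y, z) = _ at h
      rw [fib_d, emb_cons] at h
      have h2 : p.1 • y - (tot l).d z = emb l x := congrArg Prod.snd h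
      obtain ⟨y', hy', rfl⟩ := (mem_top l).1 hy
      refine ⟨p.1 • y', ⟨y', hy', rfl⟩, x - p.1 • y', ?_, by abel⟩
      rw [← ih]
      refine ⟨-z, neg_mem hz, ?_⟩
      rw [map_neg, map_sub, emb_smul, ← h2]
      abel
    · rintro ⟨_, ⟨y, hy, rfl⟩, w, hw, rfl⟩
      obtain ⟨z, hz, h⟩ := ih.2 hw
      refine ⟨(emb l y, -z), ⟨(mem_top l).2 ⟨y, hy, rfl⟩, AddSubgroup.neg_mem _ hz⟩, ?_⟩
      change (fib p.1 p.2 (tot l)).d _ = _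
      rw [fib_d, map_neg, h, emb_cons]
      refine Prod.ext ?_ ?_
      · exact tot_high l (by simp) (Cx.dG _ ((mem_top l).2 ⟨y, hy, rfl⟩))
      · change p.1 • emb l y - -emb l w = emb l (p.1 • y + w)
        rw [map_add, emb_smul]; abel

lemma top_iff (l : List (W × S)) (a : S) : E L l a l.length ↔ SS S L (a * pr l) ≤ Bd L l a := by
  constructor
  · intro h x hx
    have hm := (mem_top l).2 ⟨x, hx, rfl⟩
    rw [← bd_iff]
    exact h _ hm (tot_high l (lt_add_one _) (Cx.dG _ hm))
  · intro h z hz _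
    obtain ⟨x, hx, rfl⟩ := (mem_top l).1 hz
    exact (bd_iff l).2 (h hx)

end CH
end

section
universe u
open CategoryTheory Limits Opposite

namespace CH
open LCB
variable {S : Type u} [CommRing S] [IsDomain S]

noncomputable instance waSelf : WA S (FractionRing S) S where
  j := RingHom.id S
  hj := fun s x => Algebra.smul_def s x
  inj := fun s h => (IsFractionRing.injective S (FractionRing S)) (by rw [h, map_zero])
  stab := by
    rintro a r x ⟨N, s, hs⟩
    refine ⟨N, r * s, ?_⟩
    rw [map_mul, ← hs, Algebra.smul_def]; ring

lemma fib_dd {L : Type u} {W : Type*} [Field L] [Algebra S L] [Ring W] [Module W L]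
    [hW : WA S L W] (C : Cx S L W) (f : S) (h : ∀ x, C.d (C.d x) = 0) (x : (fib 1 f C).M) :
    (fib 1 f C).d ((fib 1 f C).d x) = 0 := by
  obtain ⟨x, y⟩ := x
  refine Prod.ext (h x) ?_
  change (1 : W) • C.d x - C.d ((1 : W) • x - C.d y) = 0
  rw [map_sub, h y, one_smul, one_smul, sub_zero, sub_self]

lemma tot_dd {L : Type u} {W : Type*} [Field L] [Algebra S L] [Ring W] [Module W L]
    [hW : WA S L W] (fs : List S) (x : (tot (L := L) (pu W fs)).M) :
    (tot (L := L) (pu W fs)).d ((tot (L := L) (pu W fs)).d x) = 0 := by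
  induction fs with
  | nil => rfl
  | cons f fs ih => exact fib_dd _ f ih x

noncomputable abbrev TT (fs : List S) : Cx S (FractionRing S) S := tot (pu S fs)

/-- graded pieces as submodules -/
def GS (C : Cx S (FractionRing S) S) (a : S) (j : ℤ) : Submodule S C.M where
  carrier := C.G a j
  add_mem' := fun h1 h2 => add_mem h1 h2
  zero_mem' := zero_mem _
  smul_mem' := fun r _ h => C.stab r h

lemma V_GS_bij {I : Ideal S} (C : Cx S (FractionRing S) S) (a b : S) (N : ℕ) (hb : b ∈ I) (hb0 : b ≠ 0)
    (hab : b ∣ a ^ N) (i : ℕ) (j : ℤ) : VM I i (GS C a j) := by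
  refine V_bij _ b hb ⟨?_, ?_⟩
  · intro x y hxy
    apply Subtype.ext
    rw [← sub_eq_zero]
    refine C.inj hb0 ?_
    have : b • (x : C.M) = b • (y : C.M) := congrArg Subtype.val hxy
    change b • ((x : C.M) - y) = 0
    rw [smul_sub, this, sub_self]
  · rintro ⟨x, hx⟩
    obtain ⟨y, hy, h⟩ := C.div hb0 hab hx
    exact ⟨⟨y, hy⟩, Subtype.ext h⟩

lemma V_GS {I : Ideal S} (fs : List S) : (∀ f ∈ fs, f ∈ I ∧ f ≠ 0) → ∀ (i : ℕ) (a : S) (j : ℤ), 1 ≤ j →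
    VM I i (GS (TT fs) a j) := by
  induction fs with
  | nil =>
    intro _ i a j hj
    refine VM_subsingleton ?_
    rintro ⟨x, hx⟩
    exact Subtype.ext (tot_high _ (by simp only [pu, List.map_nil, List.length_nil]; omega) hx)
  | cons f fs ih =>
    intro hfs i a j hj
    have hf := hfs f (by simp)
    have ih := ih (fun g hg => hfs g (List.mem_cons_of_mem _ hg))
    have h2 := V_GS_bij (I := I) (TT fs) (a * f) f 1 hf.1 hf.2 (by simp) i (j - 1)
    let F : GS (TT fs) a j →ₗ[S] GS (fib 1 f (TT fs)) a j :=
      { toFun := fun x => ⟨(x.1, 0), x.2, zero_mem _⟩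
        map_add' := fun x y => Subtype.ext (Prod.ext rfl (add_zero (0 : (TT fs).M)).symm)
        map_smul' := fun r x => Subtype.ext (Prod.ext rfl (smul_zero (A := (TT fs).M) r).symm) }
    let G : GS (fib 1 f (TT fs)) a j →ₗ[S] GS (TT fs) (a * f) (j - 1) :=
      { toFun := fun x => ⟨x.1.2, x.2.2⟩
        map_add' := fun x y => rfl
        map_smul' := fun r x => rfl }
    change VM I i (GS (fib 1 f (TT fs)) a j)
    refine VM_mid F G (fun x => rfl) ?_ ?_ ?_ (ih i a j hj) h2
    · intro x y hxy
      exact Subtype.ext (congrArg Prod.fst (congrArg Subtype.val hxy))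
    · rintro ⟨y, hy⟩
      exact ⟨⟨(0, y), zero_mem _, hy⟩, rfl⟩
    · rintro ⟨⟨x, y⟩, hx, hy⟩ h
      have h : y = 0 := congrArg Subtype.val h
      subst h
      exact ⟨⟨x, hx⟩, rfl⟩

/-- degree zero -/
lemma deg0 (fs : List S) : Nonempty (S ≃ₗ[S] GS (TT fs) 1 0) := by
  induction fs with
  | nil =>
    have hm : ∀ x : FractionRing S, x ∈ GS (TT ([] : List S)) 1 0 ↔ ∃ s, algebraMap S _ s = x := by
      intro x
      change x ∈ (if (0 : ℤ) = 0 then SS S (FractionRing S) (1 : S) else ⊥) ↔ _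
      rw [if_pos rfl]
      constructor
      · rintro ⟨N, s, hs⟩
        exact ⟨s, by rw [← hs]; simp⟩
      · rintro ⟨s, rfl⟩
        exact ⟨0, s, by simp⟩
    let F : S →ₗ[S] (TT ([] : List S)).M := (Algebra.linearMap S (FractionRing S))
    let F' : S →ₗ[S] GS (TT ([] : List S)) 1 0 := F.codRestrict _ (fun s => (hm _).2 ⟨s, rfl⟩)
    refine ⟨LinearEquiv.ofBijective F' ⟨?_, ?_⟩⟩
    · intro a b hab
      exact IsFractionRing.injective S (FractionRing S) (congrArg Subtype.val hab)
    · rintro ⟨x, hx⟩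
      obtain ⟨s, hs⟩ := (hm x).1 hx
      exact ⟨s, Subtype.ext hs⟩
  | cons f fs ih =>
    obtain ⟨e⟩ := ih
    let F : GS (TT fs) 1 0 →ₗ[S] GS (fib 1 f (TT fs)) 1 0 :=
      { toFun := fun x => ⟨(x.1, 0), x.2, zero_mem _⟩
        map_add' := fun x y => Subtype.ext (Prod.ext rfl (add_zero (0 : (TT fs).M)).symm)
        map_smul' := fun r x => Subtype.ext (Prod.ext rfl (smul_zero (A := (TT fs).M) r).symm) }
    refine ⟨e.trans (LinearEquiv.ofBijective F ⟨?_, ?_⟩)⟩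
    · intro x y hxy
      exact Subtype.ext (congrArg Prod.fst (congrArg Subtype.val hxy))
    · rintro ⟨⟨x, y⟩, hx, hy⟩
      have h : y = 0 := (TT fs).neg (by omega) hy
      subst h
      exact ⟨⟨x, hx⟩, rfl⟩

variable [IsNoetherianRing S]

lemma cech_link (fs : List S) (r : ℕ) (hr : fs.length = r + 1) (h0 : ∀ f ∈ fs, f ≠ 0)
    (I : Ideal S) (hI : I = Ideal.span {f | f ∈ fs}) :
    (∀ i, r + 1 < i → V I i (ModuleCat.of S S)) ∧
    (V I (r+1) (ModuleCat.of S S) → E (FractionRing S) (pu S fs) 1 fs.length) := by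
  obtain ⟨e⟩ := deg0 fs
  have hlin := pu_lin (L := FractionRing S) (W := S) fs
  let d : (TT fs).M →ₗ[S] (TT fs).M := { (TT fs).d with map_smul' := fun r x => hlin r x }
  let C : ℕ → Submodule S (TT fs).M := fun j => GS (TT fs) 1 j
  have hfs : ∀ f ∈ fs, f ∈ I ∧ f ≠ 0 := fun f hf => ⟨hI ▸ Ideal.subset_span hf, h0 f hf⟩
  have hdC : ∀ j x, x ∈ C j → d x ∈ C (j+1) := by
    intro j x hx
    have := (TT fs).dG hx
    change _ ∈ (TT fs).G 1 ((j + 1 : ℕ) : ℤ)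
    push_cast
    exact this
  have hdd : ∀ x, d (d x) = 0 := tot_dd fs
  have hkill : ∀ (j : ℤ), ∀ z ∈ (TT fs).G 1 j, (TT fs).d z = 0 →
      ∃ k : ℕ, ∀ s ∈ I ^ k, ∃ y ∈ (TT fs).G 1 (j-1), (TT fs).d y = s • z := by
    intro j z hz hd
    let J : Ideal S :=
      { carrier := {s | ∃ y ∈ (TT fs).G 1 (j-1), (TT fs).d y = s • z}
        zero_mem' := ⟨0, zero_mem _, by simp⟩
        add_mem' := by
          rintro s t ⟨y, hy, h⟩ ⟨y', hy', h'⟩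
          exact ⟨y + y', add_mem hy hy', by rw [map_add, h, h', add_smul]⟩
        smul_mem' := by
          rintro c s ⟨y, hy, h⟩
          exact ⟨c • y, Cx.stab _ _ hy, by rw [hlin, h, smul_eq_mul, mul_smul]⟩ }
    have hJ : I ≤ J.radical := by
      rw [hI, Ideal.span_le]
      intro f hf
      obtain ⟨M, y, hy, h⟩ := L3a (L := FractionRing S) (W := S) fs f hf 1 j z hz hd
      exact ⟨M, y, hy, h⟩
    obtain ⟨k, hk⟩ := Ideal.exists_pow_le_of_le_radical_of_fg hJ (IsNoetherian.noetherian I)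
    exact ⟨k, fun s hs => hk hs⟩
  have htors : ∀ j, ∀ z ∈ C (j+1), d z = 0 → ∃ k : ℕ, ∀ s ∈ I ^ k, ∃ y ∈ C j, d y = s • z := by
    intro j z hz hd
    obtain ⟨k, hk⟩ := hkill ((j + 1 : ℕ) : ℤ) z hz hd
    refine ⟨k, fun s hs => ?_⟩
    obtain ⟨y, hy, h⟩ := hk s hs
    refine ⟨y, ?_, h⟩
    change y ∈ (TT fs).G 1 j
    rwa [show (((j + 1 : ℕ) : ℤ) - 1) = j by push_cast; ring] at hy
  have hlen : ((pu S fs).length : ℤ) = r + 1 := by simp [pu, hr]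
  have hrr : ∀ x ∈ C (r+2), x = 0 := by
    intro x hx
    refine tot_high (L := FractionRing S) (pu S fs) (a := 1) (i := ((r + 2 : ℕ) : ℤ)) ?_ hx
    rw [hlen]; push_cast; omega
  have hC : ∀ i j, VM I i (C (j+1)) := fun i j => V_GS fs hfs i 1 _ (by push_cast; omega)
  have hZ0 : ∀ x ∈ C 0, d x = 0 → x = 0 := by
    intro x hx hd
    obtain ⟨k, hk⟩ := hkill 0 x hx hd
    obtain ⟨f, hf⟩ : ∃ f, f ∈ fs := by
      rcases fs with _ | ⟨f, fs⟩
      · simp at hr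
      · exact ⟨f, by simp⟩
    obtain ⟨y, hy, h⟩ := hk (f ^ k) (Ideal.pow_mem_pow (hfs f hf).1 k)
    have hy0 : y = 0 := (TT fs).neg (by omega) hy
    rw [hy0, map_zero] at h
    exact (TT fs).inj (pow_ne_zero k (h0 f hf)) h.symm
  constructor
  · intro i hi
    exact VM_equiv e.symm (chase_vanish (d := d) (C := C) hdC hdd htors r hrr hC hZ0 i hi)
  · intro hV
    have h1 : VM I (r+1) (C 0) := VM_equiv e hV
    intro z hz _
    rw [hr] at hz
    obtain ⟨y, hy, h⟩ := chase_top (d := d) (C := C) hdC hdd htors r hrr hC hZ0 h1 z hz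
    refine ⟨y, ?_, h⟩
    rw [hr]
    change y ∈ (TT fs).G 1 r at hy
    push_cast
    rwa [add_sub_cancel_right]

end CH
end

section
universe u
open CategoryTheory Limits Opposite

namespace CH
open LCB
variable {S : Type u} [CommRing S] [IsDomain S] [IsNoetherianRing S]

lemma V_rad {I J : Ideal S} (h : I.radical = J.radical) (i : ℕ) (M : ModuleCat.{u} S) (hV : V I i M) :
    V J i M := by
  let e := (localCohomology.isoOfSameRadical h i).app M
  exact (e.toLinearEquiv.toEquiv).subsingleton_congr.1 hV

lemma final_wrap (I : Ideal S) (fs : List S) (r : ℕ) (hr : fs.length = r + 1) (h0 : ∀ f ∈ fs, f ≠ 0)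
    (hrad : (Ideal.span {f | f ∈ fs}).radical = I.radical)
    (hE : ¬ E (FractionRing S) (pu S fs) 1 fs.length) :
    araRank I = r + 1 ∧ cohDim I = r + 1 := by
  obtain ⟨h1, h2⟩ := cech_link fs r hr h0 _ rfl
  have h3 : ¬ V I (r+1) (ModuleCat.of S S) := fun h => hE (h2 (V_rad hrad.symm _ _ h))
  have h4 : ∀ i, r + 1 < i → V I i (ModuleCat.of S S) := fun i hi => V_rad hrad _ _ (h1 i hi)
  constructor
  · apply le_antisymm
    · apply Nat.sInf_le
      refine ⟨fun i => fs.get (i.cast hr.symm), ?_⟩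
      rw [← hrad]
      congr 2
      ext f
      constructor
      · rintro ⟨i, rfl⟩; exact List.get_mem _ _
      · intro hf
        obtain ⟨i, hi⟩ := List.mem_iff_get.1 hf
        exact ⟨i.cast hr, by simpa using hi⟩
    · apply le_csInf
      · refine ⟨r + 1, fun i => fs.get (i.cast hr.symm), ?_⟩
        rw [← hrad]
        congr 2
        ext f
        constructor
        · rintro ⟨i, rfl⟩; exact List.get_mem _ _
        · intro hf
          obtain ⟨i, hi⟩ := List.mem_iff_get.1 hf
          exact ⟨i.cast hr, by simpa using hi⟩
      · rintro s ⟨g, hg⟩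
        by_contra! hs
        classical
        let gs : List S := (List.ofFn g).filter (fun x => x ≠ 0)
        have hgl : gs.length ≤ s := by
          have := List.length_filter_le (fun x => decide (x ≠ 0)) (List.ofFn g)
          rw [List.length_ofFn] at this
          exact this
        have hspan : Ideal.span {f | f ∈ gs} = Ideal.span (Set.range g) := by
          apply le_antisymm
          · apply Ideal.span_mono
            intro f hf
            have := (List.mem_filter.1 hf).1
            rwa [List.mem_ofFn] at this
          · rw [Ideal.span_le]
            rintro _ ⟨i, rfl⟩
            by_cases hi : g i = 0
            · rw [hi]; exact zero_mem _
            · apply Ideal.subset_span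
              exact List.mem_filter.2 ⟨by rw [List.mem_ofFn]; exact ⟨i, rfl⟩, by simpa using hi⟩
        have hgs0 : gs.length ≠ 0 := by
          intro h
          rw [List.length_eq_zero_iff] at h
          rw [← hspan, h] at hg
          obtain ⟨f, hf⟩ : ∃ f, f ∈ fs := by
            rcases fs with _ | ⟨f, fs⟩
            · simp at hr
            · exact ⟨f, by simp⟩
          have : f ∈ I.radical := hrad ▸ Ideal.le_radical (Ideal.subset_span hf)
          rw [← hg] at this
          obtain ⟨N, hN⟩ := this
          simp at hN
          exact h0 f hf hN.1
        obtain ⟨p, hp⟩ : ∃ p, gs.length = p + 1 := ⟨gs.length - 1, by omega⟩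
        have := (cech_link gs p hp (fun f hf => by simpa using (List.mem_filter.1 hf).2) _ rfl).1 (r+1) (by omega)
        exact h3 (V_rad (by rw [hspan, hg]) _ _ this)
  · have hset : ∀ i ∈ { i | Nontrivial ((localCohomology I i).obj (ModuleCat.of S S)) }, i ≤ r + 1 := by
      intro i hi
      by_contra! hlt
      have := h4 i hlt
      exact not_subsingleton_iff_nontrivial.2 hi this
    apply le_antisymm
    · apply csSup_le'
      exact hset
    · exact le_csSup ⟨r+1, hset⟩ (not_subsingleton_iff_nontrivial.1 h3)

end CH
end

section
namespace MA

section weights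
variable {m : ℕ}

/-- weight -/
def wt (A : Finset (Fin m)) : ℕ := ∑ a ∈ A, (m - (a : ℕ))
/-- shifted weight -/
def wt' (A : Finset (Fin m)) : ℕ := ∑ a ∈ A, (m - 1 - (a : ℕ))

lemma wt_eq (A : Finset (Fin m)) : wt A = wt' A + A.card := by
  rw [wt, wt', Finset.card_eq_sum_ones, ← Finset.sum_add_distrib]
  apply Finset.sum_congr rfl
  intro a _
  have := a.2
  omega

lemma wt'_count (A : Finset (Fin m)) :
    wt' A = ∑ j ∈ Finset.range (m - 1), (A.filter (fun a : Fin m => (a : ℕ) ≤ j)).card := by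
  simp_rw [wt', Finset.card_filter]
  rw [Finset.sum_comm]
  apply Finset.sum_congr rfl
  intro a _
  rw [← Finset.card_filter]
  have : (Finset.range (m-1)).filter (fun j => (a : ℕ) ≤ j) = Finset.Ico (a : ℕ) (m-1) := by
    ext j; simp; omega
  rw [this, Nat.card_Ico]

lemma wt'_le {A A' : Finset (Fin m)} (h : ∀ j, (A'.filter (fun a : Fin m => (a : ℕ) ≤ j)).card ≤
    (A.filter (fun a : Fin m => (a : ℕ) ≤ j)).card) : wt' A' ≤ wt' A := by
  rw [wt'_count, wt'_count]
  exact Finset.sum_le_sum (fun j _ => h j)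

lemma filter_all (A : Finset (Fin m)) (j : ℕ) (hj : m - 1 ≤ j) : A.filter (fun a : Fin m => (a : ℕ) ≤ j) = A := by
  apply Finset.filter_true_of_mem
  intro a _
  have := a.2
  omega

lemma wt'_eq {A A' : Finset (Fin m)} (h : ∀ j, (A'.filter (fun a : Fin m => (a : ℕ) ≤ j)).card ≤
    (A.filter (fun a : Fin m => (a : ℕ) ≤ j)).card) (hw : wt' A' = wt' A) (hc : A'.card = A.card) : A' = A := by
  have h1 : ∀ j, (A'.filter (fun a : Fin m => (a : ℕ) ≤ j)).card = (A.filter (fun a : Fin m => (a : ℕ) ≤ j)).card := by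
    intro j
    by_cases hj : j < m - 1
    · rw [wt'_count, wt'_count] at hw
      exact (Finset.sum_eq_sum_iff_of_le (fun j _ => h j)).1 hw j (Finset.mem_range.2 hj)
    · rw [filter_all _ _ (by omega), filter_all _ _ (by omega), hc]
  have h2 : ∀ (B : Finset (Fin m)) (a : Fin m), a ∈ B ↔
      (B.filter (fun b : Fin m => (b : ℕ) < a)).card < (B.filter (fun b : Fin m => (b : ℕ) ≤ a)).card := by
    intro B a
    constructor
    · intro ha
      apply Finset.card_lt_card
      refine ⟨fun x hx => ?_, fun hs => ?_⟩
      · simp only [Finset.mem_filter] at hx ⊢; exact ⟨hx.1, hx.2.le⟩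
      · have := hs (Finset.mem_filter.2 ⟨ha, le_rfl⟩)
        simp at this
    · intro hlt
      by_contra ha
      apply hlt.ne
      congr 1
      ext b
      simp only [Finset.mem_filter]
      constructor
      · exact fun h => ⟨h.1, h.2.le⟩
      · rintro ⟨hb, hba⟩
        refine ⟨hb, lt_of_le_of_ne hba ?_⟩
        intro h; apply ha; rwa [← Fin.ext h]
  have h3 : ∀ j : ℕ, (A'.filter (fun a : Fin m => (a : ℕ) < j)).card = (A.filter (fun a : Fin m => (a : ℕ) < j)).card := by
    intro j
    rcases j with _ | j
    · simp
    · simpa only [Nat.lt_succ_iff] using h1 j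
  ext a
  rw [h2 A' a, h2 A a, h1, h3]

lemma sum_lower (B : Finset ℕ) : B.card * (B.card - 1) ≤ 2 * ∑ b ∈ B, b := by
  induction B using Finset.induction_on_max with
  | empty => simp
  | insert a s hs ih =>
    have ha : a ∉ s := fun h => lt_irrefl _ (hs a h)
    rw [Finset.card_insert_of_notMem ha, Finset.sum_insert ha]
    have hc : s.card ≤ a := by
      have : s ⊆ Finset.range a := fun x hx => Finset.mem_range.2 (hs x hx)
      simpa using Finset.card_le_card this
    rcases h : s.card with _ | p
    · simp
    · rw [h] at ih hc
      simp at ih ⊢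
      nlinarith

lemma wt'_lower (A : Finset (Fin m)) : A.card * (A.card - 1) ≤ 2 * wt' A := by
  have hi : Set.InjOn (fun a : Fin m => m - 1 - (a : ℕ)) A := by
    intro a _ b _ h
    have := a.2; have := b.2
    apply Fin.ext
    simp only at h
    omega
  have := sum_lower (A.image (fun a : Fin m => m - 1 - (a : ℕ)))
  rwa [Finset.card_image_of_injOn hi, Finset.sum_image hi] at this

lemma wt'_upper (A : Finset (Fin m)) : 2 * wt' A + A.card * (A.card - 1) ≤ 2 * (A.card * (m - 1)) := by
  have hi : Set.InjOn (fun a : Fin m => (a : ℕ)) A := fun a _ b _ h => Fin.ext h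
  have h1 := sum_lower (A.image (fun a : Fin m => (a : ℕ)))
  rw [Finset.card_image_of_injOn hi, Finset.sum_image hi] at h1
  have h2 : wt' A + ∑ a ∈ A, (a : ℕ) = A.card * (m - 1) := by
    rw [wt', ← Finset.sum_add_distrib, Finset.card_eq_sum_ones, Finset.sum_mul]
    apply Finset.sum_congr rfl
    intro a _
    have := a.2
    omega
  omega
end weights

section greedy
variable {F : Type*} [Field F] {m n : ℕ} (X : Fin m → Fin n → F)

open Classical in
/-- greedy rows -/
noncomputable def gr : Finset (Fin m) :=
  Finset.univ.filter (fun i => X i ∉ Submodule.span F (Set.image X {i' | i' < i}))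

lemma mem_gr {X : Fin m → Fin n → F} {i : Fin m} :
    i ∈ gr X ↔ X i ∉ Submodule.span F (Set.image X {i' | i' < i}) := by
  classical
  simp [gr]

lemma fr_card {X : Fin m → Fin n → F} (A : Finset (Fin m)) (hA : LinearIndepOn F X (A : Set (Fin m))) :
    Module.finrank F (Submodule.span F (Set.image X (A : Set (Fin m)))) = A.card := by
  have := finrank_span_eq_card hA.linearIndependent
  rw [Set.image_eq_range]
  simpa using this

lemma gr_spec (j : ℕ) : LinearIndepOn F X {i | i ∈ gr X ∧ (i : ℕ) < j} ∧
    Submodule.span F (Set.image X {i | i ∈ gr X ∧ (i : ℕ) < j}) = Submodule.span F (Set.image X {i | (i : ℕ) < j}) := by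
  induction j with
  | zero => simp [linearIndepOn_empty]
  | succ j ih =>
    obtain ⟨h1, h2⟩ := ih
    by_cases hj : j < m
    · have e2 : {i : Fin m | (i : ℕ) < j + 1} = insert ⟨j, hj⟩ {i : Fin m | (i : ℕ) < j} := by
        ext i; simp [Fin.ext_iff]; omega
      have hlt : {i : Fin m | (i : ℕ) < j} = {i' | i' < (⟨j, hj⟩ : Fin m)} := by
        ext i; simp [Fin.lt_def]
      by_cases hg : (⟨j, hj⟩ : Fin m) ∈ gr X
      · have e1 : {i : Fin m | i ∈ gr X ∧ (i : ℕ) < j + 1} =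
            insert ⟨j, hj⟩ {i : Fin m | i ∈ gr X ∧ (i : ℕ) < j} := by
          ext i
          simp only [Set.mem_ofPred_eq, Set.mem_insert_iff, Fin.ext_iff]
          constructor
          · rintro ⟨h, h'⟩; by_cases hh : (i : ℕ) = j
            · exact Or.inl hh
            · exact Or.inr ⟨h, by omega⟩
          · rintro (h | h)
            · have : i = ⟨j, hj⟩ := Fin.ext h
              subst this; exact ⟨hg, by simp⟩
            · exact ⟨h.1, by omega⟩
        rw [e1, e2, Set.image_insert_eq, Set.image_insert_eq, Submodule.span_insert, Submodule.span_insert, h2]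
        refine ⟨h1.insert ?_, rfl⟩
        rw [h2, hlt]
        exact mem_gr.1 hg
      · have e1 : {i : Fin m | i ∈ gr X ∧ (i : ℕ) < j + 1} = {i : Fin m | i ∈ gr X ∧ (i : ℕ) < j} := by
          ext i
          simp only [Set.mem_ofPred_eq]
          refine and_congr_right (fun h => ?_)
          have : (i : ℕ) ≠ j := by
            intro hh
            have : i = ⟨j, hj⟩ := Fin.ext hh
            exact hg (this ▸ h)
          omega
        rw [e1, e2, Set.image_insert_eq, Submodule.span_insert, h2]
        refine ⟨h1, ?_⟩
        have : X ⟨j, hj⟩ ∈ Submodule.span F (Set.image X {i | (i : ℕ) < j}) := by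
          by_contra h
          exact hg (mem_gr.2 (by rwa [hlt] at h))
        rw [eq_comm, sup_eq_right, Submodule.span_singleton_le_iff_mem]
        exact this
    · have : ∀ i : Fin m, ((i : ℕ) < j + 1) ↔ (i : ℕ) < j := by intro i; have := i.2; omega
      simp only [this]
      exact ⟨h1, h2⟩

lemma gr_indep : LinearIndepOn F X (gr X : Set (Fin m)) := by
  have := (gr_spec X m).1
  convert this using 1
  ext i; simp

lemma gr_span : Submodule.span F (Set.image X (gr X : Set (Fin m))) = Submodule.span F (Set.range X) := by
  have := (gr_spec X m).2
  convert this using 2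
  · congr 1; ext i; simp
  · ext i; simp

lemma gr_max (A : Finset (Fin m)) (hA : LinearIndepOn F X (A : Set (Fin m))) (j : ℕ) :
    (A.filter (fun a : Fin m => (a : ℕ) ≤ j)).card ≤ ((gr X).filter (fun a : Fin m => (a : ℕ) ≤ j)).card := by
  obtain ⟨h1, h2⟩ := gr_spec X (j+1)
  have e1 : {i : Fin m | i ∈ gr X ∧ (i : ℕ) < j + 1} = ((gr X).filter (fun a : Fin m => (a : ℕ) ≤ j) : Finset _) := by
    ext i; simp [Nat.lt_succ_iff]
  rw [e1] at h1 h2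
  have hA' : LinearIndepOn F X ((A.filter (fun a : Fin m => (a : ℕ) ≤ j) : Finset _) : Set (Fin m)) :=
    hA.mono (by intro i hi; simp at hi ⊢; exact hi.1)
  rw [← fr_card _ hA', ← fr_card _ h1, h2]
  apply Submodule.finrank_mono
  apply Submodule.span_mono
  apply Set.image_mono
  intro i hi
  simp at hi ⊢
  omega

lemma gr_card : (gr X).card = (Matrix.of X).rank := by
  rw [Matrix.rank_eq_finrank_span_row, ← fr_card _ (gr_indep X), gr_span]
  rfl

lemma gr_zero (i : Fin m) (hi : ∀ a ∈ gr X, i < a) : X i = 0 := by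
  have h2 := (gr_spec X (i+1)).2
  have : {i' : Fin m | i' ∈ gr X ∧ (i' : ℕ) < i + 1} = ∅ := by
    ext a
    simp only [Set.mem_ofPred_eq, Set.mem_empty_iff_false, iff_false, not_and]
    intro ha
    have := hi a ha
    rw [Fin.lt_def] at this
    omega
  rw [this, Set.image_empty, Submodule.span_empty] at h2
  have hm : X i ∈ Submodule.span F (Set.image X {i' | (i' : ℕ) < i + 1}) :=
    Submodule.subset_span ⟨i, by simp, rfl⟩
  rw [← h2] at hm
  simpa using hm

lemma minor_rows {s : ℕ} (r : Fin s → Fin m) (c : Fin s → Fin n)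
    (h : ((Matrix.of X).submatrix r c).det ≠ 0) :
    LinearIndependent F (fun i => X (r i)) := by
  have h1 : LinearIndependent F ((Matrix.of X).submatrix r c).row :=
    Matrix.linearIndependent_rows_of_det_ne_zero h
  exact LinearIndependent.of_comp (LinearMap.funLeft F F c) h1

lemma minor_le_rank {s : ℕ} (r : Fin s → Fin m) (c : Fin s → Fin n)
    (h : ((Matrix.of X).submatrix r c).det ≠ 0) : s ≤ (Matrix.of X).rank := by
  have := minor_rows X r c h
  rw [Matrix.rank_eq_finrank_span_row]
  have h2 := finrank_span_eq_card this
  rw [Fintype.card_fin] at h2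
  rw [← h2]
  apply Submodule.finrank_mono
  apply Submodule.span_mono
  rintro _ ⟨i, rfl⟩
  exact ⟨r i, rfl⟩

lemma gr_minor {s : ℕ} (r : Fin s → Fin m) (c : Fin s → Fin n)
    (hr : Set.range r = gr X) (hc : Set.range c = gr (Matrix.of X).transpose)
    (hci : Function.Injective c) : ((Matrix.of X).submatrix r c).det ≠ 0 := by
  have hsp : ∀ i, X i ∈ Submodule.span F (Set.range (fun j => X (r j))) := by
    intro i
    have : Set.range (fun j => X (r j)) = Set.image X (gr X : Set (Fin m)) := by
      rw [← hr, ← Set.range_comp]; rfl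
    rw [this, gr_span]
    exact Submodule.subset_span ⟨i, rfl⟩
  simp_rw [Submodule.mem_span_range_iff_exists_fun] at hsp
  choose M hM using hsp
  have hcc : LinearIndependent F (fun j => (Matrix.of X).transpose (c j)) := by
    have h1 := gr_indep (Matrix.of X).transpose
    rw [← hc] at h1
    exact h1.linearIndependent.comp (fun j => (⟨c j, j, rfl⟩ : Set.range c))
      (fun a b h => hci (congrArg Subtype.val h))
  intro hdet
  obtain ⟨v, hv, hv0⟩ := Matrix.exists_mulVec_eq_zero_iff.2 hdet
  apply hv
  have : ∑ j, v j • (Matrix.of X).transpose (c j) = 0 := by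
    ext i
    have hi : ∀ j, X i (c j) = ∑ l, M i l * X (r l) (c j) := by
      intro j
      have := congrFun (hM i) (c j)
      simpa using this.symm
    simp only [Finset.sum_apply, Pi.smul_apply, Matrix.transpose_apply, Matrix.of_apply, smul_eq_mul, hi,
      Pi.zero_apply, Finset.mul_sum]
    rw [Finset.sum_comm]
    apply Finset.sum_eq_zero
    intro l _
    have := congrFun hv0 l
    simp only [Matrix.mulVec, dotProduct, Matrix.submatrix_apply, Matrix.of_apply, Pi.zero_apply] at this
    calc ∑ j, v j * (M i l * X (r l) (c j)) = M i l * ∑ j, X (r l) (c j) * v j := by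
          rw [Finset.mul_sum]; exact Finset.sum_congr rfl (fun _ _ => by ring)
      _ = 0 := by rw [this, mul_zero]
  ext j
  exact Fintype.linearIndependent_iff.1 hcc v this j

end greedy
end MA
end

section
namespace MA
section
variable {m n : ℕ}

/-- minor by finsets -/
noncomputable def mn {R : Type*} [CommRing R] (X : Matrix (Fin m) (Fin n) R) (A : Finset (Fin m))
    (B : Finset (Fin n)) : R :=
  if h : B.card = A.card then (X.submatrix (A.orderEmbOfFin rfl) (B.orderEmbOfFin h)).det else 0

/-- height -/
def ht (A : Finset (Fin m)) (B : Finset (Fin n)) : ℕ := wt A + wt' B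

noncomputable def PH {R : Type*} [CommRing R] (t : ℕ) (X : Matrix (Fin m) (Fin n) R) (H : ℕ) : R :=
  ∑ A : Finset (Fin m), ∑ B : Finset (Fin n),
    if t ≤ A.card ∧ B.card = A.card ∧ ht A B = H then mn X A B else 0

lemma mn_map {R S : Type*} [CommRing R] [CommRing S] (φ : R →+* S) (X : Matrix (Fin m) (Fin n) R) (A B) :
    mn (X.map φ) A B = φ (mn X A B) := by
  unfold mn
  split_ifs
  · rw [RingHom.map_det]; rfl
  · simp

lemma PH_map {R S : Type*} [CommRing R] [CommRing S] (φ : R →+* S) (t) (X : Matrix (Fin m) (Fin n) R) (H) :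
    PH t (X.map φ) H = φ (PH t X H) := by
  simp only [PH, map_sum, apply_ite φ, map_zero, mn_map]

lemma ht_lower (A : Finset (Fin m)) (B : Finset (Fin n)) (h : B.card = A.card) : A.card ^ 2 ≤ ht A B := by
  have h1 := wt'_lower A
  have h2 := wt'_lower B
  rw [ht, wt_eq]
  rw [h] at h2
  rcases hs : A.card with _ | s
  · simp
  · rw [hs] at h1 h2
    simp at h1 h2
    nlinarith

lemma ht_upper (A : Finset (Fin m)) (B : Finset (Fin n)) (h : B.card = A.card) : ht A B ≤ m * n := by
  have h1 := wt'_upper A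
  have h2 := wt'_upper B
  rw [ht, wt_eq]
  have h3 : A.card ≤ m := by simpa using Finset.card_le_univ A
  have h4 : B.card ≤ n := by simpa using Finset.card_le_univ B
  rw [h] at h2 h4
  rcases hs : A.card with _ | s
  · rw [hs] at h1 h2
    simp at h1 h2
    simp [h1, h2]
  · rw [hs] at h1 h2 h3 h4
    obtain ⟨p, rfl⟩ := Nat.exists_eq_add_of_le h3
    obtain ⟨q, rfl⟩ := Nat.exists_eq_add_of_le h4
    have e1 : s + 1 + p - 1 = s + p := by omega
    have e2 : s + 1 + q - 1 = s + q := by omega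
    rw [e1] at h1
    rw [e2] at h2
    simp only [Nat.add_sub_cancel] at h1 h2
    nlinarith [Nat.zero_le (p*q)]

lemma ht_pos {t h k : ℕ} (ht1 : 1 ≤ t) (A : Finset (Fin m)) (B : Finset (Fin n)) (hc : B.card = A.card) (htA : t ≤ A.card)
    (hH : ht A B = t ^ 2 + h) (hk : k ≤ m + n - 2 * t) (hh : h < k) (z1 : Fin m) (z2 : Fin n) (hz : (z1 : ℕ) + z2 ≤ k - 1 - h) :
    (∀ a ∈ A, z1 < a) ∨ (∀ b ∈ B, z2 < b) := by
  by_contra hcon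
  push Not at hcon
  obtain ⟨⟨a, haA, ha⟩, ⟨b, hbB, hb⟩⟩ := hcon
  have h1 := wt'_lower (A.erase a)
  have h2 := wt'_lower (B.erase b)
  have e1 : wt' A = (m - 1 - (a : ℕ)) + wt' (A.erase a) := by
    rw [wt', ← Finset.add_sum_erase _ _ haA]; rfl
  have e2 : wt' B = (n - 1 - (b : ℕ)) + wt' (B.erase b) := by
    rw [wt', ← Finset.add_sum_erase _ _ hbB]; rfl
  rw [Finset.card_erase_of_mem haA] at h1
  rw [Finset.card_erase_of_mem hbB] at h2
  rw [ht, wt_eq, e1, e2] at hH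
  rw [hc] at h2
  rw [Fin.le_def] at ha hb
  obtain ⟨s, hs⟩ : ∃ s, A.card = s + 1 := ⟨A.card - 1, by omega⟩
  obtain ⟨t', rfl⟩ : ∃ s, t = s + 1 := ⟨t - 1, by omega⟩
  rw [hs] at h1 h2 hH htA
  have hts : t' ≤ s := by omega
  have ham := a.2
  have hbn := b.2
  have key : t' * t' ≤ wt' (A.erase a) + wt' (B.erase b) + s := by
    rcases s with _ | s
    · have : t' = 0 := by omega
      subst this; simp
    · simp at h1 h2
      nlinarith
  have : (t'+1)^2 = t' * t' + 2 * t' + 1 := by ring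
  rw [this] at hH
  omega

lemma mn_congr {R : Type*} [CommRing R] (X Y : Matrix (Fin m) (Fin n) R) (A B)
    (h : ∀ a ∈ A, ∀ b ∈ B, X a b = Y a b) : mn X A B = mn Y A B := by
  unfold mn
  split_ifs
  · congr 1
    ext i j
    exact h _ (Finset.orderEmbOfFin_mem _ _ _) _ (Finset.orderEmbOfFin_mem _ _ _)
  · rfl

lemma PH_congr {R : Type*} [CommRing R] (t H : ℕ) (X Y : Matrix (Fin m) (Fin n) R)
    (h : ∀ A B, B.card = A.card → t ≤ A.card → ht A B = H → ∀ a ∈ A, ∀ b ∈ B, X a b = Y a b) :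
    PH t X H = PH t Y H := by
  unfold PH
  apply Finset.sum_congr rfl; intro A _
  apply Finset.sum_congr rfl; intro B _
  split_ifs with hc
  · exact mn_congr X Y A B (h A B hc.2.1 hc.1 hc.2.2)
  · rfl

section field
variable {F : Type*} [Field F] (X : Matrix (Fin m) (Fin n) F)

lemma mn_ne {A B} (h : mn X A B ≠ 0) : B.card = A.card ∧ A.card ≤ X.rank ∧
    LinearIndepOn F X (A : Set (Fin m)) := by
  unfold mn at h
  split_ifs at h with hc
  · refine ⟨hc, minor_le_rank X _ _ h, ?_⟩
    have h1 := minor_rows X _ _ h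
    have : Set.range (A.orderEmbOfFin rfl) = A := Finset.range_orderEmbOfFin A rfl
    rw [← this]
    rw [← linearIndepOn_univ_iff] at h1
    have h2 := LinearIndepOn.image_of_comp (s := Set.univ) (A.orderEmbOfFin rfl) X h1
    rwa [Set.image_univ] at h2
  · exact absurd rfl h

lemma mn_ne' {A B} (h : mn X A B ≠ 0) : LinearIndepOn F X.transpose (B : Set (Fin n)) := by
  have : mn X.transpose B A ≠ 0 := by
    unfold mn at h ⊢
    split_ifs at h with hc
    · rw [dif_pos hc.symm]
      rw [← Matrix.det_transpose] at h
      have e : ∀ (s : ℕ) (hs : s = A.card) (h1 : A.card = s) (h2 : B.card = s),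
         ((X.submatrix (A.orderEmbOfFin h1) (B.orderEmbOfFin h2)).transpose).det ≠ 0 := by
        rintro s rfl h1 h2; exact h
      exact e B.card hc hc.symm rfl
    · exact absurd rfl h
  exact (mn_ne _ this).2.2

lemma PH_small {t H : ℕ} (h : X.rank < t) : PH t X H = 0 := by
  unfold PH
  apply Finset.sum_eq_zero; intro A _
  apply Finset.sum_eq_zero; intro B _
  split_ifs with hc
  · by_contra hne
    have := (mn_ne X hne).2.1
    omega
  · rfl

lemma PH_greedy {t : ℕ} (h : t ≤ X.rank) : PH t X (ht (gr X) (gr X.transpose)) ≠ 0 := by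
  have c1 : (gr X).card = X.rank := gr_card X
  have c2 : (gr X.transpose).card = X.rank := by rw [← Matrix.rank_transpose X]; exact gr_card X.transpose
  unfold PH
  rw [Finset.sum_eq_single (gr X), Finset.sum_eq_single (gr X.transpose)]
  · rw [if_pos ⟨by omega, by omega, rfl⟩, mn, dif_pos (by omega)]
    exact gr_minor X _ _ (Finset.range_orderEmbOfFin _ _) (Finset.range_orderEmbOfFin _ _) (RelEmbedding.injective _)
  · intro B _ hB
    split_ifs with hc
    · by_contra hne
      apply hB
      have := mn_ne' X hne
      refine wt'_eq (gr_max _ _ this) ?_ (by omega)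
      have := hc.2.2
      simp only [ht] at this
      omega
    · rfl
  · simp
  · intro A _ hA
    apply Finset.sum_eq_zero
    intro B _
    split_ifs with hc
    · by_contra hne
      apply hA
      have hB := wt'_le (gr_max _ _ (mn_ne' X hne))
      obtain ⟨-, h2, h3⟩ := mn_ne X hne
      have hA := wt'_le (gr_max _ _ h3)
      have := hc.2.2
      simp only [ht, wt_eq] at this
      exact wt'_eq (gr_max _ _ h3) (by omega) (by omega)
    · rfl
  · simp

lemma rank_minor {t : ℕ} (h : t ≤ X.rank) : ∃ (r : Fin t → Fin m) (c : Fin t → Fin n),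
    Function.Injective r ∧ Function.Injective c ∧ (X.submatrix r c).det ≠ 0 := by
  have c1 : (gr X).card = X.rank := gr_card X
  obtain ⟨A, hA, hAc⟩ := Finset.exists_subset_card_eq (s := gr X) (n := t) (by omega)
  set r := A.orderEmbOfFin hAc
  set Y : Matrix (Fin t) (Fin n) F := X.submatrix r id with hY
  have hi : LinearIndependent F Y.row := by
    have := (gr_indep X).mono (Finset.coe_subset.2 hA)
    exact this.linearIndependent.comp (fun j => (⟨r j, Finset.orderEmbOfFin_mem _ _ _⟩ : (A : Set (Fin m))))
      (fun a b h => r.injective (congrArg Subtype.val h))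
  have hr : Y.rank = t := by simpa using hi.rank_matrix
  have d1 : (gr Y).card = t := (gr_card Y).trans hr
  have d2 : (gr Y.transpose).card = t := by
    have : (gr Y.transpose).card = Y.transpose.rank := gr_card Y.transpose
    rw [this, Matrix.rank_transpose, hr]
  have d3 : gr Y = Finset.univ := by
    apply Finset.eq_univ_of_card; simp [d1]
  refine ⟨r, (gr Y.transpose).orderEmbOfFin d2, r.injective, RelEmbedding.injective _, ?_⟩
  exact gr_minor Y id ((gr Y.transpose).orderEmbOfFin d2) (by simp [d3]) (Finset.range_orderEmbOfFin _ _) (RelEmbedding.injective _)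

end field
end
end MA
end

section
namespace MA
section
variable {m n : ℕ}

/-- the modified matrices -/
noncomputable def Xs {R : Type*} [CommRing R] (t : ℕ) {k : ℕ} (z : Fin k → Fin m × Fin n)
    (X : Matrix (Fin m) (Fin n) R) : ℕ → Matrix (Fin m) (Fin n) R
  | 0 => X
  | h + 1 => fun i j => Xs t z X h i j +
      if ∃ hh : h < k, z ⟨k - 1 - h, by omega⟩ = (i, j) then PH t (Xs t z X h) (t ^ 2 + h) else 0

lemma Xs_succ {R : Type*} [CommRing R] (t : ℕ) {k : ℕ} (z : Fin k → Fin m × Fin n)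
    (X : Matrix (Fin m) (Fin n) R) (h : ℕ) (i j) : Xs t z X (h + 1) i j = Xs t z X h i j +
      if ∃ hh : h < k, z ⟨k - 1 - h, by omega⟩ = (i, j) then PH t (Xs t z X h) (t ^ 2 + h) else 0 := rfl

lemma Xs_map {R S : Type*} [CommRing R] [CommRing S] (φ : R →+* S) (t : ℕ) {k : ℕ} (z : Fin k → Fin m × Fin n)
    (X : Matrix (Fin m) (Fin n) R) (h : ℕ) : Xs t z (X.map φ) h = (Xs t z X h).map φ := by
  induction h with
  | zero => rfl
  | succ h ih =>
    ext i j
    rw [Matrix.map_apply, Xs_succ, Xs_succ, map_add, apply_ite φ, map_zero, ih, PH_map, Matrix.map_apply]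

section field
variable {F : Type*} [Field F] (t : ℕ) {k : ℕ} (z : Fin k → Fin m × Fin n) (X : Matrix (Fin m) (Fin n) F)

lemma Xs_z (hz : Function.Injective z) (h : ℕ) (hh : h < k) (j : ℕ) :
    Xs t z X (h + 1 + j) (z ⟨k - 1 - h, by omega⟩).1 (z ⟨k - 1 - h, by omega⟩).2 =
    Xs t z X (h + 1) (z ⟨k - 1 - h, by omega⟩).1 (z ⟨k - 1 - h, by omega⟩).2 := by
  induction j with
  | zero => rfl
  | succ j ih =>
    rw [← ih, ← add_assoc]
    conv_lhs => rw [Xs_succ]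
    rw [if_neg, add_zero]
    rintro ⟨hh', he⟩
    have := hz he
    simp only [Fin.mk.injEq] at this
    omega

lemma Xs_z0 (hz : Function.Injective z) (hX : ∀ i, X (z i).1 (z i).2 = 0) (h : ℕ) (hh : h < k) (j : ℕ) (hj : j ≤ h) :
    Xs t z X j (z ⟨k - 1 - h, by omega⟩).1 (z ⟨k - 1 - h, by omega⟩).2 = 0 := by
  induction j with
  | zero => exact hX _
  | succ j ih =>
    rw [Xs_succ, ih (by omega), if_neg, add_zero]
    rintro ⟨hh', he⟩
    have := hz he
    simp only [Fin.mk.injEq] at this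
    omega

lemma Xs_PH (ht1 : 1 ≤ t) (hk : k ≤ m + n - 2 * t) (hd : ∀ i, ((z i).1 : ℕ) + (z i).2 ≤ i) (h : ℕ) (hh : h < k) (j : ℕ) :
    PH t (Xs t z X (h + j)) (t ^ 2 + h) = PH t (Xs t z X h) (t ^ 2 + h) := by
  induction j with
  | zero => rfl
  | succ j ih =>
    rw [← ih, ← add_assoc]
    apply PH_congr
    intro A B hc hA hH a ha b hb
    conv_lhs => rw [Xs_succ]
    rw [if_neg, add_zero]
    rintro ⟨hh', he⟩
    have h1 := hd ⟨k - 1 - (h + j), by omega⟩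
    rw [he] at h1
    simp only at h1
    rcases ht_pos ht1 A B hc hA hH hk hh a b (by omega) with h2 | h2
    · exact lt_irrefl _ (h2 a ha)
    · exact lt_irrefl _ (h2 b hb)

lemma Xs_eq (h0 : ∀ h < k, PH t (Xs t z X h) (t ^ 2 + h) = 0) (j : ℕ) : Xs t z X j = X := by
  induction j with
  | zero => rfl
  | succ j ih =>
    ext a b
    rw [Xs_succ]
    conv_rhs => rw [← ih]
    split_ifs with hc
    · rw [h0 j hc.1, add_zero]
    · rw [add_zero]

lemma pointwise (ht1 : 1 ≤ t) (hk : k ≤ m + n - 2 * t) (hd : ∀ i, ((z i).1 : ℕ) + (z i).2 ≤ i)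
    (hz : Function.Injective z) (hX : ∀ i, X (z i).1 (z i).2 = 0) :
    (∀ H, t ^ 2 + k ≤ H → H ≤ m * n → PH t (Xs t z X k) H = 0) ↔
    ∀ (r : Fin t → Fin m) (c : Fin t → Fin n), Function.Injective r → Function.Injective c →
      (X.submatrix r c).det = 0 := by
  have hrk : (∀ (r : Fin t → Fin m) (c : Fin t → Fin n), Function.Injective r → Function.Injective c →
      (X.submatrix r c).det = 0) ↔ X.rank < t := by
    constructor
    · intro h
      by_contra hc
      obtain ⟨r, c, hr, hc, hne⟩ := rank_minor X (not_lt.1 hc)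
      exact hne (h r c hr hc)
    · intro h r c _ _
      by_contra hne
      have := minor_le_rank X r c hne
      have e : (Matrix.of X).rank = X.rank := rfl
      omega
  rw [hrk]
  constructor
  · intro h
    by_cases hr : (Xs t z X k).rank < t
    · have : Xs t z X k = X := by
        apply Xs_eq
        intro h hh
        have := Xs_PH t z X ht1 hk hd h hh (k - h)
        rw [← this, show h + (k - h) = k by omega]
        exact PH_small _ hr
      rwa [this] at hr
    · exfalso
      push Not at hr
      have hg := PH_greedy _ hr
      set Y := Xs t z X k with hY
      have c1 : (gr Y).card = Y.rank := gr_card Y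
      have c2 : (gr Y.transpose).card = Y.rank := by rw [← Matrix.rank_transpose Y]; exact gr_card Y.transpose
      have l1 := ht_lower (gr Y) (gr Y.transpose) (by omega)
      have l2 := ht_upper (gr Y) (gr Y.transpose) (by omega)
      have l3 : t ^ 2 ≤ (gr Y).card ^ 2 := Nat.pow_le_pow_left (by omega) 2
      obtain ⟨p, hp⟩ := Nat.exists_eq_add_of_le (l3.trans l1)
      by_cases hpk : k ≤ p
      · exact hg (h _ (by omega) l2)
      · push Not at hpk
        have hzd := hd ⟨k - 1 - p, by omega⟩
        have hz1 := Xs_z t z X hz p hpk (k - (p + 1))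
        rw [show p + 1 + (k - (p + 1)) = k by omega] at hz1
        have hz2 : Xs t z X (p + 1) (z ⟨k - 1 - p, by omega⟩).1 (z ⟨k - 1 - p, by omega⟩).2 =
            PH t Y (t ^ 2 + p) := by
          rw [Xs_succ, Xs_z0 t z X hz hX p hpk p le_rfl, if_pos ⟨hpk, rfl⟩, zero_add]
          rw [← Xs_PH t z X ht1 hk hd p hpk (k - p), show p + (k - p) = k by omega]
        rw [hz2, ← hp] at hz1
        apply hg
        rw [← hz1, ← hY]
        rcases ht_pos ht1 _ _ (by omega) (by omega) hp hk hpk _ _ hzd with h2 | h2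
        · exact congrFun (gr_zero Y _ h2) _
        · exact congrFun (gr_zero Y.transpose _ h2) _
  · intro h H _ _
    rw [Xs_eq t z X (fun h' _ => ?_) k]
    · exact PH_small _ h
    · induction h' using Nat.strong_induction_on with
      | _ h' ih =>
        have : Xs t z X h' = X := by
          clear * - ih
          have : ∀ j ≤ h', Xs t z X j = X := by
            intro j
            induction j with
            | zero => intro _; rfl
            | succ j ihj =>
              intro hj
              ext a b
              rw [Xs_succ]
              split_ifs with hc
              · rw [ih j (by omega) hc.1, ihj (by omega), add_zero]
              · rw [ihj (by omega), add_zero]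
          exact this h' le_rfl
        rw [this]
        exact PH_small _ h

end field

/-- Statement A. -/
theorem stmtA {R : Type*} [CommRing R] (t k : ℕ) (ht1 : 1 ≤ t) (hk : k ≤ m + n - 2 * t)
    (z : Fin k → Fin m × Fin n) (hd : ∀ i, ((z i).1 : ℕ) + (z i).2 ≤ i)
    (hz : Function.Injective z) (X : Matrix (Fin m) (Fin n) R) (hX : ∀ i, X (z i).1 (z i).2 = 0) :
    ∃ fs : List R, fs.length = m * n + 1 - (t ^ 2 + k) ∧
      (Ideal.span {f | f ∈ fs}).radical = (minorsIdeal t X).radical := by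
  refine ⟨(List.range' (t ^ 2 + k) (m * n + 1 - (t ^ 2 + k))).map (PH t (Xs t z X k)), by simp, ?_⟩
  rw [Ideal.radical_eq_sInf, Ideal.radical_eq_sInf]
  congr 1
  ext P
  simp only [Set.mem_ofPred_eq]
  refine and_congr_left (fun hP => ?_)
  let φ : R →+* FractionRing (R ⧸ P) := (algebraMap (R ⧸ P) (FractionRing (R ⧸ P))).comp (Ideal.Quotient.mk P)
  have hφ : ∀ x, φ x = 0 ↔ x ∈ P := by
    intro x
    rw [RingHom.comp_apply, IsFractionRing.to_map_eq_zero_iff, Ideal.Quotient.eq_zero_iff_mem]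
  have hp := pointwise t z (X.map φ) ht1 hk hd hz (by intro i; simp [hX])
  rw [Ideal.span_le, minorsIdeal, Ideal.span_le]
  constructor
  · intro h
    rintro _ ⟨r, c, hr, hc, rfl⟩
    rw [SetLike.mem_coe, ← hφ, RingHom.map_det]
    refine hp.1 ?_ r c hr hc
    intro H h1 h2
    rw [Xs_map, PH_map, hφ]
    apply h
    simp only [List.mem_map, List.mem_range'_1, Set.mem_ofPred_eq]
    exact ⟨H, ⟨h1, by omega⟩, rfl⟩
  · intro h f hf
    simp only [List.mem_map, List.mem_range'_1, Set.mem_ofPred_eq] at hf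
    obtain ⟨H, ⟨h1, h2⟩, rfl⟩ := hf
    rw [SetLike.mem_coe, ← hφ, ← PH_map, ← Xs_map]
    refine hp.2 ?_ H h1 (by omega)
    intro r c hr hc
    have := h ⟨r, c, hr, hc, rfl⟩
    rw [SetLike.mem_coe, ← hφ, RingHom.map_det] at this
    exact this

end
end MA
end

section
namespace MA
universe uA
section
variable {m n : ℕ}

lemma minors_iff {F : Type*} [Field F] (t : ℕ) (X : Matrix (Fin m) (Fin n) F) :
    (∀ (r : Fin t → Fin m) (c : Fin t → Fin n), Function.Injective r → Function.Injective c →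
      (X.submatrix r c).det = 0) ↔ X.rank < t := by
  constructor
  · intro h
    by_contra hc
    obtain ⟨r, c, hr, hc, hne⟩ := rank_minor X (not_lt.1 hc)
    exact hne (h r c hr hc)
  · intro h r c _ _
    by_contra hne
    have := minor_le_rank X r c hne
    have e : (Matrix.of X).rank = X.rank := rfl
    omega

lemma mem_rad {R : Type uA} [CommRing R] (J : Ideal R) (f : R)
    (h : ∀ (F : Type uA) (_ : Field F) (φ : R →+* F), (∀ g ∈ J, φ g = 0) → φ f = 0) : f ∈ J.radical := by
  rw [Ideal.radical_eq_sInf, Ideal.mem_sInf]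
  rintro P ⟨hJ, hP⟩
  have hφ : ∀ x, ((algebraMap (R ⧸ P) (FractionRing (R ⧸ P))).comp (Ideal.Quotient.mk P)) x = 0 ↔ x ∈ P := by
    intro x
    rw [RingHom.comp_apply, IsFractionRing.to_map_eq_zero_iff, Ideal.Quotient.eq_zero_iff_mem]
  rw [← hφ]
  apply h
  intro g hg
  rw [hφ]
  exact hJ hg

lemma minors_hom {R F : Type*} [CommRing R] [Field F] (φ : R →+* F) (t : ℕ) (X : Matrix (Fin m) (Fin n) R) :
    (∀ g ∈ minorsIdeal t X, φ g = 0) ↔ (X.map φ).rank < t := by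
  rw [← minors_iff]
  constructor
  · intro h r c hr hc
    have := h _ (Ideal.subset_span ⟨r, c, hr, hc, rfl⟩)
    rw [RingHom.map_det] at this
    exact this
  · intro h
    have : minorsIdeal t X ≤ RingHom.ker φ := by
      apply Ideal.span_le.2
      rintro _ ⟨r, c, hr, hc, rfl⟩
      have := h r c hr hc
      rw [SetLike.mem_coe, RingHom.mem_ker, RingHom.map_det]
      exact this
    exact fun g hg => this hg

/-- Schur complement -/
def schur {R : Type*} [CommRing R] (Z : Matrix (Fin (m+1)) (Fin (n+1)) R) (i0 : Fin (m+1)) (j0 : Fin (n+1)) :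
    Matrix (Fin m) (Fin n) R :=
  fun i j => Z i0 j0 * Z (i0.succAbove i) (j0.succAbove j) - Z (i0.succAbove i) j0 * Z i0 (j0.succAbove j)

lemma schur_map {R S : Type*} [CommRing R] [CommRing S] (φ : R →+* S) (Z : Matrix (Fin (m+1)) (Fin (n+1)) R) (i0 j0) :
    (schur Z i0 j0).map φ = schur (Z.map φ) i0 j0 := by
  ext i j
  simp [schur]

lemma rank_add_le' {F : Type*} [Field F] (A B : Matrix (Fin m) (Fin n) F) : (A + B).rank ≤ A.rank + B.rank := by
  simp only [Matrix.rank]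
  have : LinearMap.range (A + B).mulVecLin ≤ LinearMap.range A.mulVecLin ⊔ LinearMap.range B.mulVecLin := by
    rintro _ ⟨v, rfl⟩
    rw [Matrix.mulVecLin_add, LinearMap.add_apply]
    exact Submodule.add_mem_sup ⟨v, rfl⟩ ⟨v, rfl⟩
  exact (Submodule.finrank_mono this).trans (Submodule.finrank_add_le_finrank_add_finrank _ _)

lemma schur_rank {F : Type*} [Field F] (Z : Matrix (Fin (m+1)) (Fin (n+1)) F) (i0 : Fin (m+1)) (j0 : Fin (n+1))
    (hx : Z i0 j0 ≠ 0) : Z.rank = (schur Z i0 j0).rank + 1 := by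
  apply le_antisymm
  · let P : Matrix (Fin (m+1)) (Fin m) F := fun i i' => if i = i0.succAbove i' then (Z i0 j0)⁻¹ else 0
    let Q : Matrix (Fin n) (Fin (n+1)) F := fun j' j => if j = j0.succAbove j' then 1 else 0
    have h : Z = P * schur Z i0 j0 * Q + Matrix.vecMulVec (fun i => (Z i0 j0)⁻¹ * Z i j0) (fun j => Z i0 j) := by
      ext i j
      rw [Matrix.add_apply, Matrix.vecMulVec_apply]
      have hQ : ∀ (M : Matrix (Fin (m+1)) (Fin n) F) i j', (M * Q) i (j0.succAbove j') = M i j' := by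
        intro M i j'
        rw [Matrix.mul_apply, Finset.sum_eq_single j'] <;> simp [Q]
        intro b hb hc; exact absurd hc.symm hb
      have hQ0 : ∀ (M : Matrix (Fin (m+1)) (Fin n) F) i, (M * Q) i j0 = 0 := by
        intro M i
        rw [Matrix.mul_apply]
        apply Finset.sum_eq_zero
        intro b _
        simp [Q, (Fin.succAbove_ne j0 b).symm]
      have hP : ∀ (M : Matrix (Fin m) (Fin n) F) i' j, (P * M) (i0.succAbove i') j = (Z i0 j0)⁻¹ * M i' j := by
        intro M i' j
        rw [Matrix.mul_apply, Finset.sum_eq_single i'] <;> simp [P]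
        intro b hb hc; exact absurd hc.symm hb
      have hP0 : ∀ (M : Matrix (Fin m) (Fin n) F) j, (P * M) i0 j = 0 := by
        intro M i
        rw [Matrix.mul_apply]
        apply Finset.sum_eq_zero
        intro b _
        simp [P, (Fin.succAbove_ne i0 b).symm]
      rcases Fin.eq_self_or_eq_succAbove j0 j with rfl | ⟨j, rfl⟩
      · rw [hQ0]; field_simp; simp
      · rw [hQ]
        rcases Fin.eq_self_or_eq_succAbove i0 i with rfl | ⟨i, rfl⟩
        · rw [hP0]; field_simp; simp
        · rw [hP, schur]; field_simp; ring
    conv_lhs => rw [h]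
    refine (rank_add_le' _ _).trans (add_le_add ?_ (Matrix.rank_vecMulVec_le _ _))
    exact (Matrix.rank_mul_le_left _ _).trans (Matrix.rank_mul_le_right _ _)
  · set Y := schur Z i0 j0
    obtain ⟨s, hs⟩ : ∃ s, s = Y.rank := ⟨_, rfl⟩
    rw [← hs]
    obtain ⟨r, c, hr, hc, hd⟩ := rank_minor Y hs.le
    have hi := minor_rows Y r c hd
    let R : Fin (s+1) → (Fin (n+1) → F) := Fin.cons (Z i0) (fun l => Z (i0.succAbove (r l)))
    have hR : LinearIndependent F R := by
      rw [Fintype.linearIndependent_iff] at hi ⊢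
      intro g hg
      rw [Fin.sum_univ_succ] at hg
      simp only [R, Fin.cons_zero, Fin.cons_succ] at hg
      have e : ∀ j, g 0 * Z i0 j + ∑ l : Fin s, g l.succ * Z (i0.succAbove (r l)) j = 0 := by
        intro j
        have := congrFun hg j
        simpa using this
      have h1 := hi (fun l => g l.succ) (by
        ext j
        have e1 := e (j0.succAbove j)
        have e0 := e j0
        simp only [Finset.sum_apply, Pi.smul_apply, smul_eq_mul, Pi.zero_apply, Y, schur, mul_sub, Finset.sum_sub_distrib]
        have e2 : ∑ l : Fin s, g l.succ * (Z i0 j0 * Z (i0.succAbove (r l)) (j0.succAbove j)) =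
          Z i0 j0 * ∑ l : Fin s, g l.succ * Z (i0.succAbove (r l)) (j0.succAbove j) := by
          rw [Finset.mul_sum]; exact Finset.sum_congr rfl (fun _ _ => by ring)
        have e3 : ∑ l : Fin s, g l.succ * (Z (i0.succAbove (r l)) j0 * Z i0 (j0.succAbove j)) =
          Z i0 (j0.succAbove j) * ∑ l : Fin s, g l.succ * Z (i0.succAbove (r l)) j0 := by
          rw [Finset.mul_sum]; exact Finset.sum_congr rfl (fun _ _ => by ring)
        rw [e2, e3]
        linear_combination Z i0 j0 * e1 - Z i0 (j0.succAbove j) * e0)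
      have h0 : g 0 = 0 := by
        have := e j0
        simp only [h1, zero_mul, Finset.sum_const_zero, add_zero] at this
        exact (mul_eq_zero.1 this).resolve_right hx
      intro i
      refine Fin.cases h0 h1 i
    have h2 := finrank_span_eq_card hR
    rw [Fintype.card_fin] at h2
    rw [Matrix.rank_eq_finrank_span_row, ← h2]
    apply Submodule.finrank_mono
    apply Submodule.span_mono
    rintro _ ⟨i, rfl⟩
    refine Fin.cases ⟨i0, rfl⟩ (fun l => ⟨i0.succAbove (r l), rfl⟩) i

lemma schur_rad1 {R : Type uA} [CommRing R] (Z : Matrix (Fin (m+1)) (Fin (n+1)) R) (i0 : Fin (m+1)) (j0 : Fin (n+1)) (t : ℕ)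
    (f : R) (hf : f ∈ (minorsIdeal (t+1) Z).radical) : Z i0 j0 * f ∈ (minorsIdeal t (schur Z i0 j0)).radical := by
  apply mem_rad
  intro F _ φ h
  rw [minors_hom, schur_map] at h
  by_cases hx : φ (Z i0 j0) = 0
  · rw [map_mul, hx, zero_mul]
  · have h2 := schur_rank (Z.map φ) i0 j0 hx
    have h3 : (Z.map φ).rank < t + 1 := by omega
    rw [← minors_hom] at h3
    obtain ⟨N, hN⟩ := hf
    have := h3 _ hN
    rw [map_pow] at this
    rw [map_mul, eq_zero_of_pow_eq_zero this, mul_zero]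

lemma schur_rad2 {R : Type uA} [CommRing R] (Z : Matrix (Fin (m+1)) (Fin (n+1)) R) (i0 : Fin (m+1)) (j0 : Fin (n+1)) (t : ℕ)
    (f : R) (hf : f ∈ (minorsIdeal t (schur Z i0 j0)).radical) : Z i0 j0 * f ∈ (minorsIdeal (t+1) Z).radical := by
  apply mem_rad
  intro F _ φ h
  rw [minors_hom] at h
  by_cases hx : φ (Z i0 j0) = 0
  · rw [map_mul, hx, zero_mul]
  · have h2 := schur_rank (Z.map φ) i0 j0 hx
    have h3 : (schur (Z.map φ) i0 j0).rank < t := by omega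
    rw [← schur_map, ← minors_hom] at h3
    obtain ⟨N, hN⟩ := hf
    have := h3 _ hN
    rw [map_pow] at this
    rw [map_mul, eq_zero_of_pow_eq_zero this, mul_zero]

/-- replace zeros by a nonzero element -/
lemma nonzero_list {R : Type*} [CommRing R] [IsReduced R] (I : Ideal R) (hI : I ≠ ⊥) (fs : List R)
    (h : (Ideal.span {f | f ∈ fs}).radical = I.radical) :
    ∃ gs : List R, gs.length = fs.length ∧ (∀ g ∈ gs, g ≠ 0) ∧ (Ideal.span {f | f ∈ gs}).radical = I.radical := by
  classical
  obtain ⟨y, hy, hy0⟩ := Submodule.exists_mem_ne_zero_of_ne_bot hI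
  refine ⟨fs.map (fun f => if f = 0 then y else f), by simp, ?_, ?_⟩
  · intro g hg
    rw [List.mem_map] at hg
    obtain ⟨f, _, rfl⟩ := hg
    split_ifs with hf
    · exact hy0
    · exact hf
  · apply le_antisymm
    · rw [Ideal.radical_le_radical_iff, Ideal.span_le]
      intro g hg
      simp only [Set.mem_ofPred_eq, List.mem_map] at hg
      obtain ⟨f, hf, rfl⟩ := hg
      split_ifs with h0
      · exact Ideal.le_radical hy
      · rw [← h]; exact Ideal.le_radical (Ideal.subset_span hf)
    · rw [← h, Ideal.radical_le_radical_iff, Ideal.span_le]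
      intro f hf
      by_cases h0 : f = 0
      · rw [h0]; exact zero_mem _
      · apply Ideal.le_radical
        apply Ideal.subset_span
        simp only [Set.mem_ofPred_eq, List.mem_map]
        exact ⟨f, hf, by simp [h0]⟩

/-- generic list -/
lemma gen_list {R : Type*} [CommRing R] [IsDomain R] (t : ℕ) (X : Matrix (Fin m) (Fin n) R) (hI : minorsIdeal t X ≠ ⊥) :
    ∃ gs : List R, gs.length = m * n + 1 - t ^ 2 ∧ (∀ g ∈ gs, g ≠ 0) ∧
      (Ideal.span {f | f ∈ gs}).radical = (minorsIdeal t X).radical := by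
  rcases Nat.eq_zero_or_pos t with rfl | ht
  · have : minorsIdeal 0 X = ⊤ := by
      rw [Ideal.eq_top_iff_one]
      apply Ideal.subset_span
      exact ⟨Fin.elim0, Fin.elim0, fun a => a.elim0, fun a => a.elim0, by simp⟩
    rw [this]
    refine ⟨List.replicate (m * n + 1) 1, by simp, by simp, ?_⟩
    congr 1
    rw [Ideal.eq_top_iff_one]
    apply Ideal.subset_span
    simp
  · obtain ⟨fs, h1, h2⟩ := stmtA t 0 ht (Nat.zero_le _) (fun i => i.elim0) (fun i => i.elim0) (fun i => i.elim0) X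
      (fun i => i.elim0)
    obtain ⟨gs, g1, g2, g3⟩ := nonzero_list _ hI fs h2
    exact ⟨gs, by rw [g1, h1, add_zero], g2, g3⟩
end
end MA
end

section
universe u v
set_option linter.unusedSectionVars false
namespace CH

/-- elementary vanishing of the top local cohomology -/
def El {S : Type*} [CommRing S] (fs : List S) : Prop :=
  ∀ N : ℕ, ∃ M : ℕ, fs.prod ^ M ∈ Ideal.span {g | ∃ f ∈ fs, g = f ^ (M + N)}

lemma El_map {S T : Type*} [CommRing S] [CommRing T] (φ : S →+* T) (fs : List S) (h : El fs) : El (fs.map φ) := by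
  intro N
  obtain ⟨M, hM⟩ := h N
  refine ⟨M, ?_⟩
  have := Ideal.mem_map_of_mem φ hM
  rw [Ideal.map_span, map_pow, map_list_prod] at this
  refine Ideal.span_mono ?_ this
  rintro _ ⟨_, ⟨f, hf, rfl⟩, rfl⟩
  exact ⟨φ f, List.mem_map_of_mem hf, map_pow _ _ _⟩

section
variable {S L : Type u} {W : Type v} [CommRing S] [Field L] [Algebra S L] [Ring W] [Module W L]
  [hW : WA S L W]

lemma span_pow_mul (fs : List S) (K : ℕ) (y a : S) (hy : y ∈ Ideal.span {g | ∃ f ∈ fs, g = f ^ K}) (j : ℕ) :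
    (a * fs.prod) ^ j * y ∈ Ideal.span {g | ∃ f ∈ fs, g = f ^ (K + j)} := by
  refine Submodule.span_induction (p := fun y _ => (a * fs.prod) ^ j * y ∈ Ideal.span {g | ∃ f ∈ fs, g = f ^ (K + j)})
    ?_ ?_ ?_ ?_ hy
  · rintro _ ⟨f, hf, rfl⟩
    obtain ⟨c, hc⟩ := List.dvd_prod hf
    have : (a * fs.prod) ^ j * f ^ K = (a ^ j * c ^ j) * f ^ (K + j) := by
      rw [hc]; ring
    rw [this]
    exact Ideal.mul_mem_left _ _ (Ideal.subset_span ⟨f, hf, rfl⟩)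
  · simp
  · intro x y _ _ hx hy
    rw [mul_add]; exact add_mem hx hy
  · intro r x _ hx
    rw [smul_eq_mul, mul_left_comm]
    exact Ideal.mul_mem_left _ _ hx

lemma pr_pu (fs : List S) : pr (pu W fs) = fs.prod := by
  simp [pr, pu, Function.comp_def]

lemma mem_Bd (fs : List S) (hf : ∀ f ∈ fs, algebraMap S L f ≠ 0) : ∀ (a : S) (ha : algebraMap S L a ≠ 0) (x : L),
    x ∈ Bd L (pu W fs) a ↔ ∃ K : ℕ, ∃ y ∈ Ideal.span {g | ∃ f ∈ fs, g = f ^ K},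
      algebraMap S L (a * fs.prod) ^ K * x = algebraMap S L y := by
  induction fs with
  | nil =>
    intro a ha x
    simp only [pu, List.map_nil, Bd, AddSubgroup.mem_bot]
    constructor
    · rintro rfl; exact ⟨0, 0, by simp, by simp⟩
    · rintro ⟨K, y, hy, h⟩
      simp at hy
      rw [hy, map_zero, mul_eq_zero] at h
      rcases h with h | h
      · simp only [List.prod_nil, mul_one] at h
        exact absurd h (pow_ne_zero _ ha)
      · exact h
  | cons f fs ih =>
    intro a ha x
    have hf0 : algebraMap S L f ≠ 0 := hf f (by simp)
    have hfs : ∀ g ∈ fs, algebraMap S L g ≠ 0 := fun g hg => hf g (by simp [hg])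
    have haf : algebraMap S L (a * f) ≠ 0 := by rw [map_mul]; exact mul_ne_zero ha hf0
    have hsub : ∀ K, Ideal.span {g | ∃ f ∈ fs, g = f ^ K} ≤ Ideal.span {g | ∃ f' ∈ f :: fs, g = f' ^ K} := by
      intro K
      apply Ideal.span_mono
      rintro _ ⟨g, hg, rfl⟩
      exact ⟨g, by simp [hg], rfl⟩
    have e0 : Bd L (pu W (f :: fs)) a = (SS S L (a * pr (pu W fs))).map (DistribSMul.toAddMonoidHom L (1 : W)) ⊔
        Bd L (pu W fs) (a * f) := rfl
    rw [e0, pr_pu]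
    have h1 : (SS S L (a * fs.prod)).map (DistribSMul.toAddMonoidHom L (1 : W)) = SS S L (a * fs.prod) := by
      have : DistribSMul.toAddMonoidHom L (1 : W) = AddMonoidHom.id L := by ext x; simp
      rw [this, AddSubgroup.map_id]
    rw [h1, AddSubgroup.mem_sup, List.prod_cons]
    constructor
    · rintro ⟨u, ⟨K, s, hs⟩, v, hv, rfl⟩
      rw [ih hfs _ haf] at hv
      obtain ⟨K', y, hy, hv⟩ := hv
      refine ⟨K + K', (a * fs.prod) ^ K' * s * f ^ (K + K') + (a * f * fs.prod) ^ K * y, ?_, ?_⟩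
      · apply add_mem
        · exact Ideal.mul_mem_left _ _ (Ideal.subset_span ⟨f, by simp, rfl⟩)
        · apply hsub
          rw [add_comm K K']
          exact span_pow_mul fs K' y _ hy K
      · simp only [map_add, map_mul, map_pow] at hs hv ⊢
        rw [← hs, ← hv]; ring
    · rintro ⟨K, y, hy, h⟩
      have : ∃ s, ∃ y' ∈ Ideal.span {g | ∃ f ∈ fs, g = f ^ K}, y = s * f ^ K + y' := by
        have e : {g | ∃ f' ∈ f :: fs, g = f' ^ K} = insert (f ^ K) {g | ∃ f ∈ fs, g = f ^ K} := by
          ext g; simp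
        rw [e, Ideal.mem_span_insert] at hy
        exact hy
      obtain ⟨s, y', hy', rfl⟩ := this
      have hp : algebraMap S L (a * fs.prod) ≠ 0 := by
        rw [map_mul, map_list_prod]
        apply mul_ne_zero ha
        apply List.prod_ne_zero
        simp only [List.mem_map, not_exists, not_and]
        exact hfs
      refine ⟨algebraMap S L s / algebraMap S L (a * fs.prod) ^ K, ⟨K, s, by field_simp⟩, x - algebraMap S L s / algebraMap S L (a * fs.prod) ^ K, ?_, by ring⟩
      rw [ih hfs _ haf]
      refine ⟨K, y', hy', ?_⟩
      have e : algebraMap S L (a * f * fs.prod) ^ K * (algebraMap S L s / algebraMap S L (a * fs.prod) ^ K) =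
        algebraMap S L (s * f ^ K) := by
        have : a * f * fs.prod = (a * fs.prod) * f := by ring
        rw [this, map_mul (algebraMap S L) (a * fs.prod) f, mul_pow, map_mul (algebraMap S L) s, map_pow]
        field_simp
      have e2 : algebraMap S L (a * f * fs.prod) ^ K * x = algebraMap S L (s * f ^ K + y') := by
        rw [← h]; congr 3; ring
      rw [mul_sub, e, e2, map_add]; ring

lemma E_of_El (fs : List S) (hf : ∀ f ∈ fs, f ≠ 0) (h : El fs) (a : S) (ha : a ≠ 0) : E L (pu W fs) a fs.length := by
  have hi : ∀ s : S, s ≠ 0 → algebraMap S L s ≠ 0 := fun s hs h => hs (hW.inj s h)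
  have hl : (pu W fs).length = fs.length := by simp [pu]
  rw [← hl, top_iff, pr_pu]
  rintro x ⟨N, s, hs⟩
  rw [mem_Bd fs (fun f hf' => hi f (hf f hf')) a (hi a ha)]
  obtain ⟨M, hM⟩ := h N
  refine ⟨M + N, a ^ M * s * fs.prod ^ M, Ideal.mul_mem_left _ _ hM, ?_⟩
  rw [pow_add, mul_assoc, hs]
  simp only [map_mul, map_pow]; ring

lemma El_of_E (fs : List S) (hf : ∀ f ∈ fs, f ≠ 0) (h : E L (pu W fs) 1 fs.length) : El fs := by
  have hi : ∀ s : S, s ≠ 0 → algebraMap S L s ≠ 0 := fun s hs h => hs (hW.inj s h)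
  have hinj : Function.Injective (algebraMap S L) := by
    rw [injective_iff_map_eq_zero]; exact hW.inj
  have hl : (pu W fs).length = fs.length := by simp [pu]
  rw [← hl, top_iff, pr_pu] at h
  intro N
  have hp : algebraMap S L fs.prod ≠ 0 := by
    rw [map_list_prod]
    apply List.prod_ne_zero
    simp only [List.mem_map, not_exists, not_and]
    exact fun f hf' => hi f (hf f hf')
  have h1 : (1 : L) / algebraMap S L fs.prod ^ N ∈ SS S L (1 * fs.prod) := by
    refine ⟨N, 1, ?_⟩
    rw [one_mul, map_one]; field_simp
  have h2 := h h1
  rw [mem_Bd fs (fun f hf' => hi f (hf f hf')) 1 (by simp)] at h2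
  obtain ⟨K, y, hy, h2⟩ := h2
  refine ⟨K, ?_⟩
  have := span_pow_mul fs K y 1 hy N
  rw [one_mul] at this h2
  have e : fs.prod ^ K = fs.prod ^ N * y := by
    apply hinj
    rw [map_mul, ← h2, map_pow, map_pow]
    field_simp
  rw [e]
  exact this
end

section
variable {R R' : Type u} [CommRing R] [IsDomain R] [CommRing R'] [IsDomain R']

lemma minors_map {A B : Type*} [CommRing A] [CommRing B] {m n : ℕ} (φ : A →+* B) (t : ℕ) (X : Matrix (Fin m) (Fin n) A) :
    minorsIdeal t (X.map φ) = (minorsIdeal t X).map φ := by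
  rw [minorsIdeal, minorsIdeal, Ideal.map_span]
  congr 1
  ext d
  constructor
  · rintro ⟨r, c, hr, hc, rfl⟩
    exact ⟨_, ⟨r, c, hr, hc, rfl⟩, by rw [RingHom.map_det]; rfl⟩
  · rintro ⟨_, ⟨r, c, hr, hc, rfl⟩, rfl⟩
    exact ⟨r, c, hr, hc, by rw [RingHom.map_det]; rfl⟩

open MA in
lemma stepC {m n t : ℕ} (π : R →+* R') (ι : R' →+* R) (x : R) (hx : x ≠ 0) (hπι : ∀ r, π (ι r) = r)
    (hk : ∀ r, x ∣ r - ι (π r)) (hπx : π x = 0) (X : Matrix (Fin (m+1)) (Fin (n+1)) R) (i0 j0) (hX : X i0 j0 = x)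
    (q : List R) (hq0 : ∀ f ∈ q, f ≠ 0) (hq : (Ideal.span {f | f ∈ q}).radical = (minorsIdeal (t+1) X).radical)
    (hql : m * n + 1 - t ^ 2 < q.length)
    (q' : List R') (hq0' : ∀ f ∈ q', f ≠ 0)
    (hq' : (Ideal.span {f | f ∈ q'}).radical = (minorsIdeal (t+1) (X.map π)).radical)
    (hql' : q'.length + 1 = q.length) (h : El q') : El q := by
  let L := FractionRing R
  have hι : Function.Injective ι := Function.LeftInverse.injective hπι
  have h1 : El (q'.map ι) := El_map ι q' h
  have h0 : ∀ f ∈ q'.map ι, f ≠ 0 := by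
    intro f hf
    obtain ⟨g, hg, rfl⟩ := List.mem_map.1 hf
    exact fun h => hq0' g hg (hι (by rw [h, map_zero]))
  have h2 : E L (pu R (x :: q'.map ι)) 1 q.length := by
    refine L1 (fun y => by rw [one_smul, one_smul]) ?_ ?_
    · apply E_high
      simp [pu]; omega
    · rw [one_mul]
      have := E_of_El (L := L) (W := R) (q'.map ι) h0 h1 x hx
      rw [List.length_map] at this
      have e : (q.length : ℤ) - 1 = q'.length := by rw [← hql']; push_cast; ring
      rw [e]
      exact this
  have hxq : ∀ r, x ∣ r → r ∈ (Ideal.span {f | f ∈ x :: q}).radical := by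
    rintro _ ⟨c, rfl⟩
    exact Ideal.le_radical (Ideal.mul_mem_right _ _ (Ideal.subset_span (by simp)))
  have hxq' : ∀ r, x ∣ r → r ∈ (Ideal.span {f | f ∈ x :: q'.map ι}).radical := by
    rintro _ ⟨c, rfl⟩
    exact Ideal.le_radical (Ideal.mul_mem_right _ _ (Ideal.subset_span (by simp)))
  have hsub : (Ideal.span {f | f ∈ q}).radical ≤ (Ideal.span {f | f ∈ x :: q}).radical := by
    apply Ideal.radical_mono
    apply Ideal.span_mono
    intro f hf; simp at hf ⊢; exact Or.inr hf
  have h3 : E L (pu R (x :: q)) 1 q.length := by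
    refine (rad_change [] List.Pairwise.nil (x :: q'.map ι) (x :: q) 1 one_ne_zero ?_ ?_ _).2 h2
    · intro f hf
      rw [one_mul]
      rcases List.mem_cons.1 hf with rfl | hf
      · exact ⟨hx, hxq _ dvd_rfl⟩
      · refine ⟨h0 f hf, ?_⟩
        obtain ⟨g, hg, rfl⟩ := List.mem_map.1 hf
        have : g ∈ (minorsIdeal (t+1) (X.map π)).radical := by
          rw [← hq']; exact Ideal.le_radical (Ideal.subset_span hg)
        obtain ⟨N, hN⟩ := this
        rw [minors_map, Ideal.mem_map_iff_of_surjective π (fun r => ⟨ι r, hπι r⟩)] at hN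
        obtain ⟨y, hy, hyN⟩ := hN
        have h4 : ι g ^ N ∈ (Ideal.span {f | f ∈ x :: q}).radical := by
          have e : ι g ^ N = y - (y - ι (π y)) := by rw [hyN, map_pow]; ring
          rw [e]
          exact sub_mem (hsub (hq ▸ Ideal.le_radical hy)) (hxq _ (hk y))
        exact Ideal.mem_radical_of_pow_mem h4
    · intro f hf
      rw [one_mul]
      rcases List.mem_cons.1 hf with rfl | hf
      · exact ⟨hx, hxq' _ dvd_rfl⟩
      · refine ⟨hq0 f hf, ?_⟩
        have : f ∈ (minorsIdeal (t+1) X).radical := by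
          rw [← hq]; exact Ideal.le_radical (Ideal.subset_span hf)
        obtain ⟨N, hN⟩ := this
        have h4 : π (f ^ N) ∈ (Ideal.span {f | f ∈ q'}).radical := by
          rw [hq', minors_map]
          exact Ideal.le_radical (Ideal.mem_map_of_mem _ hN)
        obtain ⟨M, hM⟩ := h4
        have h5 := Ideal.mem_map_of_mem ι hM
        rw [Ideal.map_span, ← map_pow] at h5
        have h6 : (f ^ N) ^ M ∈ (Ideal.span {f | f ∈ x :: q'.map ι}).radical := by
          have e : (f ^ N) ^ M = ι (π ((f ^ N) ^ M)) + ((f ^ N) ^ M - ι (π ((f ^ N) ^ M))) := by ring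
          rw [e]
          refine add_mem (Ideal.le_radical (Ideal.span_mono ?_ h5)) (hxq' _ (hk _))
          rintro _ ⟨g, hg, rfl⟩
          exact List.mem_cons_of_mem _ (List.mem_map_of_mem hg)
        rw [← pow_mul] at h6
        exact Ideal.mem_radical_of_pow_mem h6
  -- Schur
  have hq1 : q ≠ [] := by rintro rfl; simp at hql
  obtain ⟨f0, hf0⟩ := List.exists_mem_of_ne_nil q hq1
  have hne : minorsIdeal t (schur X i0 j0) ≠ ⊥ := by
    intro hb
    have := schur_rad1 X i0 j0 t f0 (by rw [← hq]; exact Ideal.le_radical (Ideal.subset_span hf0))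
    rw [hb, hX] at this
    obtain ⟨N, hN⟩ := this
    rw [Ideal.mem_bot] at hN
    exact mul_ne_zero hx (hq0 _ hf0) (eq_zero_of_pow_eq_zero hN)
  obtain ⟨gs, g1, g2, g3⟩ := gen_list t (schur X i0 j0) hne
  have h4 : E L (pu R q) x q.length := by
    refine (rad_change [] List.Pairwise.nil gs q x hx ?_ ?_ _).2 ?_
    · intro f hf
      refine ⟨g2 f hf, ?_⟩
      rw [hq, ← hX]
      apply schur_rad2
      rw [← g3]; exact Ideal.le_radical (Ideal.subset_span hf)
    · intro f hf
      refine ⟨hq0 f hf, ?_⟩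
      rw [g3, ← hX]
      apply schur_rad1
      rw [← hq]; exact Ideal.le_radical (Ideal.subset_span hf)
    · apply E_high
      simp [op, pu]; omega
  apply El_of_E (L := L) (W := R) q hq0
  exact L2 h3 (by rw [one_mul]; exact h4)
end
end CH
end

section
universe u v
namespace CH
open MA

section
variable {K : Type u} [Field K] {m n : ℕ}

/-- sparse matrix -/
noncomputable def SX (K : Type u) [Field K] {m n k : ℕ} {σ : Type} (e : Fin m × Fin n ≃ (Fin k ⊕ σ)) :
    Matrix (Fin m) (Fin n) (MvPolynomial σ K) :=
  fun i j => Sum.elim (fun _ => 0) (fun l => MvPolynomial.X l) (e (i, j))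

lemma SX_ne_bot {k t : ℕ} {σ : Type} (e : Fin m × Fin n ≃ (Fin k ⊕ σ)) (htm : t ≤ m) (htn : t ≤ n)
    (hk : k ≤ m + n - 2 * t) (hd : ∀ h : Fin k, ((e.symm (Sum.inl h)).1 : ℕ) + ((e.symm (Sum.inl h)).2 : ℕ) ≤ (h : ℕ)) :
    minorsIdeal t (SX K e) ≠ ⊥ := by
  intro hb
  let r : Fin t → Fin m := fun i => ⟨m - t + i, by omega⟩
  let c : Fin t → Fin n := fun i => ⟨n - t + i, by omega⟩
  have hr : Function.Injective r := fun a b h => by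
    have := congrArg Fin.val h; simp only [r] at this; exact Fin.ext (by omega)
  have hc : Function.Injective c := fun a b h => by
    have := congrArg Fin.val h; simp only [c] at this; exact Fin.ext (by omega)
  have hmem : ((SX K e).submatrix r c).det ∈ minorsIdeal t (SX K e) := Ideal.subset_span ⟨r, c, hr, hc, rfl⟩
  rw [hb, Ideal.mem_bot] at hmem
  let φ : MvPolynomial σ K →+* K := (MvPolynomial.eval (fun s =>
    if ((e.symm (Sum.inr s)).1 : ℕ) + n = ((e.symm (Sum.inr s)).2 : ℕ) + m then 1 else 0))
  have h1 := congrArg φ hmem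
  rw [map_zero, RingHom.map_det] at h1
  have : φ.mapMatrix ((SX K e).submatrix r c) = 1 := by
    ext i j
    simp only [RingHom.mapMatrix_apply, Matrix.map_apply, Matrix.submatrix_apply, SX]
    rcases hp : e (r i, c j) with h | s
    · exfalso
      have := hd h
      rw [← hp, Equiv.symm_apply_apply] at this
      simp only [r, c] at this
      have := h.2
      omega
    · simp only [Sum.elim_inr, φ, MvPolynomial.eval_X]
      rw [← hp, Equiv.symm_apply_apply, Matrix.one_apply]
      simp only [r, c, Fin.ext_iff]
      congr 1
      apply propext
      omega
  rw [this, Matrix.det_one] at h1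
  exact one_ne_zero h1

/-- nonvanishing for sparse matrices -/
def PJ (K : Type u) [Field K] (m n t j : ℕ) : Prop :=
  ∀ (σ : Type) (e : Fin m × Fin n ≃ (Fin j ⊕ σ)),
    (∀ h : Fin j, ((e.symm (Sum.inl h)).1 : ℕ) + ((e.symm (Sum.inl h)).2 : ℕ) ≤ (h : ℕ)) →
    ∀ q : List (MvPolynomial σ K), (∀ f ∈ q, f ≠ 0) →
      (Ideal.span {f | f ∈ q}).radical = (minorsIdeal t (SX K e)).radical →
      q.length = m * n + 1 - (t ^ 2 + j) → ¬ El q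

lemma sparse_list {t k : ℕ} {σ : Type} (ht : 1 ≤ t) (e : Fin m × Fin n ≃ (Fin k ⊕ σ)) (htm : t ≤ m) (htn : t ≤ n)
    (hk : k ≤ m + n - 2 * t) (hd : ∀ h : Fin k, ((e.symm (Sum.inl h)).1 : ℕ) + ((e.symm (Sum.inl h)).2 : ℕ) ≤ (h : ℕ)) :
    ∃ q : List (MvPolynomial σ K), (∀ f ∈ q, f ≠ 0) ∧
      (Ideal.span {f | f ∈ q}).radical = (minorsIdeal t (SX K e)).radical ∧
      q.length = m * n + 1 - (t ^ 2 + k) := by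
  obtain ⟨fs, h1, h2⟩ := stmtA t k ht hk (fun i => e.symm (Sum.inl i)) hd
    (fun a b h => Sum.inl_injective (e.symm.injective h)) (SX K e) (by
      intro i
      simp only [SX, Prod.mk.eta, Equiv.apply_symm_apply, Sum.elim_inl])
  obtain ⟨gs, g1, g2, g3⟩ := nonzero_list _ (SX_ne_bot e htm htn hk hd) fs h2
  exact ⟨gs, g2, g3, by rw [g1, h1]⟩

set_option maxHeartbeats 2000000 in
lemma PJ_succ {m n t j : ℕ} (htm : t ≤ m) (htn : t ≤ n) (hj : j + 1 ≤ (m + 1) + (n + 1) - 2 * (t + 1))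
    (h : PJ K (m+1) (n+1) (t+1) j) : PJ K (m+1) (n+1) (t+1) (j+1) := by
  intro σ e' hd' q' hq0' hq' hl' hE
  let ε : (Fin (j + 1) ⊕ σ) ≃ (Fin j ⊕ (Fin 1 ⊕ σ)) :=
    (Equiv.sumCongr finSumFinEquiv.symm (Equiv.refl σ)).trans (Equiv.sumAssoc _ _ _)
  let e : Fin (m+1) × Fin (n+1) ≃ (Fin j ⊕ (Fin 1 ⊕ σ)) := e'.trans ε
  have he1 : ∀ h : Fin j, e.symm (Sum.inl h) = e'.symm (Sum.inl h.castSucc) := fun h => rfl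
  have he2 : ∀ p s, e p = Sum.inr (Sum.inr s) ↔ e' p = Sum.inr s := by
    intro p s
    rw [← Equiv.eq_symm_apply, ← Equiv.eq_symm_apply]
    rfl
  have hd : ∀ h : Fin j, ((e.symm (Sum.inl h)).1 : ℕ) + ((e.symm (Sum.inl h)).2 : ℕ) ≤ (h : ℕ) := by
    intro h
    rw [he1]
    exact hd' h.castSucc
  obtain ⟨q, hq0, hq, hl⟩ := sparse_list (K := K) (t := t+1) (by omega) e (by omega) (by omega) (by omega) hd
  have key : (m + 1) + (n + 1) + (t + 1) ^ 2 ≤ (m + 1) * (n + 1) + 2 * (t + 1) := by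
    obtain ⟨p, rfl⟩ := Nat.exists_eq_add_of_le htm
    obtain ⟨p', rfl⟩ := Nat.exists_eq_add_of_le htn
    nlinarith [Nat.zero_le (t * p), Nat.zero_le (t * p'), Nat.zero_le (p * p')]
  let π : MvPolynomial (Fin 1 ⊕ σ) K →ₐ[K] MvPolynomial σ K :=
    MvPolynomial.aeval (Sum.elim (fun _ => 0) MvPolynomial.X)
  let ι : MvPolynomial σ K →ₐ[K] MvPolynomial (Fin 1 ⊕ σ) K := MvPolynomial.rename Sum.inr
  have hπι : ∀ r, π (ι r) = r := by
    intro r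
    have : π.comp ι = AlgHom.id K _ := by
      apply MvPolynomial.algHom_ext
      intro s
      simp [π, ι]
    exact DFunLike.congr_fun this r
  let x : MvPolynomial (Fin 1 ⊕ σ) K := MvPolynomial.X (Sum.inl 0)
  have hk : ∀ r, x ∣ r - ι (π r) := by
    intro r
    rw [← Ideal.mem_span_singleton, ← Ideal.Quotient.eq]
    have : (Ideal.Quotient.mkₐ K (Ideal.span {x})) = (Ideal.Quotient.mkₐ K (Ideal.span {x})).comp (ι.comp π) := by
      apply MvPolynomial.algHom_ext
      rintro (a | s)
      · have : a = 0 := Subsingleton.elim _ _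
        subst this
        simp only [AlgHom.comp_apply, π, MvPolynomial.aeval_X, Sum.elim_inl, map_zero]
        rw [Ideal.Quotient.mkₐ_eq_mk, Ideal.Quotient.eq_zero_iff_mem]
        exact Ideal.mem_span_singleton_self _
      · simp [π, ι]
    exact DFunLike.congr_fun this r
  obtain ⟨⟨i0, j0⟩, hij⟩ : ∃ p, e p = Sum.inr (Sum.inl 0) := ⟨e.symm _, Equiv.apply_symm_apply _ _⟩
  have hmap : (SX K e).map (π : _ →+* _) = SX K e' := by
    ext1 i' j'
    simp only [Matrix.map_apply, SX]
    rcases h1 : e (i', j') with a | a | s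
    · have h2 := hd
      have : e' (i', j') = Sum.inl a.castSucc := by
        rw [← Equiv.eq_symm_apply, ← he1, Equiv.eq_symm_apply]; exact h1
      rw [this]; simp
    · have : ∃ b, e' (i', j') = Sum.inl b := by
        rcases h2 : e' (i', j') with b | s
        · exact ⟨b, rfl⟩
        · rw [(he2 _ _).2 h2] at h1; simp at h1
      obtain ⟨b, hb⟩ := this
      rw [hb]; simp [π]
    · rw [(he2 _ _).1 h1]; simp [π]
  refine h _ e hd q hq0 hq hl (stepC (π : _ →+* _) (ι : _ →+* _) x (MvPolynomial.X_ne_zero _) hπι hk (by simp [π, x]) (SX K e) i0 j0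
    (by simp only [SX, hij]; rfl) q hq0 hq ?_ q' hq0' (by rw [hmap]; exact hq') ?_ hE)
  · rw [hl]
    have : (t+1)^2 = t^2 + 2 * t + 1 := by ring
    have : (m+1) * (n+1) = m * n + m + n + 1 := by ring
    omega
  · omega

lemma PJ_all {m n t k : ℕ} (ht : 1 ≤ t) (htm : t ≤ m) (htn : t ≤ n) (hk : k ≤ m + n - 2 * t)
    (h : PJ K m n t 0) : PJ K m n t k := by
  induction k with
  | zero => exact h
  | succ k ih =>
    obtain ⟨t, rfl⟩ : ∃ s, t = s + 1 := ⟨t - 1, by omega⟩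
    obtain ⟨m, rfl⟩ : ∃ s, m = s + 1 := ⟨m - 1, by omega⟩
    obtain ⟨n, rfl⟩ : ∃ s, n = s + 1 := ⟨n - 1, by omega⟩
    exact PJ_succ (by omega) (by omega) hk (ih (by omega))

theorem stmt4_of (K : Type u) [Field K] (m n t k : ℕ)
    (ht1 : 1 ≤ t) (htm : t ≤ m) (hmn : m ≤ n)
    (hk3 : k ≤ m + n - 2 * t)
    (X : Matrix (Fin m) (Fin n) (MvPolynomial (Fin (m * n - k)) K))
    (e : Fin m × Fin n ≃ (Fin k ⊕ Fin (m * n - k)))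
    (hX : ∀ p : Fin m × Fin n,
      X p.1 p.2 = Sum.elim (fun _ => 0) (fun l => MvPolynomial.X l) (e p))
    (hdiag : ∀ h : Fin k,
      ((e.symm (Sum.inl h)).1 : ℕ) + ((e.symm (Sum.inl h)).2 : ℕ) ≤ (h : ℕ))
    (h0 : PJ K m n t 0) :
    araRank (minorsIdeal t X) = m * n - t ^ 2 - k + 1 ∧
      cohDim (minorsIdeal t X) = m * n - t ^ 2 - k + 1 := by
  have hXe : X = SX K e := by ext1 i j; exact hX (i, j)
  obtain ⟨q, hq0, hq, hl⟩ := sparse_list (K := K) ht1 e htm (by omega) hk3 hdiag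
  have key : m + n + t ^ 2 ≤ m * n + 2 * t := by
    obtain ⟨p, rfl⟩ := Nat.exists_eq_add_of_le htm
    obtain ⟨p', rfl⟩ := Nat.exists_eq_add_of_le hmn
    nlinarith [Nat.zero_le (t * p), Nat.zero_le (t * p'), Nat.zero_le (p * p'), Nat.zero_le (p * p)]
  rw [hXe]
  refine final_wrap _ q (m * n - t ^ 2 - k) (by omega) hq0 hq ?_
  intro hE
  exact PJ_all ht1 htm (by omega) hk3 h0 _ e hdiag q hq0 hq hl (El_of_E q hq0 hE)
end
end CH
end

section
universe u v
set_option linter.unusedVariables false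
set_option linter.unusedSectionVars false
namespace CH
section der
variable {K S L : Type u} [CommRing K] [CommRing S] [IsDomain S] [Algebra K S] [Field L] [Algebra S L] [IsFractionRing S L]

/-- square zero extension hom attached to a derivation -/
noncomputable def tsq (L : Type u) [Field L] [Algebra S L] (D : Derivation K S S) : S →+* TrivSqZeroExt L L where
  toFun s := TrivSqZeroExt.inl (algebraMap S L s) + TrivSqZeroExt.inr (algebraMap S L (D s))
  map_one' := by simp
  map_zero' := by simp
  map_add' x y := by ext <;> simp [Algebra.smul_def]
  map_mul' x y := by
    ext
    · simp
    · simp only [TrivSqZeroExt.snd_add, TrivSqZeroExt.snd_inl, TrivSqZeroExt.snd_inr, TrivSqZeroExt.snd_mul, TrivSqZeroExt.fst_add, TrivSqZeroExt.fst_inl, TrivSqZeroExt.fst_inr, add_zero, zero_add, Derivation.leibniz, map_add, map_mul, smul_eq_mul, op_smul_eq_smul]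

lemma tsq_unit (D : Derivation K S S) (y : nonZeroDivisors S) : IsUnit (tsq L D y) := by
  rw [TrivSqZeroExt.isUnit_iff_isUnit_fst]
  simp only [tsq, RingHom.coe_mk, MonoidHom.coe_mk, OneHom.coe_mk, TrivSqZeroExt.fst_add, TrivSqZeroExt.fst_inl, TrivSqZeroExt.fst_inr, add_zero]
  exact IsUnit.mk0 _ (IsFractionRing.to_map_ne_zero_of_mem_nonZeroDivisors y.2)

/-- extension of a derivation to the fraction field -/
noncomputable def dL (L : Type u) [Field L] [Algebra S L] [IsFractionRing S L] (D : Derivation K S S) : L →+ L where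
  toFun x := (IsLocalization.lift (M := nonZeroDivisors S) (tsq_unit (L := L) D) x).snd
  map_zero' := by simp
  map_add' x y := by simp

lemma dL_fst (D : Derivation K S S) (x : L) :
    (IsLocalization.lift (M := nonZeroDivisors S) (tsq_unit (L := L) D) x).fst = x := by
  have : ((TrivSqZeroExt.fstHom L L L).toRingHom.comp (IsLocalization.lift (M := nonZeroDivisors S) (tsq_unit (L := L) D))) =
      RingHom.id L := by
    apply IsLocalization.ringHom_ext (nonZeroDivisors S)
    ext s
    simp [tsq]
  exact RingHom.congr_fun this x

lemma dL_mul (D : Derivation K S S) (x y : L) : dL L D (x * y) = x * dL L D y + y * dL L D x := by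
  change TrivSqZeroExt.snd _ = _
  rw [map_mul, TrivSqZeroExt.snd_mul, dL_fst, dL_fst, op_smul_eq_smul, smul_eq_mul, smul_eq_mul]
  rfl

lemma dL_map (D : Derivation K S S) (s : S) : dL L D (algebraMap S L s) = algebraMap S L (D s) := by
  change TrivSqZeroExt.snd _ = _
  rw [IsLocalization.lift_eq]
  simp only [tsq, RingHom.coe_mk, MonoidHom.coe_mk, OneHom.coe_mk, TrivSqZeroExt.snd_add, TrivSqZeroExt.snd_inl, TrivSqZeroExt.snd_inr, zero_add]

lemma dL_pow (D : Derivation K S S) (x : L) (n : ℕ) : dL L D (x ^ n) = n * x ^ (n - 1) * dL L D x := by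
  induction n with
  | zero =>
    have := dL_map (L := L) D 1
    simpa using this
  | succ n ih =>
    rw [pow_succ, dL_mul, ih]
    rcases n with _ | n
    · simp
    · push_cast
      ring

lemma dL_ext (f : L →+ L) (hf : ∀ x y, f (x * y) = x * f y + y * f x) (h : ∀ s, f (algebraMap S L s) = 0) (x : L) : f x = 0 := by
  obtain ⟨a, b, hb, rfl⟩ := IsFractionRing.div_surjective (A := S) x
  have hb' : algebraMap S L b ≠ 0 := IsFractionRing.to_map_ne_zero_of_mem_nonZeroDivisors hb
  have h1 := hf (algebraMap S L b) (algebraMap S L a / algebraMap S L b)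
  rw [mul_div_cancel₀ _ hb', h, h, mul_zero, add_zero] at h1
  exact (mul_eq_zero.1 h1.symm).resolve_left hb'

lemma dL_comm (D D' : Derivation K S S) (h : ∀ s, D (D' s) = D' (D s)) (x : L) : dL L D (dL L D' x) = dL L D' (dL L D x) := by
  have := dL_ext (S := S) ((dL L D).comp (dL L D') - (dL L D').comp (dL L D)) (by
    intro x y
    simp only [AddMonoidHom.sub_apply, AddMonoidHom.comp_apply, dL_mul, map_add]
    ring) (by
    intro s
    simp only [AddMonoidHom.sub_apply, AddMonoidHom.comp_apply, dL_map, h, sub_self]) x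
  rwa [AddMonoidHom.sub_apply, sub_eq_zero] at this

/-- explicit formula for the derivative of a fraction -/
lemma dL_frac (D : Derivation K S S) (a s : S) (x : L) (N : ℕ) (h : algebraMap S L a ^ N * x = algebraMap S L s) :
    algebraMap S L a ^ (N + 1) * dL L D x = algebraMap S L (a * D s - N * D a * s) := by
  have h1 := congrArg (dL L D) h
  rw [dL_mul, dL_map, dL_pow, dL_map] at h1
  rw [map_sub, map_mul, map_mul, map_mul, ← h1, ← h, map_natCast]
  rcases N with _ | N
  · simp
  · simp only [Nat.add_sub_cancel]; ring

/-- the operators preserving all localizations -/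
def Wr (S L : Type u) [CommRing S] [Field L] [Algebra S L] : Subring (AddMonoid.End L) where
  carrier := {f | ∀ a x, x ∈ SS S L a → f x ∈ SS S L a}
  mul_mem' hf hg a x hx := hf a _ (hg a x hx)
  one_mem' a x hx := hx
  add_mem' hf hg a x hx := add_mem (hf a x hx) (hg a x hx)
  zero_mem' a x hx := zero_mem _
  neg_mem' hf a x hx := neg_mem (hf a x hx)

noncomputable instance waW : WA S L (Wr S L) where
  j := ((Module.toAddMonoidEnd L L).comp (algebraMap S L)).codRestrict (Wr S L) (by
    rintro s a x ⟨N, r, hr⟩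
    refine ⟨N, s * r, ?_⟩
    rw [map_mul, ← hr]
    change _ * (algebraMap S L s * x) = _
    ring)
  hj s x := rfl
  inj s h := (IsFractionRing.injective S L) (by rw [h, map_zero])
  stab a r x h := r.2 a x h

/-- derivations as operators -/
noncomputable def dW (L : Type u) [Field L] [Algebra S L] [IsFractionRing S L] (D : Derivation K S S) : Wr S L :=
  ⟨dL L D, by
    rintro a x ⟨N, s, hs⟩
    exact ⟨N + 1, _, dL_frac D a s x N hs⟩⟩

lemma dW_smul (D : Derivation K S S) (x : L) : dW L D • x = dL L D x := rfl

lemma W_ext {f g : Wr S L} (h : ∀ x : L, f • x = g • x) : f = g := Subtype.ext (AddMonoidHom.ext h)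

lemma dW_comm (D D' : Derivation K S S) (h : ∀ s, D (D' s) = D' (D s)) : Commute (dW L D) (dW L D') :=
  W_ext (fun x => by rw [mul_smul, mul_smul]; exact dL_comm D D' h x)

lemma dW_j (D : Derivation K S S) (s : S) : dW L D * waW.j s = waW.j s * dW L D + waW.j (D s) :=
  W_ext (fun x => by
    rw [mul_smul, add_smul, mul_smul, waW.hj, waW.hj, waW.hj, dW_smul, dW_smul, dL_mul, dL_map]
    ring)

lemma dW_j_comm (D : Derivation K S S) (s : S) (h : D s = 0) : Commute (dW L D) (waW.j s) := by
  have := dW_j (L := L) D s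
  rw [h, map_zero, add_zero] at this
  exact this
end der
end CH
end

section
universe u v
set_option linter.unusedVariables false
set_option linter.unusedSectionVars false
namespace CH
variable {S L : Type u} {W : Type v} [CommRing S] [Field L] [Algebra S L] [Ring W] [Module W L]
  [hW : WA S L W]

lemma L1' {r : W} {C : Cx S L W} {a : S} {i : ℤ} (hr : ∀ x, C.d (r • x) = r • C.d x) (h1 : Ex C a i)
    (h2 : ∀ z ∈ C.G a (i-1), C.d z = 0 → ∃ y ∈ C.G a (i-1), C.d y = 0 ∧ r • y = z) : Ex (fib r 1 C) a i := by
  rintro ⟨x, y⟩ ⟨hx, hy⟩ hxy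
  rw [fib_d] at hxy
  have e1 : C.d x = 0 := congrArg Prod.fst hxy
  have e2 : r • x - C.d y = 0 := congrArg Prod.snd hxy
  change x ∈ C.G a i at hx
  change y ∈ C.G (a * 1) (i - 1) at hy
  rw [mul_one] at hy
  obtain ⟨x', hx', hdx'⟩ := h1 x hx e1
  obtain ⟨z, hz, hdz, hrz⟩ := h2 (r • x' - y) (sub_mem (C.stab r hx') hy) (by rw [map_sub, hr, hdx', e2])
  refine ⟨(x' - z, 0), fib_G.2 ⟨sub_mem hx' hz, zero_mem _⟩, ?_⟩
  rw [fib_d, map_sub, hdz, hdx', map_zero, smul_sub, hrz]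
  refine Prod.ext (sub_zero _) ?_
  simp

lemma Ex_scale {r : W} {C : Cx S L W} {a b : S} {N : ℕ} {i : ℤ} (hb0 : b ≠ 0) (hb : b ∣ a ^ N)
    (hbd : ∀ x, C.d (hW.j b • x) = hW.j b • C.d x) (h : Ex (fib (hW.j b * r) 1 C) a i) : Ex (fib r 1 C) a i := by
  rintro ⟨x, y⟩ ⟨hx, hy⟩ hxy
  rw [fib_d] at hxy
  have e1 : C.d x = 0 := congrArg Prod.fst hxy
  have e2 : r • x - C.d y = 0 := congrArg Prod.snd hxy
  change x ∈ C.G a i at hx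
  change y ∈ C.G (a * 1) (i - 1) at hy
  obtain ⟨⟨x', y'⟩, hxy', hd⟩ := h (x, hW.j b • y) (fib_G.2 ⟨hx, C.stab _ hy⟩) (by
    rw [fib_d, e1, hbd, mul_smul, ← smul_sub, e2, smul_zero]; rfl)
  replace hxy' := fib_G.1 hxy'
  replace hd := (fib_d (hW.j b * r) 1 C x' y').symm.trans hd
  have e3 : C.d x' = x := congrArg Prod.fst hd
  have e4 : (hW.j b * r) • x' - C.d y' = hW.j b • y := congrArg Prod.snd hd
  obtain ⟨y'', hy'', rfl⟩ := C.div (N := N) hb0 (by rwa [mul_one]) hxy'.2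
  refine ⟨(x', y''), fib_G.2 ⟨hxy'.1, hy''⟩, ?_⟩
  rw [fib_d, e3]
  refine Prod.ext rfl ?_
  change r • x' - C.d y'' = y
  rw [hbd, mul_smul, ← smul_sub] at e4
  rw [← sub_eq_zero]
  refine C.inj hb0 ?_
  rw [smul_sub, e4, sub_self]

lemma fib2_d (r s : W) (C : Cx S L W) (x1 x2 y1 y2 : C.M) :
    (fib r 1 (fib s 1 C)).d (((x1, x2), (y1, y2)) : (C.M × C.M) × (C.M × C.M)) =
      (((C.d x1, s • x1 - C.d x2), (r • x1 - C.d y1, r • x2 - (s • y1 - C.d y2))) : (C.M × C.M) × (C.M × C.M)) := rfl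

lemma fib2_G {r s : W} {C : Cx S L W} {a : S} {i : ℤ} {x1 x2 y1 y2 : C.M} :
    (((x1, x2), (y1, y2)) : (C.M × C.M) × (C.M × C.M)) ∈ (fib r 1 (fib s 1 C)).G a i ↔
      (x1 ∈ C.G a i ∧ x2 ∈ C.G a (i - 1)) ∧ (y1 ∈ C.G a (i - 1) ∧ y2 ∈ C.G a (i - 1 - 1)) := by
  have : (((x1, x2), (y1, y2)) : (C.M × C.M) × (C.M × C.M)) ∈ (fib r 1 (fib s 1 C)).G a i ↔
      (x1 ∈ C.G a i ∧ x2 ∈ C.G (a * 1) (i - 1)) ∧ (y1 ∈ C.G (a * 1) (i - 1) ∧ y2 ∈ C.G (a * 1 * 1) (i - 1 - 1)) := Iff.rfl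
  simp only [mul_one] at this
  exact this

lemma Ex_basis {r s c : W} {C : Cx S L W} {a : S} {i : ℤ} (hcd : ∀ x, C.d (c • x) = c • C.d x) (hcs : Commute c s)
    (h : Ex (fib (r + c * s) 1 (fib s 1 C)) a i) : Ex (fib r 1 (fib s 1 C)) a i := by
  rintro ⟨⟨x1, x2⟩, ⟨y1, y2⟩⟩ hG hd
  obtain ⟨⟨hx1, hx2⟩, hy1, hy2⟩ := fib2_G.1 hG
  replace hd := (fib2_d r s C x1 x2 y1 y2).symm.trans hd
  have e1 : C.d x1 = 0 := congrArg (fun z => z.1.1) hd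
  have e2 : s • x1 - C.d x2 = 0 := congrArg (fun z => z.1.2) hd
  have e3 : r • x1 - C.d y1 = 0 := congrArg (fun z => z.2.1) hd
  have e4 : r • x2 - (s • y1 - C.d y2) = 0 := congrArg (fun z => z.2.2) hd
  obtain ⟨⟨⟨u1, u2⟩, ⟨w1, w2⟩⟩, hG', hd'⟩ := h ((x1, x2), (y1 + c • x2, y2)) (fib2_G.2 ⟨⟨hx1, hx2⟩, add_mem hy1 (C.stab c hx2), hy2⟩) (by
    refine (fib2_d _ _ _ _ _ _ _).trans ?_
    refine Prod.ext (Prod.ext e1 e2) (Prod.ext ?_ ?_)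
    · change (r + c * s) • x1 - C.d (y1 + c • x2) = 0
      rw [map_add, hcd, add_smul, mul_smul, add_sub_add_comm, e3, ← smul_sub, e2, smul_zero, add_zero]
    · change (r + c * s) • x2 - (s • (y1 + c • x2) - C.d y2) = 0
      rw [← e4, add_smul, smul_add, hcs.eq, mul_smul]; abel)
  replace hG' := fib2_G.1 hG'
  replace hd' := (fib2_d (r + c * s) s C u1 u2 w1 w2).symm.trans hd'
  have f1 : C.d u1 = x1 := congrArg (fun z => z.1.1) hd'
  have f2 : s • u1 - C.d u2 = x2 := congrArg (fun z => z.1.2) hd'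
  have f3 : (r + c * s) • u1 - C.d w1 = y1 + c • x2 := congrArg (fun z => z.2.1) hd'
  have f4 : (r + c * s) • u2 - (s • w1 - C.d w2) = y2 := congrArg (fun z => z.2.2) hd'
  refine ⟨((u1, u2), (w1 - c • u2, w2)), ?_, ?_⟩
  · exact fib2_G.2 ⟨hG'.1, sub_mem hG'.2.1 (C.stab c hG'.1.2), hG'.2.2⟩
  · refine (fib2_d _ _ _ _ _ _ _).trans ?_
    refine Prod.ext (Prod.ext f1 f2) (Prod.ext ?_ ?_)
    · change r • u1 - C.d (w1 - c • u2) = y1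
      rw [← add_right_cancel_iff (a := c • x2), ← f3, ← f2, map_sub, hcd, add_smul, smul_sub, mul_smul]; abel
    · change r • u2 - (s • (w1 - c • u2) - C.d w2) = y2
      rw [← f4, add_smul, smul_sub, hcs.eq, mul_smul]; abel

lemma E_basis {r s c : W} {l : List (W × S)} {a : S} {i : ℤ} (hs : (s, (1 : S)) ∈ l) (hc : ∀ p ∈ l, Commute p.1 c)
    (h : E L ((r + c * s, 1) :: l) a i) : E L ((r, 1) :: l) a i := by
  classical
  obtain ⟨l1, l2, rfl⟩ := List.append_of_mem hs
  have hp : (l1 ++ (s, (1 : S)) :: l2).Perm ((s, 1) :: (l1 ++ l2)) := List.perm_middle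
  rw [E_perm (hp.cons _)] at h ⊢
  refine Ex_basis ?_ ?_ h
  · intro x
    exact tot_comm _ c (fun p hp => hc p (by simp at hp ⊢; tauto)) x
  · exact (hc (s, 1) hs).symm

lemma E_basis_list {l : List (W × S)} {a : S} {i : ℤ} (cs : List (W × W)) : ∀ {r : W}, (∀ p ∈ cs, (p.2, (1 : S)) ∈ l) → (∀ q ∈ cs, ∀ p ∈ l, Commute p.1 q.1) →
    (h : E L ((r + (cs.map (fun p => p.1 * p.2)).sum, 1) :: l) a i) → E L ((r, 1) :: l) a i := by
  induction cs with
  | nil => intro r _ _ h; simpa using h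
  | cons p cs ih =>
    intro r h1 h2 h
    refine E_basis (h1 p (by simp)) (h2 p (by simp)) (ih (fun q hq => h1 q (by simp [hq])) (fun q hq => h2 q (by simp [hq])) ?_)
    simpa [add_assoc] using h

lemma tot_nil {D : W} {P : S → Prop} (hP : ∀ a b, P a → P b → P (a * b))
    (hb : ∀ a, P a → ∀ x ∈ SS S L a, ∃ N : ℕ, D ^ N • x = 0) (l : List (W × S)) : (∀ p ∈ l, P p.2) →
    ∀ a, P a → ∀ i, ∀ x ∈ (tot (L := L) l).G a i, ∃ N : ℕ, D ^ N • x = 0 := by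
  induction l with
  | nil =>
    intro _ a ha i x hx
    by_cases hi : i = 0
    · subst hi
      exact hb a ha x hx
    · have : ∀ y : L, y ∈ (if i = 0 then SS S L a else ⊥ : AddSubgroup L) → y = 0 := by
        intro y hy
        rwa [if_neg hi, AddSubgroup.mem_bot] at hy
      refine ⟨0, ?_⟩
      rw [this x hx]
      exact smul_zero (A := L) _
  | cons p l ih =>
    rintro hl a ha i ⟨x, y⟩ hxy
    have ih := ih (fun q hq => hl q (by simp [hq]))
    have h := fib_G.1 hxy
    obtain ⟨N1, h1⟩ := ih a ha _ _ h.1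
    obtain ⟨N2, h2⟩ := ih _ (hP _ _ ha (hl p (by simp))) _ _ h.2
    refine ⟨N1 + N2, Prod.ext ?_ ?_⟩
    · change D ^ (N1 + N2) • x = 0
      rw [add_comm, pow_add, mul_smul, h1, smul_zero]
    · change D ^ (N1 + N2) • y = 0
      rw [pow_add, mul_smul, h2, smul_zero]

lemma heis_pow {D X v : W} (hDX : D * X = X * D + v) (hXv : Commute X v) (s : ℕ) :
    D * X ^ (s + 1) = X ^ (s + 1) * D + ((s : W) + 1) * (X ^ s * v) := by
  induction s with
  | zero => simp [hDX]
  | succ s ih =>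
    rw [pow_succ X (s + 1), ← mul_assoc, ih, add_mul, mul_assoc (X ^ (s+1)) D X, hDX]
    have e : X ^ s * v * X = X ^ (s + 1) * v := by rw [mul_assoc, ← hXv.eq, pow_succ, mul_assoc]
    rw [mul_assoc ((s : W) + 1), e]
    push_cast
    noncomm_ring

lemma heis {D : W} {x b a : S} {N : ℕ} {C : Cx S L W} (hb0 : b ≠ 0) (hb : b ∣ a ^ N)
    (hDx : D * hW.j x = hW.j x * D + hW.j b) (hDb : Commute D (hW.j b))
    (hch : ∀ n : ℕ, ∃ c : S, ((n : S) + 1) * c = 1)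
    (d1 : ∀ z, C.d (hW.j x • z) = hW.j x • C.d z) (d2 : ∀ z, C.d (hW.j b • z) = hW.j b • C.d z)
    (d3 : ∀ z, C.d (D • z) = D • C.d z) (i : ℤ) (q : ℕ) :
    ∀ z ∈ C.G a i, C.d z = 0 → D ^ q • z = 0 → ∀ s : ℕ, ∃ y ∈ C.G a i, C.d y = 0 ∧ D • y = hW.j x ^ s • z := by
  have d1' : ∀ (s : ℕ) z, C.d (hW.j x ^ s • z) = hW.j x ^ s • C.d z := by
    intro s
    induction s with
    | zero => intro z; simp
    | succ s ih => intro z; rw [pow_succ, mul_smul, mul_smul, ih, d1]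
  have dn : ∀ (n : ℕ) z, C.d (((n : W) + 1) • z) = ((n : W) + 1) • C.d z := by
    intro n z
    rw [← Nat.cast_succ, Nat.cast_smul_eq_nsmul, Nat.cast_smul_eq_nsmul, map_nsmul]
  induction q with
  | zero =>
    intro z hz hd h s
    rw [pow_zero, one_smul] at h
    exact ⟨0, zero_mem _, map_zero _, by rw [h, smul_zero, smul_zero]⟩
  | succ q ih =>
    intro z hz hd h s
    obtain ⟨z', hz', rfl⟩ := C.div hb0 hb hz
    have hdz' : C.d z' = 0 := by
      rw [d2] at hd; exact C.inj hb0 hd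
    have hDz' : D ^ (q+1) • z' = 0 := by
      refine C.inj hb0 ?_
      rw [← mul_smul, ← (hDb.pow_left (q+1)).eq, mul_smul, h]
    obtain ⟨y', hy', hdy', hDy'⟩ := ih (D • z') (C.stab _ hz') (by rw [d3, hdz', smul_zero])
      (by rw [← mul_smul, ← pow_succ]; exact hDz') (s + 1)
    obtain ⟨c, hc⟩ := hch s
    have hc1 : ((s : W) + 1) * hW.j c = 1 := by
      have := congrArg hW.j hc
      simpa using this
    have hcom : ∀ r : W, ((s : W) + 1) * r = r * ((s : W) + 1) := fun r => by
      rw [add_mul, mul_add, (Nat.cast_commute s r).eq]; simp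
    have hc2 : ∀ r : W, r * hW.j c = hW.j c * r := by
      intro r
      calc r * hW.j c = (hW.j c * ((s : W) + 1)) * (r * hW.j c) := by rw [← hcom, hc1, one_mul]
        _ = hW.j c * (((s : W) + 1) * r) * hW.j c := by noncomm_ring
        _ = hW.j c * (r * (((s : W) + 1) * hW.j c)) := by rw [hcom]; noncomm_ring
        _ = _ := by rw [hc1, mul_one]
    refine ⟨hW.j c • (hW.j x ^ (s+1) • z' - y'), C.stab _ (sub_mem (C.stab _ hz') hy'), ?_, ?_⟩
    · have h0 : ((s : W) + 1) • C.d (hW.j c • (hW.j x ^ (s+1) • z' - y')) = 0 := by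
        rw [← dn, ← mul_smul, hc1, one_smul, map_sub, d1', hdz', hdy', smul_zero, sub_zero]
      have : hW.j c • ((s : W) + 1) • C.d (hW.j c • (hW.j x ^ (s+1) • z' - y')) = 0 := by rw [h0, smul_zero]
      rwa [← mul_smul, ← hcom, hc1, one_smul] at this
    · rw [← mul_smul, hc2, mul_smul, smul_sub, hDy', ← mul_smul D,
        heis_pow hDx ((Commute.all x b).map hW.j) s, add_smul, mul_smul _ D, add_sub_cancel_left, ← mul_smul, ← mul_assoc,
        ← hcom, hc1, one_mul, mul_smul]

/-- adding an operator for free -/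
lemma E_free {l : List (W × S)} {a b x : S} {N : ℕ} {i : ℤ} {r D : W} (cs : List (W × W)) {P : S → Prop}
    (hch : ∀ n : ℕ, ∃ c : S, ((n : S) + 1) * c = 1)
    (hP : ∀ a b, P a → P b → P (a * b)) (hPn : ∀ a, P a → ∀ x ∈ SS S L a, ∃ N : ℕ, D ^ N • x = 0)
    (hb0 : b ≠ 0) (hb : b ∣ a ^ N) (hPa : P a) (hPl : ∀ p ∈ l, P p.2)
    (hD : D = hW.j b * r + (cs.map (fun p => p.1 * p.2)).sum)
    (h1 : ∀ p ∈ cs, (p.2, (1 : S)) ∈ l) (h2 : ∀ q ∈ cs, ∀ p ∈ l, Commute p.1 q.1)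
    (hDx : D * hW.j x = hW.j x * D + hW.j b) (hDb : Commute D (hW.j b))
    (hlx : ∀ p ∈ l, Commute p.1 (hW.j x)) (hlb : ∀ p ∈ l, Commute p.1 (hW.j b)) (hlD : ∀ p ∈ l, Commute p.1 D)
    (h : E L l a i) : E L ((r, 1) :: l) a i := by
  refine Ex_scale hb0 hb (tot_comm l _ hlb) ?_
  refine E_basis_list (r := hW.j b * r) cs h1 h2 ?_
  rw [← hD]
  refine L1' (tot_comm l _ hlD) h ?_
  intro z hz hd
  obtain ⟨q, hq⟩ := tot_nil hP hPn l hPl a hPa _ z hz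
  obtain ⟨y, hy, hdy, hDy⟩ := heis hb0 hb hDx hDb hch (tot_comm l _ hlx) (tot_comm l _ hlb) (tot_comm l _ hlD) (i-1) q z hz hd hq 0
  exact ⟨y, hy, hdy, by rw [hDy, pow_zero, one_smul]⟩
end CH
end

section
universe u v
set_option linter.unusedVariables false
set_option linter.unusedSectionVars false
namespace CH
open MvPolynomial
section kap
variable {K : Type u} [Field K] {σ : Type} {m : ℕ}

/-- constant exponent -/
noncomputable def ce (m N : ℕ) : Fin m →₀ ℕ := Finsupp.equivFunOnFinite.symm (fun _ => N)

@[simp] lemma ce_apply (N : ℕ) (i : Fin m) : ce m N i = N := rfl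

lemma ce_add (N M : ℕ) : ce m (N + M) = ce m N + ce m M := by ext; simp

/-- the coefficient of `∏ v ^ N` -/
noncomputable def kap (N : ℕ) (s : MvPolynomial (Fin m ⊕ σ) K) : MvPolynomial σ K :=
  coeff (ce m N) (sumRingEquiv K (Fin m) σ s)

/-- product of new variables -/
noncomputable def Vp (K : Type u) [Field K] (σ : Type) (m : ℕ) : MvPolynomial (Fin m ⊕ σ) K := ∏ i : Fin m, X (Sum.inl i)

lemma Vp_map : sumRingEquiv K (Fin m) σ (Vp K σ m) = monomial (ce m 1) 1 := by
  rw [Vp, map_prod, monomial_eq, map_one, one_mul, Finsupp.prod_fintype _ _ (by simp)]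
  simp

lemma ren_map (P : MvPolynomial σ K) : sumRingEquiv K (Fin m) σ (rename Sum.inr P) = C P := by
  have : ((sumRingEquiv K (Fin m) σ).toRingHom.comp (rename Sum.inr : MvPolynomial σ K →ₐ[K] _).toRingHom) = C := by
    apply MvPolynomial.ringHom_ext
    · intro r; simp
    · intro i; simp
  exact RingHom.congr_fun this P

lemma kap_add (N : ℕ) (s r : MvPolynomial (Fin m ⊕ σ) K) : kap N (s + r) = kap N s + kap N r := by
  simp [kap]

lemma kap_sub (N : ℕ) (s r : MvPolynomial (Fin m ⊕ σ) K) : kap N (s - r) = kap N s - kap N r := by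
  simp [kap]

lemma kap_ren (N : ℕ) (P : MvPolynomial σ K) (s : MvPolynomial (Fin m ⊕ σ) K) :
    kap N (rename Sum.inr P * s) = P * kap N s := by
  simp only [kap, map_mul, ren_map, coeff_C_mul]

lemma kap_V (N M : ℕ) (s : MvPolynomial (Fin m ⊕ σ) K) : kap (N + M) (Vp K σ m ^ M * s) = kap N s := by
  simp only [kap, map_mul, map_pow, Vp_map, monomial_pow, one_pow]
  have : M • ce m 1 = ce m M := by ext; simp
  rw [this, ce_add, add_comm, coeff_monomial_mul, one_mul]

lemma kap_v (N : ℕ) (i : Fin m) (s : MvPolynomial (Fin m ⊕ σ) K) : kap N (X (Sum.inl i) ^ (N + 1) * s) = 0 := by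
  simp only [kap, map_mul, map_pow, sumRingEquiv_X_inl]
  rw [X_pow_eq_monomial, coeff_monomial_mul', if_neg]
  intro h
  have := h i
  simp at this

lemma kap_inr (N : ℕ) (j : σ) (s : MvPolynomial (Fin m ⊕ σ) K) : kap N (pderiv (Sum.inr j) s) = pderiv j (kap N s) := by
  unfold kap
  generalize ce m N = e
  classical
  induction s using MvPolynomial.induction_on generalizing e with
  | C a => simp only [pderiv_C, map_zero, sumRingEquiv_C, coeff_zero, coeff_C]; split_ifs <;> simp
  | add p q hp hq => simp only [map_add, coeff_add, hp, hq]
  | mul_X p k ih =>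
    rcases k with i | k
    · rw [pderiv_mul, pderiv_X_of_ne (by simp), mul_zero, add_zero, map_mul, map_mul, sumRingEquiv_X_inl, coeff_mul_X', coeff_mul_X']
      split_ifs
      · rw [ih]
      · simp
    · rw [pderiv_mul, map_add, map_mul, map_mul, map_mul, sumRingEquiv_X_inr, coeff_add, mul_comm, coeff_C_mul, ih, mul_comm _ (C (X k)), coeff_C_mul, pderiv_mul,
        pderiv_X, mul_comm]
      by_cases h : k = j
      · subst h
        simp [add_comm, mul_comm]
      · simp [h, mul_comm]

lemma kap_inl (N : ℕ) (i : Fin m) (s : MvPolynomial (Fin m ⊕ σ) K) :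
    kap (N + 1) (Vp K σ m * pderiv (Sum.inl i) s - ((N + 1 : ℕ) : MvPolynomial (Fin m ⊕ σ) K) * pderiv (Sum.inl i) (Vp K σ m) * s) = 0 := by
  rw [kap_sub]
  have h1 := kap_V (m := m) N 1 (pderiv (Sum.inl i) s)
  rw [pow_one] at h1
  rw [h1]
  have e : ce m 1 - Finsupp.single i 1 + Finsupp.single i 1 = ce m 1 := by
    apply tsub_add_cancel_of_le
    intro k
    by_cases h : k = i <;> simp [h, Finsupp.single_apply, eq_comm]
  have hV : sumRingEquiv K (Fin m) σ (pderiv (Sum.inl i) (Vp K σ m)) = monomial (ce m 1 - Finsupp.single i 1) 1 := by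
    rw [← pderiv_sumRingEquiv, Vp_map, pderiv_monomial]
    simp
  simp only [kap, map_mul, map_natCast, hV]
  rw [← pderiv_sumRingEquiv, coeff_pderiv, mul_assoc]
  have e2 : ce m (N+1) = (ce m 1 - Finsupp.single i 1) + (ce m N + Finsupp.single i 1) := by
    rw [add_comm (ce m N), ← add_assoc, e, add_comm, ce_add]
  have e3 : ((N + 1 : ℕ) : MvPolynomial (Fin m) (MvPolynomial σ K)) = C ((N + 1 : ℕ) : MvPolynomial σ K) := by simp
  rw [e3, coeff_C_mul, e2, coeff_monomial_mul, one_mul]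
  simp
  ring
end kap
end CH
end

section
universe u v
set_option linter.unusedVariables false
set_option linter.unusedSectionVars false
namespace CH
open MvPolynomial
section bdlem
variable {S L : Type u} {W : Type v} [CommRing S] [IsDomain S] [Field L] [Algebra S L] [Ring W] [Module W L] [WA S L W]

lemma pr_cons (p : W × S) (l : List (W × S)) : pr (p :: l) = p.2 * pr l := by simp [pr]

lemma Bd_le (T : AddSubgroup L) : ∀ (l : List (W × S)) (a : S),
    (∀ p ∈ l, ∀ c, c * p.2 = a * pr l → ∀ x ∈ SS S L c, p.1 • x ∈ T) → Bd L l a ≤ T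
  | [], a, _ => bot_le
  | p :: l, a, h => by
    refine sup_le ?_ (Bd_le T l (a * p.2) ?_)
    · rintro _ ⟨x, hx, rfl⟩
      exact h p (by simp) (a * pr l) (by rw [pr_cons]; ring) x hx
    · intro q hq c hc x hx
      exact h q (by simp [hq]) c (by rw [hc, pr_cons]; ring) x hx

lemma mem_Bd' : ∀ (l : List (W × S)) (a : S) (p : W × S), p ∈ l → ∀ c, c * p.2 = a * pr l → p.2 ≠ 0 →
    ∀ x ∈ SS S L c, p.1 • x ∈ Bd L l a
  | q :: l, a, p, hp, c, hc, h0, x, hx => by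
    rw [pr_cons] at hc
    rcases List.mem_cons.1 hp with rfl | hp
    · refine AddSubgroup.mem_sup_left ⟨x, ?_, rfl⟩
      have : c = a * pr l := mul_right_cancel₀ h0 (by rw [hc]; ring)
      rw [← this]; exact hx
    · exact AddSubgroup.mem_sup_right (mem_Bd' l (a * q.2) p hp c (by rw [hc]; ring) h0 x hx)
end bdlem

section res
variable {K : Type u} [Field K] {σ : Type} {m : ℕ}
variable {L L' : Type u} [Field L] [Algebra (MvPolynomial σ K) L] [IsFractionRing (MvPolynomial σ K) L]
  [Field L'] [Algebra (MvPolynomial (Fin m ⊕ σ) K) L'] [IsFractionRing (MvPolynomial (Fin m ⊕ σ) K) L']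

noncomputable def dv {τ : Type} (L : Type u) [Field L] [Algebra (MvPolynomial τ K) L] [IsFractionRing (MvPolynomial τ K) L] (s : τ) :
    Wr (MvPolynomial τ K) L := dW L (pderiv s)

/-- the list of operators and localizations -/
noncomputable def cl {τ : Type} (L : Type u) [Field L] [Algebra (MvPolynomial τ K) L] [IsFractionRing (MvPolynomial τ K) L] (o : List τ)
    (p : List (MvPolynomial τ K)) : List (Wr (MvPolynomial τ K) L × MvPolynomial τ K) :=
  op (MvPolynomial τ K) (o.map (dv L)) ++ pu (Wr (MvPolynomial τ K) L) p

lemma mem_cl {τ : Type} {L : Type u} [Field L] [Algebra (MvPolynomial τ K) L] [IsFractionRing (MvPolynomial τ K) L] {o : List τ}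
    {p : List (MvPolynomial τ K)} {q : Wr (MvPolynomial τ K) L × MvPolynomial τ K} :
    q ∈ cl L o p ↔ (∃ j ∈ o, (dv L j, 1) = q) ∨ ∃ f ∈ p, (1, f) = q := by
  simp only [cl, op, pu, List.map_map, List.mem_append, List.mem_map, Function.comp]

lemma cl_len {τ : Type} {L : Type u} [Field L] [Algebra (MvPolynomial τ K) L] [IsFractionRing (MvPolynomial τ K) L] {o : List τ}
    {p : List (MvPolynomial τ K)} : (cl L o p).length = o.length + p.length := by
  simp [cl, op, pu]

lemma pr_cl {τ : Type} {L : Type u} [Field L] [Algebra (MvPolynomial τ K) L] [IsFractionRing (MvPolynomial τ K) L] {o : List τ}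
    {p : List (MvPolynomial τ K)} : pr (cl L o p) = p.prod := by
  simp [pr, cl, op, pu, Function.comp_def]

/-- exactness for these lists -/
def EE (L : Type u) {K : Type u} [Field K] {τ : Type} [Field L] [Algebra (MvPolynomial τ K) L] [IsFractionRing (MvPolynomial τ K) L] (o : List τ)
    (p : List (MvPolynomial τ K)) (a : MvPolynomial τ K) (i : ℤ) : Prop := E L (cl L o p) a i

lemma EE_top {τ : Type} {L : Type u} [Field L] [Algebra (MvPolynomial τ K) L] [IsFractionRing (MvPolynomial τ K) L] {o : List τ}
    {p : List (MvPolynomial τ K)} {i : ℤ} (hi : i = ((o.length + p.length : ℕ) : ℤ)) :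
    EE L o p 1 i ↔ SS (MvPolynomial τ K) L p.prod ≤ Bd L (cl L o p) 1 := by
  rw [EE, hi, ← cl_len (L := L), top_iff, one_mul, pr_cl]

local notation "ι" => algebraMap (MvPolynomial σ K) L
local notation "κι" => algebraMap (MvPolynomial (Fin m ⊕ σ) K) L'

def Rel (m : ℕ) {L' : Type u} [Field L'] [Algebra (MvPolynomial (Fin m ⊕ σ) K) L']
    (P : MvPolynomial σ K) (x' : L') (x : L) : Prop := ∃ (N : ℕ) (s' : MvPolynomial (Fin m ⊕ σ) K),
  algebraMap (MvPolynomial (Fin m ⊕ σ) K) L' (rename Sum.inr P * Vp K σ m) ^ (N + 1) * x' = algebraMap (MvPolynomial (Fin m ⊕ σ) K) L' s' ∧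
  algebraMap (MvPolynomial σ K) L P ^ (N + 1) * x = algebraMap (MvPolynomial σ K) L (kap N s')

lemma rel_raise {P : MvPolynomial σ K} {x' : L'} {x : L} {N : ℕ} {s' : MvPolynomial (Fin m ⊕ σ) K}
    (h1 : κι (rename Sum.inr P * Vp K σ m) ^ (N + 1) * x' = κι s') (h2 : ι P ^ (N + 1) * x = ι (kap N s')) (M : ℕ) :
    κι (rename Sum.inr P * Vp K σ m) ^ (N + M + 1) * x' = κι ((rename Sum.inr P * Vp K σ m) ^ M * s') ∧
    ι P ^ (N + M + 1) * x = ι (kap (N + M) ((rename Sum.inr P * Vp K σ m) ^ M * s')) := by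
  constructor
  · rw [map_mul κι (_ ^ M), ← h1, map_pow]; ring
  · rw [mul_pow, mul_assoc, ← map_pow (rename Sum.inr), kap_ren, kap_V, map_mul, ← h2, map_pow]; ring

lemma rel_two {P : MvPolynomial σ K} {x' y' : L'} {x y : L} (h : Rel m P x' x) (h' : Rel m P y' y) :
    ∃ (N : ℕ) (s' r' : MvPolynomial (Fin m ⊕ σ) K),
      (κι (rename Sum.inr P * Vp K σ m) ^ (N + 1) * x' = κι s' ∧ ι P ^ (N + 1) * x = ι (kap N s')) ∧
      (κι (rename Sum.inr P * Vp K σ m) ^ (N + 1) * y' = κι r' ∧ ι P ^ (N + 1) * y = ι (kap N r')) := by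
  obtain ⟨N, s, h1, h2⟩ := h
  obtain ⟨M, r, h3, h4⟩ := h'
  have h5 := rel_raise h3 h4 N
  rw [add_comm M N] at h5
  exact ⟨N + M, _, _, rel_raise h1 h2 M, h5⟩

lemma rel_uniq {P : MvPolynomial σ K} (hP : P ≠ 0) {x' : L'} {x y : L} (h : Rel m P x' x) (h' : Rel m P x' y) : x = y := by
  obtain ⟨N, s, r, ⟨h1, h2⟩, h3, h4⟩ := rel_two h h'
  rw [h1] at h3
  have := IsFractionRing.injective (MvPolynomial (Fin m ⊕ σ) K) L' h3
  rw [← this, ← h2] at h4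
  have h0 : ι P ≠ 0 := by
    rw [Ne, FaithfulSMul.algebraMap_eq_zero_iff]; exact hP
  exact (mul_left_cancel₀ (pow_ne_zero _ h0) h4).symm

/-- the subgroup of elements with residue in `B` -/
def Tr (m : ℕ) {L' : Type u} [Field L'] [Algebra (MvPolynomial (Fin m ⊕ σ) K) L'] [IsFractionRing (MvPolynomial (Fin m ⊕ σ) K) L']
    (P : MvPolynomial σ K) (B : AddSubgroup L) : AddSubgroup L' where
  carrier := {x' | ∃ x ∈ B, Rel m P x' x}
  zero_mem' := ⟨0, zero_mem _, 0, 0, by simp, by simp [kap]⟩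
  add_mem' := by
    rintro x' y' ⟨x, hx, h⟩ ⟨y, hy, h'⟩
    obtain ⟨N, s, r, ⟨h1, h2⟩, h3, h4⟩ := rel_two h h'
    refine ⟨x + y, add_mem hx hy, N, s + r, ?_, ?_⟩
    · rw [map_add, ← h1, ← h3]; ring
    · rw [kap_add, map_add, ← h2, ← h4]; ring
  neg_mem' := by
    rintro x' ⟨x, hx, N, s, h1, h2⟩
    refine ⟨-x, neg_mem hx, N, -s, ?_, ?_⟩
    · rw [map_neg, ← h1]; ring
    · have : kap N (-s) = - kap N s := by simp [kap]
      rw [this, map_neg, ← h2]; ring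

lemma SS_succ {S L : Type u} [CommRing S] [Field L] [Algebra S L] {a : S} {x : L} (h : x ∈ SS S L a) :
    ∃ N : ℕ, ∃ s, algebraMap S L a ^ (N + 1) * x = algebraMap S L s := by
  obtain ⟨N, s, h⟩ := mem_SS.1 h
  exact ⟨N, a * s, by rw [map_mul, ← h]; ring⟩

/-- residue lemma -/
lemma residue (o : List σ) (o' : List (Fin m ⊕ σ)) (ho : ∀ j, Sum.inr j ∈ o' → j ∈ o) (p : List (MvPolynomial σ K)) (hp : ∀ f ∈ p, f ≠ 0)
    (h : EE L' o' ((p.map (rename Sum.inr) ++ (List.finRange m).map (fun i => (X (Sum.inl i) : MvPolynomial (Fin m ⊕ σ) K)))) 1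
      ((o'.length + (p.length + m) : ℕ) : ℤ)) :
    EE L o p 1 ((o.length + p.length : ℕ) : ℤ) := by
  rw [EE_top (by simp)] at h
  rw [EE_top rfl]
  set P := p.prod with hPd
  have hP0 : P ≠ 0 := by
    rw [hPd, Ne, List.prod_eq_zero_iff]; intro h0; exact hp 0 h0 rfl
  have hren : Function.Injective (rename Sum.inr : MvPolynomial σ K → MvPolynomial (Fin m ⊕ σ) K) := rename_injective _ Sum.inr_injective
  have hQ : (p.map (rename Sum.inr) ++ (List.finRange m).map (fun i => (X (Sum.inl i) : MvPolynomial (Fin m ⊕ σ) K))).prod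
      = rename Sum.inr P * Vp K σ m := by
    rw [List.prod_append, hPd, map_list_prod, Vp, ← List.ofFn_eq_map, List.prod_ofFn]
  rw [hQ] at h
  set B := Bd L (cl L o p) 1 with hB
  have hQ0 : rename Sum.inr P * Vp K σ m ≠ 0 := by
    refine mul_ne_zero (fun h0 => hP0 (hren (by rw [h0, map_zero]))) ?_
    rw [Vp, Finset.prod_ne_zero_iff]; intro i _; exact X_ne_zero _
  have hP1 : ι P ≠ 0 := by rw [Ne, FaithfulSMul.algebraMap_eq_zero_iff]; exact hP0
  have hQ1 : κι (rename Sum.inr P * Vp K σ m) ≠ 0 := by rw [Ne, FaithfulSMul.algebraMap_eq_zero_iff]; exact hQ0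
  refine fun x hx => ?_
  have key := h.trans (Bd_le (Tr (L' := L') m P B) _ _ ?_)
  swap
  · 
    intro q hq c hc x' hx'
    rw [one_mul, pr_cl, hQ] at hc
    rw [mem_cl] at hq
    simp only [List.mem_append, List.mem_map] at hq
    rcases hq with ⟨j, hj, rfl⟩ | ⟨_, ⟨f, hf, rfl⟩ | ⟨i, hi, rfl⟩, rfl⟩
    · simp only [mul_one] at hc
      subst hc
      obtain ⟨N, s, hs⟩ := SS_succ hx'
      have e1 := dL_frac (L := L') (pderiv j) _ s x' (N + 1) hs
      change dL L' (pderiv j) x' ∈ _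
      rcases j with i | j
      · refine ⟨0, zero_mem _, N + 1, _, e1, ?_⟩
        have : (rename Sum.inr P * Vp K σ m) * pderiv (Sum.inl i) s - ((N + 1 : ℕ) : MvPolynomial (Fin m ⊕ σ) K) * pderiv (Sum.inl i) (rename Sum.inr P * Vp K σ m) * s
          = rename Sum.inr P * (Vp K σ m * pderiv (Sum.inl i) s - ((N + 1 : ℕ) : MvPolynomial (Fin m ⊕ σ) K) * pderiv (Sum.inl i) (Vp K σ m) * s) := by
          have h0 : pderiv (Sum.inl i) (rename Sum.inr P : MvPolynomial (Fin m ⊕ σ) K) = 0 := by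
            apply pderiv_eq_zero_of_notMem_vars
            classical
            intro hv
            have := vars_rename _ _ hv
            simp at this
          rw [pderiv_mul, h0]; ring
        rw [this, kap_ren, kap_inl]; simp
      · have e2 : ι P ^ (N + 1) * (ι (kap N s) / ι P ^ (N + 1)) = ι (kap N s) := mul_div_cancel₀ _ (pow_ne_zero _ hP1)
        have e3 := dL_frac (L := L) (pderiv j) _ _ _ (N + 1) e2
        refine ⟨dL L (pderiv (R := K) j) (ι (kap N s) / ι P ^ (N + 1)), ?_, N + 1, _, e1, ?_⟩
        · refine mem_Bd' _ _ (dv (K := K) L j, 1) ?_ P ?_ one_ne_zero _ ?_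
          · rw [mem_cl]
            exact Or.inl ⟨j, ho j hj, rfl⟩
          · rw [one_mul, pr_cl, mul_one]
          · exact mem_SS.2 ⟨N + 1, _, e2⟩
        · rw [e3]
          congr 1
          have h0 : pderiv (Sum.inr j) (Vp K σ m) = 0 := by
            apply pderiv_eq_zero_of_notMem_vars
            classical
            intro hv
            have := vars_prod _ hv
            simp [vars_X] at this
          have h1 : pderiv (Sum.inr j) (rename Sum.inr P : MvPolynomial (Fin m ⊕ σ) K) = rename Sum.inr (pderiv j P) :=
            pderiv_rename (R := K) Sum.inr_injective j P
          rw [pderiv_mul, h0, h1, mul_zero, add_zero, kap_sub, mul_assoc (rename Sum.inr P), kap_ren]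
          have h2 : ((N + 1 : ℕ) : MvPolynomial (Fin m ⊕ σ) K) * (rename Sum.inr (pderiv j P) * Vp K σ m) * s =
            rename Sum.inr (((N + 1 : ℕ) : MvPolynomial σ K) * pderiv j P) * (Vp K σ m * s) := by
            rw [map_mul, map_natCast]; ring
          have h3 := kap_V (m := m) N 1 s
          have h4 := kap_V (m := m) N 1 (pderiv (Sum.inr j) s)
          rw [pow_one] at h3 h4
          rw [h2, kap_ren, h3, h4, kap_inr]
    · simp only at hc
      obtain ⟨g, hg⟩ : f ∣ P := List.dvd_prod hf
      have hf0 : rename Sum.inr f ≠ (0 : MvPolynomial (Fin m ⊕ σ) K) := fun h0 => hp f hf (hren (by rw [h0, map_zero]))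
      have hc' : c = rename Sum.inr g * Vp K σ m := by
        apply mul_right_cancel₀ hf0
        rw [hc, hg, map_mul]; ring
      have hg0 : ι g ≠ 0 := by
        rw [Ne, FaithfulSMul.algebraMap_eq_zero_iff]; rintro rfl; rw [mul_zero] at hg; exact hP0 hg
      obtain ⟨N, s, hs⟩ := SS_succ hx'
      have e2 : ι g ^ (N + 1) * (ι (kap N s) / ι g ^ (N + 1)) = ι (kap N s) := mul_div_cancel₀ _ (pow_ne_zero _ hg0)
      change (1 : Wr (MvPolynomial (Fin m ⊕ σ) K) L') • x' ∈ _
      rw [one_smul]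
      refine ⟨(1 : Wr (MvPolynomial σ K) L) • (ι (kap N s) / ι g ^ (N + 1)), ?_, N, rename Sum.inr (f ^ (N + 1)) * s, ?_, ?_⟩
      · refine mem_Bd' _ _ (1, f) ?_ g ?_ (hp f hf) _ ?_
        · rw [mem_cl]
          exact Or.inr ⟨f, hf, rfl⟩
        · rw [one_mul, pr_cl, ← hPd, hg, mul_comm]
        · exact mem_SS.2 ⟨N + 1, _, e2⟩
      · rw [← hc, map_mul κι (rename _ _), ← hs, map_pow, map_pow, map_mul]; ring
      · rw [one_smul, kap_ren, map_mul, hg, map_mul, map_pow, mul_pow, mul_assoc, e2]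
    · simp only at hc
      obtain ⟨N, s, hs⟩ := SS_succ hx'
      change (1 : Wr (MvPolynomial (Fin m ⊕ σ) K) L') • x' ∈ _
      rw [one_smul]
      refine ⟨0, zero_mem _, N, X (Sum.inl i) ^ (N + 1) * s, ?_, ?_⟩
      · rw [map_mul κι (_ ^ _), ← hs, ← hc, map_pow, map_mul]; ring
      · rw [kap_v]; simp
  obtain ⟨N, s, hs⟩ := SS_succ hx
  have e1 : κι (rename Sum.inr P * Vp K σ m) ^ (N + 1) * (κι (Vp K σ m ^ N * rename Sum.inr s) / κι (rename Sum.inr P * Vp K σ m) ^ (N + 1))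
    = κι (Vp K σ m ^ N * rename Sum.inr s) := mul_div_cancel₀ _ (pow_ne_zero _ hQ1)
  have h1 : Rel m P (κι (Vp K σ m ^ N * rename Sum.inr s) / κι (rename Sum.inr P * Vp K σ m) ^ (N + 1)) x := by
    refine ⟨N, _, e1, ?_⟩
    rw [hs]
    have := kap_V (m := m) 0 N (rename Sum.inr s)
    rw [zero_add] at this
    rw [this]
    have h2 := kap_ren (m := m) 0 s 1
    rw [mul_one] at h2
    rw [h2]
    have h3 : kap (K := K) (σ := σ) (m := m) 0 1 = 1 := by
      have : ce m 0 = 0 := by ext; simp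
      simp [kap, this]
    rw [h3, mul_one]
  obtain ⟨y, hy, h2⟩ := key (mem_SS.2 ⟨N + 1, _, e1⟩)
  rw [rel_uniq hP0 h1 h2]
  exact hy
end res
end CH
end

section
universe u v
set_option linter.unusedVariables false
set_option linter.unusedSectionVars false
namespace CH
open MvPolynomial
section dstep
variable {K : Type u} [Field K] {τ : Type}

lemma pd_comm (a b : τ) (s : MvPolynomial τ K) : pderiv a (pderiv b s) = pderiv b (pderiv a s) := by
  have : ⁅(pderiv a : Derivation K (MvPolynomial τ K) (MvPolynomial τ K)), (pderiv b : Derivation K (MvPolynomial τ K) (MvPolynomial τ K))⁆ = 0 := by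
    apply MvPolynomial.derivation_ext
    intro i
    classical
    rw [Derivation.commutator_apply, pderiv_X, pderiv_X]
    simp only [Pi.single_apply]
    split_ifs <;> simp
  have := DFunLike.congr_fun this s
  rw [Derivation.commutator_apply] at this
  exact sub_eq_zero.1 this

variable {m n : ℕ} (v : Fin m → τ) (x : Fin m → Fin n → τ)

/-- column derivations -/
noncomputable def Dj (K : Type u) [Field K] (j : Fin n) : Derivation K (MvPolynomial τ K) (MvPolynomial τ K) :=
  ∑ i, (X (v i) : MvPolynomial τ K) • pderiv (x i j)

lemma Dj_apply (j : Fin n) (s : MvPolynomial τ K) : Dj v x K j s = ∑ i, X (v i) * pderiv (x i j) s := by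
  rw [Dj]
  change Derivation.coeFnAddMonoidHom _ _ = _
  rw [map_sum, Finset.sum_apply]
  rfl

variable {v x} (hx : ∀ i j i' j', x i j = x i' j' → i = i' ∧ j = j') (hv : ∀ i i' j, v i ≠ x i' j)
include hx hv

lemma Dj_v (j : Fin n) (i : Fin m) : Dj v x K j (X (v i)) = 0 := by
  rw [Dj_apply]
  refine Finset.sum_eq_zero (fun i' _ => ?_)
  rw [pderiv_X_of_ne (hv _ _ _), mul_zero]

lemma Dj_x (j j' : Fin n) (i : Fin m) : Dj v x K j (X (x i j')) = if j = j' then X (v i) else 0 := by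
  rw [Dj_apply, Finset.sum_eq_single i]
  · split_ifs with h
    · rw [h, pderiv_X_self, mul_one]
    · rw [pderiv_X_of_ne (fun h' => h (hx _ _ _ _ h').2.symm), mul_zero]
  · intro i' _ h
    rw [pderiv_X_of_ne (fun h' => h (hx _ _ _ _ h').1.symm), mul_zero]
  · simp

lemma pd_v (j : Fin n) (i i' : Fin m) : pderiv (x i j) (X (v i') : MvPolynomial τ K) = 0 := pderiv_X_of_ne (hv _ _ _)

lemma Dj_comm (j j' : Fin n) (i : Fin m) (s : MvPolynomial τ K) :
    pderiv (x i j') (Dj v x K j s) = Dj v x K j (pderiv (x i j') s) := by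
  rw [Dj_apply, Dj_apply, map_sum]
  refine Finset.sum_congr rfl (fun i' _ => ?_)
  rw [pderiv_mul, pd_v hx hv, zero_mul, zero_add, pd_comm]

lemma Dj_two (j : Fin n) (a : τ) : Dj v x K j (Dj v x K j (X a)) = 0 := by
  by_cases h : ∃ i, a = x i j
  · obtain ⟨i, rfl⟩ := h
    rw [Dj_x hx hv, if_pos rfl, Dj_v hx hv]
  · have : Dj v x K j (X a) = 0 := by
      rw [Dj_apply]
      refine Finset.sum_eq_zero (fun i' _ => ?_)
      rw [pderiv_X_of_ne (fun h' => h ⟨_, h'⟩), mul_zero]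
    rw [this, map_zero]

omit hx hv in
lemma it_mul (D : Derivation K (MvPolynomial τ K) (MvPolynomial τ K)) (p y : MvPolynomial τ K) (h : D (D y) = 0) (N : ℕ) :
    D^[N+1] (p * y) = D^[N+1] p * y + (N + 1) * D^[N] p * D y := by
  induction N with
  | zero => simp [Derivation.leibniz, mul_comm, add_comm]
  | succ N ih =>
    rw [Function.iterate_succ_apply', ih, map_add, Derivation.leibniz, Derivation.leibniz, h]
    rw [Derivation.leibniz, Function.iterate_succ_apply' _ (N+1), Function.iterate_succ_apply' _ N]
    have : D ((N : MvPolynomial τ K) + 1) = 0 := by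
      rw [map_add, Derivation.map_natCast, Derivation.map_one_eq_zero, add_zero]
    rw [this]
    simp only [smul_eq_mul]
    push_cast
    ring

lemma Dj_nil (j : Fin n) (s : MvPolynomial τ K) : ∃ N : ℕ, (Dj v x K j)^[N] s = 0 := by
  induction s using MvPolynomial.induction_on with
  | C a => exact ⟨1, by simp [MvPolynomial.derivation_C]⟩
  | add p q hp hq =>
    obtain ⟨N, hN⟩ := hp
    obtain ⟨M, hM⟩ := hq
    refine ⟨N + M, ?_⟩
    rw [iterate_map_add, add_comm N M, Function.iterate_add_apply, hN, add_comm M N, Function.iterate_add_apply, hM,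
      iterate_map_zero, iterate_map_zero, add_zero]
  | mul_X p a ih =>
    obtain ⟨N, hN⟩ := ih
    refine ⟨N + 1, ?_⟩
    rw [it_mul _ _ _ (Dj_two hx hv j a), Function.iterate_succ_apply', hN, map_zero]
    simp

variable {L : Type u} [Field L] [Algebra (MvPolynomial τ K) L] [IsFractionRing (MvPolynomial τ K) L]

lemma Dj_nilL (j : Fin n) (a : MvPolynomial τ K) (ha : a ≠ 0 ∧ Dj v x K j a = 0) (y : L) (hy : y ∈ SS (MvPolynomial τ K) L a) :
    ∃ N : ℕ, dW L (Dj v x K j) ^ N • y = 0 := by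
  obtain ⟨M, s, hs⟩ := mem_SS.1 hy
  obtain ⟨N, hN⟩ := Dj_nil hx hv j s
  have key : ∀ N : ℕ, algebraMap (MvPolynomial τ K) L a ^ M * (dW L (Dj v x K j) ^ N • y) = algebraMap (MvPolynomial τ K) L ((Dj v x K j)^[N] s) := by
    intro N
    induction N with
    | zero => simpa using hs
    | succ N ih =>
      rw [pow_succ', mul_smul, Function.iterate_succ_apply', ← dL_map, ← ih, dL_mul, dL_pow, dL_map, ha.2, map_zero, mul_zero, mul_zero, add_zero,
        dW_smul]
  refine ⟨N, ?_⟩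
  have h2 := key N
  rw [hN, map_zero] at h2
  refine (mul_eq_zero.1 h2).resolve_left (pow_ne_zero _ ?_)
  rw [Ne, FaithfulSMul.algebraMap_eq_zero_iff]; exact ha.1

omit hx hv in
lemma dL_Dj (j : Fin n) (y : L) : dL L (Dj v x K j) y = ∑ i, algebraMap (MvPolynomial τ K) L (X (v i)) * dL L (pderiv (R := K) (x i j)) y := by
  have := dL_ext (S := MvPolynomial τ K) (dL L (Dj v x K j) - ∑ i, (AddMonoidHom.mulLeft (algebraMap (MvPolynomial τ K) L (X (v i)))).comp (dL L (pderiv (R := K) (x i j)))) (by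
    intro a b
    simp only [AddMonoidHom.sub_apply, AddMonoidHom.finset_sum_apply, AddMonoidHom.comp_apply, AddMonoidHom.coe_mulLeft, dL_mul, mul_add, Finset.sum_add_distrib, mul_sub, Finset.mul_sum]
    have : ∀ a b : L, ∑ i, algebraMap (MvPolynomial τ K) L (X (v i)) * (a * dL L (pderiv (R := K) (x i j)) b) = ∑ i, a * (algebraMap (MvPolynomial τ K) L (X (v i)) * dL L (pderiv (R := K) (x i j)) b) :=
      fun a b => Finset.sum_congr rfl (fun _ _ => by ring)
    rw [this, this]
    ring) (by
    intro s
    simp only [AddMonoidHom.sub_apply, AddMonoidHom.finset_sum_apply, AddMonoidHom.comp_apply, AddMonoidHom.coe_mulLeft, dL_map, Dj_apply, map_sum, map_mul, sub_self]) y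
  simp only [AddMonoidHom.sub_apply, AddMonoidHom.finset_sum_apply, AddMonoidHom.comp_apply, AddMonoidHom.coe_mulLeft] at this
  exact sub_eq_zero.1 this

omit hx hv in
lemma dv_comm (a b : τ) : Commute (dv (K := K) L a) (dv L b) := dW_comm _ _ (pd_comm a b)

omit hx hv in
lemma EE_perm {o o' : List τ} (h : o.Perm o') {g : List (MvPolynomial τ K)} {a : MvPolynomial τ K} {i : ℤ} : EE L o g a i ↔ EE L o' g a i :=
  E_perm (((h.map _).map _).append_right _)

omit hx hv in
lemma cl_commute (o : List τ) (g : List (MvPolynomial τ K)) (w : Wr (MvPolynomial τ K) L) (h : ∀ s ∈ o, Commute (dv L s) w) :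
    ∀ p ∈ cl L o g, Commute p.1 w := by
  intro p hp
  rcases mem_cl.1 hp with ⟨s, hs, rfl⟩ | ⟨f, hf, rfl⟩
  · exact h s hs
  · exact Commute.one_left _

omit hx hv in
lemma EE_ops (R o : List τ) (g : List (MvPolynomial τ K)) (a : MvPolynomial τ K) (B : ℕ) (h : ∀ i : ℤ, (B : ℤ) < i → EE L o g a i) :
    ∀ i : ℤ, ((B + R.length : ℕ) : ℤ) < i → EE L (R ++ o) g a i := by
  induction R with
  | nil => simpa using h
  | cons s R ih =>
    intro i hi
    rw [List.length_cons] at hi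
    exact E_op1 (cl_commute _ _ _ (fun b _ => dv_comm b s)) (ih i (by push_cast at hi ⊢; linarith)) (ih (i-1) (by push_cast at hi ⊢; linarith))

omit hx hv in
lemma EE_high (o : List τ) (g : List (MvPolynomial τ K)) (a : MvPolynomial τ K) (i : ℤ) (h : ((o.length + g.length : ℕ) : ℤ) < i) : EE L o g a i :=
  E_high _ (by rw [cl_len]; exact h)
end dstep

section dstep2
variable {K : Type u} [Field K] [CharZero K] {τ : Type}
variable {m n : ℕ} {v : Fin (m+1) → τ} {x : Fin (m+1) → Fin n → τ}
variable (hx : ∀ i j i' j', x i j = x i' j' → i = i' ∧ j = j') (hv : ∀ i i' j, v i ≠ x i' j)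
variable {L : Type u} [Field L] [Algebra (MvPolynomial τ K) L] [IsFractionRing (MvPolynomial τ K) L]

lemma finRange_perm (k : Fin (m+1)) : (List.finRange (m+1)).Perm (k :: (List.finRange m).map k.succAbove) := by
  rw [List.perm_ext_iff_of_nodup (List.nodup_finRange _)]
  · intro a
    simp only [List.mem_finRange, List.mem_cons, List.mem_map, true_and, true_iff]
    rcases Fin.eq_self_or_eq_succAbove k a with h | ⟨b, h⟩
    · exact Or.inl h
    · exact Or.inr ⟨b, h.symm⟩
  · rw [List.nodup_cons]
    refine ⟨?_, (List.nodup_finRange _).map Fin.succAbove_right_injective⟩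
    simp [Fin.succAbove_ne]

include hx hv in
lemma colbound (k : Fin (m+1)) (g : List (MvPolynomial τ K)) (hg : ∀ f ∈ g, f ≠ 0 ∧ ∀ j, Dj v x K j f = 0) (J : List (Fin n)) (hJ : J.Nodup) :
    ∀ i : ℤ, ((g.length + J.length * m : ℕ) : ℤ) < i →
      EE L (J.flatMap (fun j => (List.finRange (m+1)).map (fun i => x i j))) g (X (v k)) i := by
  induction J with
  | nil => intro i hi; exact EE_high _ _ _ _ (by simpa using hi)
  | cons j J ih =>
    rw [List.nodup_cons] at hJ
    intro i hi
    rw [List.flatMap_cons]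
    have h0 : ((List.finRange (m+1)).map (fun i => x i j) ++ J.flatMap (fun j => (List.finRange (m+1)).map (fun i => x i j))).Perm
      (x k j :: ((List.finRange m).map (fun i => x (k.succAbove i) j) ++ J.flatMap (fun j => (List.finRange (m+1)).map (fun i => x i j)))) := by
      rw [← List.cons_append]
      refine List.Perm.append_right _ (((finRange_perm k).map _).trans ?_)
      rw [List.map_cons, List.map_map]
      rfl
    rw [EE_perm h0]
    have h1 := EE_ops (L := L) ((List.finRange m).map (fun i => x (k.succAbove i) j)) _ g (X (v k)) _ (ih hJ.2) i (by
      rw [List.length_map, List.length_finRange]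
      rw [List.length_cons] at hi
      push_cast at hi ⊢
      linarith)
    have hmem : ∀ s ∈ (List.finRange m).map (fun i => x (k.succAbove i) j) ++ J.flatMap (fun j => (List.finRange (m+1)).map (fun i => x i j)),
        ∃ i' j', s = x i' j' ∧ (i' ≠ k ∨ j' ≠ j) := by
      intro s hs
      simp only [List.mem_append, List.mem_map, List.mem_flatMap, List.mem_finRange, true_and] at hs
      rcases hs with ⟨i', rfl⟩ | ⟨j', hj', i', rfl⟩
      · exact ⟨_, _, rfl, Or.inl (Fin.succAbove_ne _ _)⟩
      · exact ⟨_, _, rfl, Or.inr (fun h => hJ.1 (h ▸ hj'))⟩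
    have hDx : Dj v x K j (X (x k j)) = X (v k) := by rw [Dj_x hx hv, if_pos rfl]
    refine E_free (D := dW L (Dj v x K j)) (b := X (v k)) (x := X (x k j)) (N := 1)
      ((List.finRange m).map (fun i => (waW.j (X (v (k.succAbove i))), dv L (x (k.succAbove i) j))))
      (P := fun a => a ≠ 0 ∧ Dj v x K j a = 0) ?_ ?_ (fun a ha y hy => Dj_nilL hx hv j a ha y hy) (X_ne_zero _) (by simp)
      ⟨X_ne_zero _, Dj_v hx hv j k⟩ ?_ ?_ ?_ ?_ ?_ ?_ ?_ ?_ ?_ h1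
    · intro n
      refine ⟨C (((n : K) + 1)⁻¹), ?_⟩
      have : ((n : MvPolynomial τ K) + 1) = C ((n : K) + 1) := by simp
      rw [this, ← C_mul, mul_inv_cancel₀ (Nat.cast_add_one_ne_zero n), C_1]
    · rintro a b ⟨ha, ha'⟩ ⟨hb, hb'⟩
      exact ⟨mul_ne_zero ha hb, by rw [Derivation.leibniz, ha', hb', smul_zero, smul_zero, add_zero]⟩
    · intro p hp
      rcases mem_cl.1 hp with ⟨s, hs, rfl⟩ | ⟨f, hf, rfl⟩
      · exact ⟨one_ne_zero, Derivation.map_one_eq_zero _⟩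
      · exact ⟨(hg f hf).1, (hg f hf).2 j⟩
    · apply W_ext
      intro y
      rw [dW_smul, dL_Dj, Fin.sum_univ_succAbove _ k, add_smul, mul_smul, waW.hj, List.map_map, ← List.ofFn_eq_map, List.sum_ofFn, Finset.sum_smul]
      congr 1
    · intro p hp
      obtain ⟨i', _, rfl⟩ := List.mem_map.1 hp
      refine mem_cl.2 (Or.inl ⟨x (k.succAbove i') j, ?_, rfl⟩)
      exact List.mem_append_left _ (List.mem_map.2 ⟨i', List.mem_finRange _, rfl⟩)
    · intro q hq
      obtain ⟨i', _, rfl⟩ := List.mem_map.1 hq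
      apply cl_commute
      intro s hs
      obtain ⟨i1, j1, rfl, _⟩ := hmem s hs
      exact dW_j_comm _ _ (pd_v hx hv _ _ _)
    · rw [dW_j, hDx]
    · exact dW_j_comm _ _ (Dj_v hx hv j k)
    · apply cl_commute
      intro s hs
      obtain ⟨i1, j1, rfl, h⟩ := hmem s hs
      refine dW_j_comm _ _ (pderiv_X_of_ne ?_)
      intro h'
      have := hx _ _ _ _ h'
      rcases h with h | h
      · exact h this.1.symm
      · exact h this.2.symm
    · apply cl_commute
      intro s hs
      obtain ⟨i1, j1, rfl, _⟩ := hmem s hs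
      exact dW_j_comm _ _ (pd_v hx hv _ _ _)
    · apply cl_commute
      intro s hs
      obtain ⟨i1, j1, rfl, _⟩ := hmem s hs
      exact dW_comm _ _ (Dj_comm hx hv _ _ _)
end dstep2
end CH
end

section
universe u v
set_option linter.unusedVariables false
set_option linter.unusedSectionVars false
namespace CH
open MvPolynomial MA
lemma rad_map {R S : Type*} [CommRing R] [CommRing S] (φ : R →+* S) {I J : Ideal R} (h : I.radical = J.radical) :
    (I.map φ).radical = (J.map φ).radical := by
  have key : ∀ I J : Ideal R, I.radical = J.radical → (I.map φ).radical ≤ (J.map φ).radical := by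
    intro I J h
    apply Ideal.radical_le_radical_iff.2
    exact (Ideal.map_mono (Ideal.le_radical.trans h.le)).trans (Ideal.map_radical_le φ)
  exact le_antisymm (key _ _ h) (key _ _ h.symm)

lemma span_map_list {R S : Type*} [CommRing R] [CommRing S] (φ : R →+* S) (l : List R) :
    (Ideal.span {f | f ∈ l}).map φ = Ideal.span {f | f ∈ l.map φ} := by
  rw [Ideal.map_span]
  congr 1
  ext f
  simp

section stepb
variable {K : Type u} [Field K] [CharZero K] {τ : Type}
variable {m n : ℕ} {v : Fin (m+1) → τ} {x : Fin (m+1) → Fin n → τ}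
variable {L : Type u} [Field L] [Algebra (MvPolynomial τ K) L] [IsFractionRing (MvPolynomial τ K) L]

/-- constants of the column derivations -/
noncomputable def cst (v : Fin (m+1) → τ) (x : Fin (m+1) → Fin n → τ) : Subring (MvPolynomial τ K) where
  carrier := {s | ∀ j, Dj v x K j s = 0}
  zero_mem' := fun j => map_zero _
  one_mem' := fun j => Derivation.map_one_eq_zero _
  add_mem' := fun {a b} ha hb j => by rw [map_add, ha, hb, add_zero]
  neg_mem' := fun {a} ha j => by rw [map_neg, ha, neg_zero]
  mul_mem' := fun {a b} ha hb j => by rw [Derivation.leibniz, ha, hb, smul_zero, smul_zero, add_zero]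

/-- list of the matrix variables -/
def ol {σ : Type} {m n : ℕ} (x : Fin m → Fin n → σ) : List σ :=
  (List.finRange n).flatMap (fun j => (List.finRange m).map (fun i => x i j))

lemma ol_len {σ : Type} {m n : ℕ} (x : Fin m → Fin n → σ) : (ol x).length = n * m := by
  simp [ol, List.length_flatMap]

lemma stepbound (hx : ∀ i j i' j', x i j = x i' j' → i = i' ∧ j = j') (hv : ∀ i i' j, v i ≠ x i' j)
    (Z : Matrix (Fin (m+1)) (Fin (n+1)) (MvPolynomial τ K)) (hZ1 : ∀ i, Z i (Fin.last n) = X (v i))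
    (hZ2 : ∀ i j, Z i (Fin.castSucc j) = X (x i j)) (t : ℕ) (hne : minorsIdeal (t+1) Z ≠ ⊥)
    (q : List (MvPolynomial τ K)) (hq0 : ∀ f ∈ q, f ≠ 0)
    (hq : (Ideal.span {f | f ∈ q}).radical = (minorsIdeal (t+1) Z).radical)
    (k : Fin (m+1)) (V : List (Fin (m+1))) :
    ∀ i : ℤ, (((m * n + 1 - t ^ 2) + V.length + n * m + (m + 1) : ℕ) : ℤ) < i →
      EE L ((List.finRange (m+1)).map v ++ ol x) (V.map (fun i => X (v i)) ++ q) (X (v k)) i := by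
  let M : Matrix (Fin m) (Fin n) (cst (K := K) v x) := fun i j => ⟨schur Z k (Fin.last n) i j, by
    intro j'
    simp only [schur, Fin.succAbove_last, hZ1, hZ2]
    rw [map_sub, Derivation.leibniz, Derivation.leibniz, Dj_v hx hv, Dj_v hx hv, Dj_x hx hv, Dj_x hx hv]
    split_ifs <;> simp [mul_comm]⟩
  let φ : cst (K := K) v x →+* MvPolynomial τ K := Subring.subtype _
  have hM : M.map φ = schur Z k (Fin.last n) := by ext; rfl
  have hmm : (minorsIdeal t M).map φ = minorsIdeal t (schur Z k (Fin.last n)) := by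
    rw [← minors_map, hM]
  have hMne : minorsIdeal t M ≠ ⊥ := by
    intro hb
    rw [hb, Ideal.map_bot] at hmm
    obtain ⟨f, hf, hf0⟩ := Submodule.exists_mem_ne_zero_of_ne_bot hne
    have := schur_rad1 Z k (Fin.last n) t f (Ideal.le_radical hf)
    rw [← hmm, Ideal.radical_bot_of_isReduced, Ideal.mem_bot, hZ1] at this
    exact mul_ne_zero (X_ne_zero _) hf0 this
  obtain ⟨p, hpl, hp0, hp⟩ := gen_list t M hMne
  have hp' : (Ideal.span {f | f ∈ p.map φ}).radical = (minorsIdeal t (schur Z k (Fin.last n))).radical := by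
    rw [← span_map_list, ← hmm]; exact rad_map φ hp
  have hfl : ∀ f ∈ p.map φ ++ V.map (fun i => (X (v i) : MvPolynomial τ K)), f ≠ 0 ∧ ∀ j, Dj v x K j f = 0 := by
    intro f hf
    rcases List.mem_append.1 hf with hf | hf
    · obtain ⟨g, hg, rfl⟩ := List.mem_map.1 hf
      exact ⟨fun h => hp0 g hg (Subtype.ext h), g.2⟩
    · obtain ⟨i, hi, rfl⟩ := List.mem_map.1 hf
      exact ⟨X_ne_zero _, fun j => Dj_v hx hv j i⟩
  have h1 := colbound (L := L) hx hv k _ hfl (List.finRange n) (List.nodup_finRange n)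
  have h2 := EE_ops ((List.finRange (m+1)).map v) _ _ _ _ h1
  intro i hi
  have h3 := h2 i (lt_of_le_of_lt ?_ hi)
  · refine (rad_change (((List.finRange (m+1)).map v ++ ol x).map (dv L)) ?_ (p.map φ ++ V.map (fun i => (X (v i) : MvPolynomial τ K))) (V.map (fun i => X (v i)) ++ q) (X (v k)) (X_ne_zero _) ?_ ?_ i).2 h3
    · rw [List.pairwise_map]
      exact List.pairwise_of_forall (fun a b => dv_comm a b)
    · intro f hf
      refine ⟨(hfl f hf).1, ?_⟩
      rcases List.mem_append.1 hf with hf | hf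
      · have h4 : f ∈ (minorsIdeal t (schur Z k (Fin.last n))).radical := by
          rw [← hp']; exact Ideal.le_radical (Ideal.subset_span hf)
        have := schur_rad2 Z k (Fin.last n) t f h4
        rw [hZ1, ← hq] at this
        refine Ideal.radical_mono (Ideal.span_mono ?_) this
        intro g hg
        exact List.mem_append_right _ hg
      · exact Ideal.le_radical (Ideal.mul_mem_left _ _ (Ideal.subset_span (List.mem_append_left _ hf)))
    · intro f hf
      rcases List.mem_append.1 hf with hf | hf
      · refine ⟨(hfl f (List.mem_append_right _ hf)).1, ?_⟩
        exact Ideal.le_radical (Ideal.mul_mem_left _ _ (Ideal.subset_span (List.mem_append_right _ hf)))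
      · refine ⟨hq0 f hf, ?_⟩
        have h4 : f ∈ (minorsIdeal (t+1) Z).radical := by
          rw [← hq]; exact Ideal.le_radical (Ideal.subset_span hf)
        have := schur_rad1 Z k (Fin.last n) t f h4
        rw [hZ1, ← hp'] at this
        refine Ideal.radical_mono (Ideal.span_mono ?_) this
        intro g hg
        exact List.mem_append_left _ hg
  · simp only [List.length_append, List.length_map, List.length_finRange, hpl]
    exact_mod_cast le_of_eq (by ring)
end stepb

section main
variable {K : Type u} [Field K]
/-- generic matrix -/
noncomputable def gm (K : Type u) [Field K] {σ : Type} {m n : ℕ} (x : Fin m → Fin n → σ) : Matrix (Fin m) (Fin n) (MvPolynomial σ K) :=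
  fun i j => X (x i j)

lemma gm_ne_bot {σ : Type} {m n t : ℕ} (x : Fin m → Fin n → σ) (hx : ∀ i j i' j', x i j = x i' j' → i = i' ∧ j = j')
    (htm : t ≤ m) (htn : t ≤ n) : minorsIdeal t (gm K x) ≠ ⊥ := by
  classical
  intro hb
  have hmem : ((gm K x).submatrix (Fin.castLE htm) (Fin.castLE htn)).det ∈ minorsIdeal t (gm K x) :=
    Ideal.subset_span ⟨_, _, Fin.castLE_injective _, Fin.castLE_injective _, rfl⟩
  rw [hb, Ideal.mem_bot] at hmem
  let φ : MvPolynomial σ K →+* K := MvPolynomial.eval (fun s => if ∃ i j, x i j = s ∧ (i : ℕ) = j then 1 else 0)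
  have h1 := congrArg φ hmem
  rw [map_zero, RingHom.map_det] at h1
  have : φ.mapMatrix ((gm K x).submatrix (Fin.castLE htm) (Fin.castLE htn)) = 1 := by
    ext i j
    simp only [RingHom.mapMatrix_apply, Matrix.map_apply, Matrix.submatrix_apply, gm, φ, MvPolynomial.eval_X, Matrix.one_apply]
    congr 1
    apply propext
    constructor
    · rintro ⟨a, b, h, h'⟩
      obtain ⟨rfl, rfl⟩ := hx _ _ _ _ h
      exact Fin.ext h'
    · rintro rfl
      exact ⟨_, _, rfl, rfl⟩
  rw [this, Matrix.det_one] at h1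
  exact one_ne_zero h1

/-- nonvanishing -/
def NZ (K : Type u) [Field K] (m n t : ℕ) : Prop :=
  ∃ (σ : Type) (x : Fin m → Fin n → σ) (p : List (MvPolynomial σ K)),
    (∀ i j i' j', x i j = x i' j' → i = i' ∧ j = j') ∧ (∀ f ∈ p, f ≠ 0) ∧
    (Ideal.span {f | f ∈ p}).radical = (minorsIdeal t (gm K x)).radical ∧ p.length = m * n + 1 - t ^ 2 ∧
    ¬ EE (FractionRing (MvPolynomial σ K)) (ol x) p 1 (((ol x).length + p.length : ℕ) : ℤ)

lemma pw_dv {τ : Type} {L : Type u} [Field L] [Algebra (MvPolynomial τ K) L] [IsFractionRing (MvPolynomial τ K) L] (o : List τ) :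
    (o.map (dv (K := K) L)).Pairwise Commute := by
  rw [List.pairwise_map]
  exact List.pairwise_of_forall (fun a b => dv_comm a b)

lemma EE_consf {τ : Type} {L : Type u} [Field L] [Algebra (MvPolynomial τ K) L] [IsFractionRing (MvPolynomial τ K) L] (o : List τ)
    (g : List (MvPolynomial τ K)) (f a : MvPolynomial τ K) (i : ℤ) (h1 : EE L o g a i) (h2 : EE L o g (a * f) (i - 1)) :
    EE L o (f :: g) a i := by
  have h3 : E L ((1, f) :: cl L o g) a i := L1 (fun x => by rw [one_smul, one_smul]) h1 h2
  exact (E_perm List.perm_middle.symm).1 h3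

lemma NZ_col [CharZero K] {m n t : ℕ} (htm : t ≤ m) (htn : t + 1 ≤ n) (h : NZ K (m+1) n (t+1)) : NZ K (m+1) (n+1) (t+1) := by
  obtain ⟨σ, x, p, hx, hp0, hp, hpl, hN⟩ := h
  let x' : Fin (m+1) → Fin (n+1) → Fin (m+1) ⊕ σ := fun i => Fin.lastCases (Sum.inl i) (fun j => Sum.inr (x i j))
  have x1 : ∀ i, x' i (Fin.last n) = Sum.inl i := fun i => Fin.lastCases_last
  have x2 : ∀ i j, x' i (Fin.castSucc j) = Sum.inr (x i j) := fun i j => Fin.lastCases_castSucc _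
  let L := FractionRing (MvPolynomial (Fin (m+1) ⊕ σ) K)
  let y : Fin (m+1) → Fin n → Fin (m+1) ⊕ σ := fun i j => Sum.inr (x i j)
  have hy : ∀ i j i' j', y i j = y i' j' → i = i' ∧ j = j' := fun i j i' j' h => hx _ _ _ _ (Sum.inr_injective h)
  have hx' : ∀ i j i' j', x' i j = x' i' j' → i = i' ∧ j = j' := by
    intro i j i' j'
    refine Fin.lastCases ?_ (fun j => ?_) j <;> refine Fin.lastCases ?_ (fun j' => ?_) j'
    · rw [x1, x1]; intro h; exact ⟨Sum.inl_injective h, rfl⟩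
    · rw [x1, x2]; intro h; cases h
    · rw [x1, x2]; intro h; cases h
    · rw [x2, x2]; intro h
      obtain ⟨h1, h2⟩ := hx _ _ _ _ (Sum.inr_injective h)
      exact ⟨h1, by rw [h2]⟩
  have hne := gm_ne_bot (K := K) x' hx' (t := t+1) (by omega) (by omega)
  obtain ⟨q, hql, hq0, hq⟩ := gen_list (t+1) (gm K x') hne
  have hol : (ol x').Perm ((List.finRange (m+1)).map Sum.inl ++ ol y) := by
    have : ol x' = ol y ++ (List.finRange (m+1)).map Sum.inl := by
      simp only [ol, List.finRange_succ_last, List.flatMap_append, List.flatMap_map, List.flatMap_cons, List.flatMap_nil, List.append_nil, x1, x2, y]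
    rw [this]
    exact List.perm_append_comm
  refine ⟨_, x', q, hx', hq0, hq, hql, fun hE => hN ?_⟩
  rw [EE_perm hol] at hE
  have hsq : (t+1)^2 = t^2 + 2*t + 1 := by ring
  have hmn : (t+1)^2 ≤ (m+1) * n := by rw [pow_two]; exact Nat.mul_le_mul (by omega) htn
  have hmn' : t^2 ≤ m * n := by rw [pow_two]; exact Nat.mul_le_mul htm (by omega)
  have r1 : (m+1) * n = m * n + n := by ring
  have r2 : (m+1) * (n+1) = m * n + m + n + 1 := by ring
  have r3 : (n+1) * (m+1) = m * n + m + n + 1 := by ring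
  have r4 : n * (m+1) = m * n + n := by ring
  have r5 : n * m = m * n := by ring
  have hind : ∀ V : List (Fin (m+1)), V.length ≤ m + 1 →
      EE L ((List.finRange (m+1)).map Sum.inl ++ ol y) (V.map (fun i => X (Sum.inl i)) ++ q) 1 (((ol x').length + q.length : ℕ) : ℤ) := by
    intro V
    induction V with
    | nil => intro _; exact hE
    | cons k V ih =>
      intro hV
      rw [List.length_cons] at hV
      have h1 := ih (by omega)
      have h2 := stepbound (L := L) (v := Sum.inl) hy (fun i i' j h => by cases h) (gm K x') (fun i => congrArg X (x1 i)) (fun i j => congrArg X (x2 i j)) t hne q hq0 hq k V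
        ((((ol x').length + q.length : ℕ) : ℤ) - 1) (by rw [ol_len, hql]; omega)
      exact EE_consf _ _ _ _ _ h1 (by rw [one_mul]; exact h2)
  have hV := hind (List.finRange (m+1)) (by simp)
  let ρ : MvPolynomial σ K →+* MvPolynomial (Fin (m+1) ⊕ σ) K := (rename Sum.inr : MvPolynomial σ K →ₐ[K] MvPolynomial (Fin (m+1) ⊕ σ) K).toRingHom
  have hρ : (Ideal.span {f | f ∈ p.map ρ}).radical = (minorsIdeal (t+1) ((gm K x).map ρ)).radical := by
    rw [minors_map, ← span_map_list]; exact rad_map ρ hp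
  have hgm : ∀ i j, (gm K x).map ρ i j = X (Sum.inr (x i j)) := fun i j => rename_X _ _
  apply residue (L' := L) (ol x) ((List.finRange (m+1)).map Sum.inl ++ ol y) _ p hp0
  · have hh : (((List.finRange (m+1)).map Sum.inl ++ ol y).length + (p.length + (m + 1)) : ℕ) = (ol x').length + q.length := by
      rw [← hol.length_eq, ol_len, hpl, hql]; omega
    rw [hh]
    refine (rad_change _ (pw_dv _) _ _ 1 one_ne_zero ?_ ?_ _).1 hV
    · intro f hf
      rw [one_mul]
      rcases List.mem_append.1 hf with hf | hf
      · refine ⟨?_, ?_⟩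
        · obtain ⟨g, hg, rfl⟩ := List.mem_map.1 hf
          intro h
          exact hp0 g hg (rename_injective _ Sum.inr_injective (h.trans (map_zero _).symm))
        · have h1 : f ∈ (minorsIdeal (t+1) ((gm K x).map ρ)).radical := by
            rw [← hρ]; exact Ideal.le_radical (Ideal.subset_span hf)
          have h2 : minorsIdeal (t+1) ((gm K x).map ρ) ≤ minorsIdeal (t+1) (gm K x') := by
            apply Ideal.span_le.2
            rintro _ ⟨r, c, hr, hc, rfl⟩
            refine Ideal.subset_span ⟨r, fun i => (c i).castSucc, hr, (Fin.castSucc_injective _).comp hc, ?_⟩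
            congr 1
            ext1 i j
            rw [Matrix.submatrix_apply, Matrix.submatrix_apply, hgm, gm, x2]
          have h3 := Ideal.radical_mono h2 h1
          rw [← hq] at h3
          exact Ideal.radical_mono (Ideal.span_mono (fun g hg => List.mem_append_right _ hg)) h3
      · refine ⟨?_, Ideal.le_radical (Ideal.subset_span (List.mem_append_left _ hf))⟩
        obtain ⟨i, hi, rfl⟩ := List.mem_map.1 hf
        exact X_ne_zero _
    · intro f hf
      rw [one_mul]
      rcases List.mem_append.1 hf with hf | hf
      · refine ⟨?_, Ideal.le_radical (Ideal.subset_span (List.mem_append_right _ hf))⟩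
        obtain ⟨i, hi, rfl⟩ := List.mem_map.1 hf
        exact X_ne_zero _
      · refine ⟨hq0 f hf, ?_⟩
        have h1 : f ∈ (minorsIdeal (t+1) (gm K x')).radical := by
          rw [← hq]; exact Ideal.le_radical (Ideal.subset_span hf)
        refine (Ideal.radical_le_radical_iff.2 ?_) h1
        apply Ideal.span_le.2
        rintro _ ⟨r, c, hr, hc, rfl⟩
        by_cases hcl : ∃ j, c j = Fin.last n
        · obtain ⟨j, hj⟩ := hcl
          apply mem_rad
          intro F _ φ hφ
          rw [RingHom.map_det]
          apply Matrix.det_eq_zero_of_column_eq_zero j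
          intro i
          rw [RingHom.mapMatrix_apply, Matrix.map_apply, Matrix.submatrix_apply, hj, gm, x1]
          exact hφ _ (Ideal.subset_span (List.mem_append_right _ (List.mem_map.2 ⟨r i, List.mem_finRange _, rfl⟩)))
        · have hc' : ∀ j, ∃ j', c j = Fin.castSucc j' := by
            intro j
            rcases Fin.eq_castSucc_or_eq_last (c j) with ⟨j', h⟩ | h
            · exact ⟨j', h⟩
            · exact absurd ⟨j, h⟩ hcl
          choose c' hc' using hc'
          have h2 : ((gm K x').submatrix r c).det ∈ minorsIdeal (t+1) ((gm K x).map ρ) := by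
            refine Ideal.subset_span ⟨r, c', hr, fun a b h => hc (by rw [hc', hc', h]), ?_⟩
            congr 1
            ext1 i j
            rw [Matrix.submatrix_apply, Matrix.submatrix_apply, hgm, gm, hc', x2]
          have h3 := Ideal.le_radical h2
          rw [← hρ] at h3
          exact Ideal.radical_mono (Ideal.span_mono (fun g hg => List.mem_append_left _ hg)) h3
  · intro j hj
    rcases List.mem_append.1 hj with hj | hj
    · simp at hj
    · simp only [ol, List.mem_flatMap, List.mem_map, y] at hj ⊢
      obtain ⟨a, ha, b, hb, h⟩ := hj
      exact ⟨a, ha, b, hb, Sum.inr_injective h⟩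
end main
end CH
end

section
universe u v
set_option linter.unusedVariables false
set_option linter.unusedSectionVars false
namespace CH
open MvPolynomial MA
section fin
variable {K : Type u} [Field K]

lemma ol_nodup {σ : Type} {m n : ℕ} (x : Fin m → Fin n → σ) (hx : ∀ i j i' j', x i j = x i' j' → i = i' ∧ j = j') : (ol x).Nodup := by
  rw [ol, List.nodup_flatMap]
  refine ⟨fun j _ => (List.nodup_finRange m).map (fun a b h => (hx _ _ _ _ h).1), ?_⟩
  refine (List.nodup_finRange n).imp ?_
  intro a b hab
  simp only [Function.onFun, List.disjoint_left, List.mem_map]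
  rintro _ ⟨i, _, rfl⟩ ⟨i', _, h⟩
  exact hab (hx _ _ _ _ h).2.symm

lemma minors_le_T {R : Type*} [CommRing R] {m n : ℕ} (t : ℕ) (X : Matrix (Fin m) (Fin n) R) : minorsIdeal t X ≤ minorsIdeal t X.transpose := by
  apply Ideal.span_le.2
  rintro _ ⟨r, c, hr, hc, rfl⟩
  exact Ideal.subset_span ⟨c, r, hc, hr, by rw [← Matrix.transpose_submatrix, Matrix.det_transpose]⟩

lemma minors_T {R : Type*} [CommRing R] {m n : ℕ} (t : ℕ) (X : Matrix (Fin m) (Fin n) R) : minorsIdeal t X.transpose = minorsIdeal t X :=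
  le_antisymm (minors_le_T t X.transpose) (minors_le_T t X)

lemma NZ_T {m n t : ℕ} (h : NZ K m n t) : NZ K n m t := by
  obtain ⟨σ, x, p, hx, hp0, hp, hpl, hN⟩ := h
  have hx' : ∀ i j i' j', (fun (a : Fin n) (b : Fin m) => x b a) i j = (fun (a : Fin n) (b : Fin m) => x b a) i' j' → i = i' ∧ j = j' :=
    fun i j i' j' h => (hx _ _ _ _ h).symm
  have hperm : (ol (fun (a : Fin n) (b : Fin m) => x b a)).Perm (ol x) := by
    rw [List.perm_ext_iff_of_nodup (ol_nodup _ hx') (ol_nodup _ hx)]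
    intro s
    simp only [ol, List.mem_flatMap, List.mem_map, List.mem_finRange, true_and]
    exact exists_comm
  refine ⟨σ, fun a b => x b a, p, hx', hp0, ?_, by rw [hpl, mul_comm], ?_⟩
  · rw [hp, ← minors_T]; rfl
  · rw [EE_perm hperm, hperm.length_eq]; exact hN

lemma NZ_all [CharZero K] {m n t : ℕ} (htm : t + 1 ≤ m) (htn : t + 1 ≤ n) (h : NZ K (t+1) (t+1) (t+1)) : NZ K m n (t+1) := by
  have key : ∀ a, t ≤ a → NZ K (a+1) (t+1) (t+1) → ∀ n, t + 1 ≤ n → NZ K (a+1) n (t+1) := by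
    intro a ha h n hn
    induction n, hn using Nat.le_induction with
    | base => exact h
    | succ n hn ih => exact NZ_col ha hn ih
  have h1 := key t le_rfl h m htm
  obtain ⟨a, rfl⟩ : ∃ a, m = a + 1 := ⟨m - 1, by omega⟩
  exact key a (by omega) (NZ_T h1) n htn

lemma PJ0 {m n t : ℕ} (htm : t ≤ m) (htn : t ≤ n) (h : NZ K m n t) : PJ K m n t 0 := by
  obtain ⟨σ, x, p, hx, hp0, hp, hpl, hN⟩ := h
  intro σ' e _ q hq0 hq hql hEl
  apply hN
  let L := FractionRing (MvPolynomial σ K)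
  let g : σ' → σ := fun s => x (e.symm (Sum.inr s)).1 (e.symm (Sum.inr s)).2
  have hg : Function.Injective g := by
    intro a b h
    obtain ⟨h1, h2⟩ := hx _ _ _ _ h
    exact Sum.inr_injective (e.symm.injective (Prod.ext h1 h2))
  let ψ : MvPolynomial σ' K →+* MvPolynomial σ K := (rename g : MvPolynomial σ' K →ₐ[K] MvPolynomial σ K).toRingHom
  have hψ : Function.Injective ψ := rename_injective g hg
  have hM : (SX K e).map ψ = gm K x := by
    ext1 i j
    rw [Matrix.map_apply, SX, gm]
    rcases hp : e (i, j) with h | s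
    · exact h.elim0
    · rw [Sum.elim_inr]
      have : x i j = g s := by simp only [g, ← hp, Equiv.symm_apply_apply]
      rw [this]
      exact rename_X _ _
  have hr : (Ideal.span {f | f ∈ q.map ψ}).radical = (Ideal.span {f | f ∈ p}).radical := by
    rw [hp, ← hM, minors_map, ← span_map_list]; exact rad_map ψ hq
  have hq0' : ∀ f ∈ q.map ψ, f ≠ 0 := by
    intro f hf
    obtain ⟨f, hf1, rfl⟩ := List.mem_map.1 hf
    exact fun h => hq0 f hf1 (hψ (h.trans (map_zero _).symm))
  have h1 := E_of_El (L := L) (W := Wr (MvPolynomial σ K) L) (q.map ψ) hq0' (El_map ψ q hEl) 1 one_ne_zero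
  have h2 : E L (op (MvPolynomial σ K) ([] : List (Wr (MvPolynomial σ K) L)) ++ pu _ p) 1 (q.map ψ).length := by
    refine (rad_change [] List.Pairwise.nil (q.map ψ) p 1 one_ne_zero ?_ ?_ _).2 h1
    · intro f hf
      refine ⟨hq0' f hf, ?_⟩
      rw [one_mul, ← hr]; exact Ideal.le_radical (Ideal.subset_span hf)
    · intro f hf
      refine ⟨hp0 f hf, ?_⟩
      rw [one_mul, hr]; exact Ideal.le_radical (Ideal.subset_span hf)
  have hmn : t ^ 2 ≤ m * n := by rw [pow_two]; exact Nat.mul_le_mul htm htn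
  have hlen : (q.map ψ).length = p.length := by rw [List.length_map, hql, hpl, add_zero]
  have h3 := EE_ops (L := L) (ol x) [] p 1 (p.length - 1) (by
    intro i hi
    rcases lt_or_ge (p.length : ℤ) i with h | h
    · exact EE_high _ _ _ _ (by simpa using h)
    · have : i = ((q.map ψ).length : ℤ) := by rw [hlen]; omega
      rw [this]
      exact h2)
  have h4 := h3 (((ol x).length + p.length : ℕ) : ℤ) (by omega)
  rw [List.append_nil] at h4
  exact h4
end fin
end CH
end

section
universe u v
set_option linter.unusedVariables false
set_option linter.unusedSectionVars false
namespace CH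
open MvPolynomial MA
section detder
variable {R : Type*} [CommRing R] (D : R →+ R) (hD : ∀ x y, D (x * y) = x * D y + y * D x)
include hD

lemma D_one : D 1 = 0 := by
  have := hD 1 1
  simp only [one_mul] at this
  simpa using this

lemma D_prod {n : ℕ} (f : Fin n → R) : D (∏ i, f i) = ∑ a, ∏ i, Function.update f a (D (f a)) i := by
  induction n with
  | zero => simp [D_one D hD]
  | succ n ih =>
    rw [Fin.prod_univ_succ, hD, Fin.sum_univ_succ, ih, add_comm]
    congr 1
    · rw [Fin.prod_univ_succ, mul_comm]
      simp
    · rw [Finset.mul_sum]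
      refine Finset.sum_congr rfl (fun a _ => ?_)
      rw [Fin.prod_univ_succ]
      congr 1
      refine Finset.prod_congr rfl (fun i _ => ?_)
      by_cases h : i = a
      · subst h; simp
      · rw [Function.update_of_ne h, Function.update_of_ne (fun h' => h (Fin.succ_injective _ h'))]

lemma D_det {n : ℕ} (A : Matrix (Fin n) (Fin n) R) : D A.det = ∑ a, (A.updateRow a (fun b => D (A a b))).det := by
  rw [← Matrix.det_transpose, Matrix.det_apply, map_sum]
  have : ∀ a, (A.updateRow a (fun b => D (A a b))).det = ∑ σ : Equiv.Perm (Fin n), Equiv.Perm.sign σ • ∏ i, Function.update (fun i => A i (σ i)) a (D (A a (σ a))) i := by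
    intro a
    rw [← Matrix.det_transpose, Matrix.det_apply]
    refine Finset.sum_congr rfl (fun σ _ => ?_)
    congr 1
    refine Finset.prod_congr rfl (fun i _ => ?_)
    rw [Matrix.transpose_apply]
    by_cases h : i = a
    · subst h; simp
    · rw [Matrix.updateRow_ne h, Function.update_of_ne h]
  simp only [this]
  rw [Finset.sum_comm]
  refine Finset.sum_congr rfl (fun σ _ => ?_)
  rw [← Finset.smul_sum]
  rw [Units.smul_def, Units.smul_def, map_zsmul]
  congr 1
  exact D_prod D hD (fun i => A i (σ i))

lemma D_det_unit {n : ℕ} (A : Matrix (Fin n) (Fin n) R) (p q : Fin n) (h : ∀ a b, D (A a b) = if a = p ∧ b = q then 1 else 0) :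
    D A.det = A.adjugate q p := by
  rw [D_det D hD, Matrix.adjugate_apply, Finset.sum_eq_single p]
  · congr 1
    congr 1
    ext b
    rw [h, Pi.single_apply]
    simp
  · intro a _ ha
    apply Matrix.det_eq_zero_of_row_eq_zero a
    intro b
    rw [Matrix.updateRow_self, h, if_neg (fun h => ha h.1)]
  · simp
end detder

section fieldpart
variable {F : Type*} [Field F] (D : F →+ F) (hD : ∀ x y, D (x * y) = x * D y + y * D x)
include hD

lemma D_inv {n : ℕ} (A : Matrix (Fin n) (Fin n) F) (hA : A.det ≠ 0) (p q : Fin n) (h : ∀ a b, D (A a b) = if a = p ∧ b = q then 1 else 0)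
    (a b : Fin n) : D (A⁻¹ a b) = - (A⁻¹ a p * A⁻¹ q b) := by
  have hu : IsUnit A.det := IsUnit.mk0 _ hA
  have h1 : A⁻¹ * A = 1 := Matrix.nonsing_inv_mul A hu
  have h2 : A * A⁻¹ = 1 := Matrix.mul_nonsing_inv A hu
  have h3 : (A⁻¹).map D * A + A⁻¹ * A.map D = 0 := by
    ext i j
    have := congrArg D (congrFun (congrFun h1 i) j)
    rw [Matrix.mul_apply, map_sum] at this
    have h0 : D ((1 : Matrix (Fin n) (Fin n) F) i j) = 0 := by
      rw [Matrix.one_apply]; split_ifs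
      · exact D_one D hD
      · exact map_zero _
    rw [h0] at this
    simp only [Matrix.add_apply, Matrix.mul_apply, Matrix.map_apply, Matrix.zero_apply]
    rw [← this, ← Finset.sum_add_distrib]
    refine Finset.sum_congr rfl (fun x _ => ?_)
    rw [hD]; ring
  have h4 : (A⁻¹).map D = - (A⁻¹ * A.map D * A⁻¹) := by
    have := congrArg (· * A⁻¹) h3
    simp only [add_mul, zero_mul] at this
    rw [mul_assoc, h2, mul_one] at this
    exact eq_neg_of_add_eq_zero_left this
  have h5 := congrFun (congrFun h4 a) b
  rw [Matrix.map_apply, Matrix.neg_apply, Matrix.mul_apply] at h5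
  rw [h5]
  congr 1
  rw [Finset.sum_eq_single q]
  · congr 1
    rw [Matrix.mul_apply, Finset.sum_eq_single p]
    · simp [h]
    · intro c _ hc
      simp [h, hc]
    · simp
  · intro c _ hc
    rw [Matrix.mul_apply]
    simp [h, hc]
  · simp

lemma D_minor {n k : ℕ} (Z : Matrix (Fin n) (Fin n) F) (p q : Fin n) (hZ : ∀ a b, D (Z a b) = - (Z p b * Z a q))
    (r c : Fin k → Fin n) : D (Z.submatrix r c).det = - ∑ a, Z (r a) q * (Z.submatrix (Function.update r a p) c).det := by
  rw [D_det D hD, ← Finset.sum_neg_distrib]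
  refine Finset.sum_congr rfl (fun a _ => ?_)
  have : (Z.submatrix r c).updateRow a (fun b => D (Z.submatrix r c a b)) =
      (Z.submatrix (Function.update r a p) c).updateRow a ((- Z (r a) q) • (Z.submatrix (Function.update r a p) c) a) := by
    ext i j
    by_cases h : i = a
    · subst h
      simp [hZ]; ring
    · simp [Matrix.updateRow_ne h, Function.update_of_ne h]
  rw [this, Matrix.det_updateRow_smul, Matrix.updateRow_eq_self]
  ring
end fieldpart

lemma lap_swap {F : Type*} [Field F] {n k : ℕ} (Z : Matrix (Fin n) (Fin n) F) (r c : Fin (k+1) → Fin n) (a : Fin k) :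
    ∑ j : Fin (k+1), (-1) ^ (j : ℕ) * (Z (r a.succ) (c j) * (Z.submatrix (Function.update (fun i => r i.succ) a (r 0)) (fun i => c (j.succAbove i))).det)
      = - (Z.submatrix r c).det := by
  have h1 := Matrix.det_permute (Equiv.swap 0 a.succ) (Z.submatrix r c)
  rw [Equiv.Perm.sign_swap (Fin.succ_ne_zero a).symm] at h1
  have h2 : (Z.submatrix r c).submatrix (Equiv.swap 0 a.succ) id = Z.submatrix (fun i => r (Equiv.swap 0 a.succ i)) c := rfl
  rw [h2, Matrix.det_succ_row_zero] at h1
  simp only [Units.val_neg, Units.val_one, Int.cast_neg, Int.cast_one, neg_mul, one_mul] at h1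
  rw [← h1]
  refine Finset.sum_congr rfl (fun j _ => ?_)
  rw [mul_assoc]
  refine congrArg₂ (· * ·) rfl (congrArg₂ (· * ·) ?_ ?_)
  · simp
  · refine congrArg Matrix.det ?_
    ext i l
    simp only [Matrix.submatrix_apply]
    refine congrArg₂ Z ?_ rfl
    by_cases h : i = a
    · subst h; simp
    · rw [Function.update_of_ne h, Equiv.swap_apply_of_ne_of_ne (Fin.succ_ne_zero i) (fun h' => h (Fin.succ_injective _ h'))]

section evs
variable {K : Type u} [Field K] {σ : Type}

/-- the operators -/
def pdS (K : Type u) [Field K] (σ : Type) : Set (Module.End K (MvPolynomial σ K)) :=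
  Set.range (fun s => (pderiv s : Derivation K (MvPolynomial σ K) (MvPolynomial σ K)).toLinearMap)

lemma pdS_comm : ∀ a ∈ pdS K σ, ∀ b ∈ pdS K σ, a * b = b * a := by
  rintro _ ⟨s, rfl⟩ _ ⟨s', rfl⟩
  exact LinearMap.ext (fun x => pd_comm s s' x)

open scoped IsMulCommutative in
/-- constant coefficient differential operators -/
noncomputable def ev (K : Type u) [Field K] (σ : Type) : MvPolynomial σ K →ₐ[K] Module.End K (MvPolynomial σ K) :=
  haveI := Algebra.isMulCommutative_adjoin K (pdS_comm (K := K) (σ := σ))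
  (Subalgebra.val _).comp (aeval (R := K) (S₁ := Algebra.adjoin K (pdS K σ)) (fun s => ⟨_, Algebra.subset_adjoin ⟨s, rfl⟩⟩))

lemma ev_X (s : σ) (h : MvPolynomial σ K) : ev K σ (X s) h = pderiv s h := by
  simp [ev, aeval_X]

lemma ev_mul (f g h : MvPolynomial σ K) : ev K σ (f * g) h = ev K σ f (ev K σ g h) := by
  rw [map_mul]; rfl

lemma ev_add (f g h : MvPolynomial σ K) : ev K σ (f + g) h = ev K σ f h + ev K σ g h := by
  rw [map_add]; rfl

lemma ev_C (a : K) (h : MvPolynomial σ K) : ev K σ (C a) h = C a * h := by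
  rw [← algebraMap_eq, AlgHom.commutes, Module.algebraMap_end_apply, algebraMap_eq, C_mul']

lemma ev_comm (s : σ) (g h : MvPolynomial σ K) : ev K σ g (X s * h) = X s * ev K σ g h + ev K σ (pderiv s g) h := by
  classical
  induction g using MvPolynomial.induction_on generalizing h with
  | C a => rw [pderiv_C, map_zero, ev_C, ev_C, LinearMap.zero_apply]; ring
  | add p q hp hq => rw [ev_add, hp, hq, map_add (pderiv s), ev_add, ev_add]; ring
  | mul_X p i hp =>
    rw [ev_mul, ev_X, pderiv_mul, map_add, hp, pderiv_mul, ev_add, ev_mul, ev_mul, ev_X]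
    by_cases hi : i = s
    · subst hi
      rw [pderiv_X_self, mul_one, one_mul]; ring
    · rw [pderiv_X_of_ne hi, pderiv_X_of_ne (Ne.symm hi)]; simp
end evs
end CH
end

section
universe u v
set_option linter.unusedVariables false
set_option linter.unusedSectionVars false
namespace CH
open MvPolynomial MA
section capelli
variable {K : Type u} [Field K] {t : ℕ}
variable {L : Type u} [Field L] [Algebra (MvPolynomial (Fin t × Fin t) K) L] [IsFractionRing (MvPolynomial (Fin t × Fin t) K) L]

/-- generic square matrix -/
noncomputable abbrev gA (K : Type u) [Field K] (t : ℕ) : Matrix (Fin t) (Fin t) (MvPolynomial (Fin t × Fin t) K) := gm K (fun i j => (i, j))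

lemma gA_pd (p q a b : Fin t) : pderiv (p, q) (gA K t a b) = if a = p ∧ b = q then 1 else 0 := by
  rw [gA, gm]
  split_ifs with h
  · rw [h.1, h.2, pderiv_X_self]
  · exact pderiv_X_of_ne (fun h' => h (Prod.ext_iff.1 h'))

lemma gA_det : (gA K t).det ≠ 0 := by
  intro h
  have := congrArg (MvPolynomial.eval (fun s : Fin t × Fin t => if s.1 = s.2 then (1 : K) else 0)) h
  rw [map_zero, RingHom.map_det] at this
  have h1 : (MvPolynomial.eval (fun s : Fin t × Fin t => if s.1 = s.2 then (1 : K) else 0)).mapMatrix (gA K t) = 1 := by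
    ext i j
    simp [gA, gm, Matrix.one_apply]
  rw [h1, Matrix.det_one] at this
  exact one_ne_zero this

/-- over the fraction field -/
noncomputable def gL (K : Type u) [Field K] (t : ℕ) (L : Type u) [Field L] [Algebra (MvPolynomial (Fin t × Fin t) K) L] : Matrix (Fin t) (Fin t) L :=
  (gA K t).map (algebraMap (MvPolynomial (Fin t × Fin t) K) L)

/-- inverse transpose -/
noncomputable def gZ (K : Type u) [Field K] (t : ℕ) (L : Type u) [Field L] [Algebra (MvPolynomial (Fin t × Fin t) K) L] : Matrix (Fin t) (Fin t) L :=
  (gL K t L)⁻¹.transpose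

lemma gL_det : (gL K t L).det = algebraMap (MvPolynomial (Fin t × Fin t) K) L (gA K t).det := by
  rw [gL, RingHom.map_det]; rfl

lemma gL_det0 : (gL K t L).det ≠ 0 := by
  rw [gL_det]
  exact fun h => gA_det (IsFractionRing.injective (MvPolynomial (Fin t × Fin t) K) L (h.trans (map_zero _).symm))

lemma gL_D (p q a b : Fin t) : dL L (pderiv (R := K) (p, q)) (gL K t L a b) = if a = p ∧ b = q then 1 else 0 := by
  rw [gL, Matrix.map_apply, dL_map, gA_pd]
  split_ifs <;> simp

lemma gZ_D (p q a b : Fin t) : dL L (pderiv (R := K) (p, q)) (gZ K t L a b) = - (gZ K t L p b * gZ K t L a q) := by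
  simp only [gZ, Matrix.transpose_apply]
  rw [D_inv _ (dL_mul _) _ gL_det0 p q (gL_D p q)]

lemma gdet_D (p q : Fin t) : dL L (pderiv (R := K) (p, q)) (gL K t L).det = (gL K t L).det * gZ K t L p q := by
  rw [D_det_unit _ (dL_mul _) _ p q (gL_D p q), gZ, Matrix.transpose_apply, Matrix.inv_def, Ring.inverse_eq_inv', Matrix.smul_apply, smul_eq_mul,
    mul_inv_cancel_left₀ gL_det0]

lemma gdet_DM (p q : Fin t) (M : ℕ) : dL L (pderiv (R := K) (p, q)) ((gL K t L).det ^ M) = M * ((gL K t L).det ^ M * gZ K t L p q) := by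
  rw [dL_pow, gdet_D]
  rcases M with _ | M
  · simp
  · rw [Nat.add_sub_cancel, pow_succ]; ring

lemma cap (M : ℕ) (k : ℕ) (r c : Fin k → Fin t) :
    algebraMap (MvPolynomial (Fin t × Fin t) K) L (ev K _ ((gA K t).submatrix r c).det ((gA K t).det ^ M)) =
      ((∏ i ∈ Finset.range k, (M + i) : ℕ) : L) * ((gL K t L).det ^ M * ((gZ K t L).submatrix r c).det) := by
  induction k with
  | zero =>
    rw [Matrix.det_fin_zero, Matrix.det_fin_zero, map_one, Module.End.one_apply, map_pow, gL_det]
    simp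
  | succ k ih =>
    rw [Matrix.det_succ_row_zero, map_sum, LinearMap.sum_apply, map_sum]
    have key : ∀ j : Fin (k+1), algebraMap (MvPolynomial (Fin t × Fin t) K) L (ev K _ ((-1) ^ (j : ℕ) * (gA K t).submatrix r c 0 j *
        (((gA K t).submatrix r c).submatrix Fin.succ j.succAbove).det) ((gA K t).det ^ M)) =
        ((∏ i ∈ Finset.range k, (M + i) : ℕ) : L) * ((gL K t L).det ^ M * (M * ((-1) ^ (j : ℕ) * gZ K t L (r 0) (c j) * (((gZ K t L).submatrix r c).submatrix Fin.succ j.succAbove).det)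
          - ∑ a : Fin k, (-1) ^ (j : ℕ) * (gZ K t L (r a.succ) (c j) * ((gZ K t L).submatrix (Function.update (fun i => r i.succ) a (r 0)) (fun i => c (j.succAbove i))).det))) := by
      intro j
      have e1 : ((-1) ^ (j : ℕ) : MvPolynomial (Fin t × Fin t) K) = C ((-1) ^ (j : ℕ)) := by simp
      have e2 : algebraMap (MvPolynomial (Fin t × Fin t) K) L (C ((-1) ^ (j : ℕ))) = (-1) ^ (j : ℕ) := by rw [← e1]; simp
      rw [e1, mul_assoc, ev_mul, ev_C, ev_mul, map_mul, e2]
      have e3 : (gA K t).submatrix r c 0 j = X (r 0, c j) := rfl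
      rw [e3, ev_X, ← dL_map (L := L)]
      have e4 := ih (fun i => r i.succ) (fun i => c (j.succAbove i))
      have e5 : ((gA K t).submatrix r c).submatrix Fin.succ j.succAbove = (gA K t).submatrix (fun i => r i.succ) (fun i => c (j.succAbove i)) := rfl
      have e6 : ((gZ K t L).submatrix r c).submatrix Fin.succ j.succAbove = (gZ K t L).submatrix (fun i => r i.succ) (fun i => c (j.succAbove i)) := rfl
      rw [e5, e6, e4, ← nsmul_eq_mul, map_nsmul, nsmul_eq_mul, dL_mul, gdet_DM, D_minor _ (dL_mul _) _ _ _ (gZ_D _ _), ← Finset.mul_sum]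
      ring
    rw [Finset.sum_congr rfl (fun j _ => key j), ← Finset.mul_sum, ← Finset.mul_sum, Finset.sum_sub_distrib, ← Finset.mul_sum, Finset.sum_comm]
    have h1 : ∑ j : Fin (k+1), (-1) ^ (j : ℕ) * gZ K t L (r 0) (c j) * (((gZ K t L).submatrix r c).submatrix Fin.succ j.succAbove).det = ((gZ K t L).submatrix r c).det := by
      rw [Matrix.det_succ_row_zero ((gZ K t L).submatrix r c)]; rfl
    rw [h1, Finset.sum_congr rfl (fun a _ => lap_swap (gZ K t L) r c a), Finset.prod_range_succ]
    simp
    ring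

lemma cap_det (M : ℕ) : ev K _ (gA K t).det ((gA K t).det ^ (M+1)) = ((∏ i ∈ Finset.range t, (M + 1 + i) : ℕ) : MvPolynomial (Fin t × Fin t) K) * (gA K t).det ^ M := by
  let L := FractionRing (MvPolynomial (Fin t × Fin t) K)
  apply IsFractionRing.injective (MvPolynomial (Fin t × Fin t) K) L
  have := cap (K := K) (L := L) (M+1) t id id
  rw [Matrix.submatrix_id_id, Matrix.submatrix_id_id] at this
  rw [this, map_mul, map_natCast, map_pow, ← gL_det (L := L), gZ, Matrix.det_transpose, Matrix.det_nonsing_inv, Ring.inverse_eq_inv', pow_succ,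
    mul_assoc, mul_inv_cancel₀ gL_det0, mul_one]

lemma cap_det0 (ht : 1 ≤ t) : ev K _ (gA K t).det 1 = 0 := by
  let L := FractionRing (MvPolynomial (Fin t × Fin t) K)
  apply IsFractionRing.injective (MvPolynomial (Fin t × Fin t) K) L
  have := cap (K := K) (L := L) 0 t id id
  rw [Matrix.submatrix_id_id, Matrix.submatrix_id_id, pow_zero] at this
  rw [this, Finset.prod_eq_zero (i := 0) (Finset.mem_range.2 ht) rfl]
  simp
end capelli

section capelli2
variable {K : Type u} [Field K] {t : ℕ}
lemma D_det_der {k R : Type*} [CommRing k] [CommRing R] [Algebra k R] (d : Derivation k R R) {n : ℕ} (A : Matrix (Fin n) (Fin n) R) (p q : Fin n)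
    (h : ∀ a b, d (A a b) = if a = p ∧ b = q then 1 else 0) : d A.det = A.adjugate q p :=
  D_det_unit d.toLinearMap.toAddMonoidHom (fun x y => d.leibniz x y) A p q h

lemma cap_cof (M : ℕ) (p q : Fin (t+1)) : ev K _ (pderiv (p, q) (gA K (t+1)).det) ((gA K (t+1)).det ^ (M+1)) =
    ((∏ i ∈ Finset.range t, (M + 1 + i) : ℕ) : MvPolynomial (Fin (t+1) × Fin (t+1)) K) * (X (p, q) * (gA K (t+1)).det ^ M) := by
  let L := FractionRing (MvPolynomial (Fin (t+1) × Fin (t+1)) K)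
  apply IsFractionRing.injective (MvPolynomial (Fin (t+1) × Fin (t+1)) K) L
  have h1 : pderiv (p, q) (gA K (t+1)).det = (gA K (t+1)).adjugate q p :=
    D_det_der (pderiv (R := K) (p, q)) _ p q (gA_pd p q)
  rw [h1, Matrix.adjugate_fin_succ_eq_det_submatrix]
  have e1 : ((-1) ^ ((p : ℕ) + q) : MvPolynomial (Fin (t+1) × Fin (t+1)) K) = C ((-1) ^ ((p : ℕ) + q)) := by simp
  have e2 : algebraMap (MvPolynomial (Fin (t+1) × Fin (t+1)) K) L (C ((-1) ^ ((p : ℕ) + q))) = (-1) ^ ((p : ℕ) + q) := by rw [← e1]; simp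
  rw [e1, ev_mul, ev_C, map_mul, e2, cap (L := L)]
  have h2 := Matrix.adjugate_fin_succ_eq_det_submatrix (gZ K (t+1) L) q p
  have h3 : (gZ K (t+1) L).adjugate = (gZ K (t+1) L).det • (gL K (t+1) L).transpose := by
    have hu : IsUnit (gL K (t+1) L).det := IsUnit.mk0 _ gL_det0
    have h4 : gZ K (t+1) L * (gL K (t+1) L).transpose = 1 := by
      rw [gZ, ← Matrix.transpose_mul, Matrix.mul_nonsing_inv _ hu, Matrix.transpose_one]
    calc (gZ K (t+1) L).adjugate = (gZ K (t+1) L).adjugate * (gZ K (t+1) L * (gL K (t+1) L).transpose) := by rw [h4, mul_one]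
      _ = _ := by rw [← mul_assoc, Matrix.adjugate_mul, Matrix.smul_mul, one_mul]
  rw [h3, Matrix.smul_apply, Matrix.transpose_apply, smul_eq_mul] at h2
  have h5 : (gL K (t+1) L).det * (gZ K (t+1) L).det = 1 := by
    rw [gZ, Matrix.det_transpose, Matrix.det_nonsing_inv, Ring.inverse_eq_inv', mul_inv_cancel₀ gL_det0]
  have h6 : gL K (t+1) L p q = algebraMap (MvPolynomial (Fin (t+1) × Fin (t+1)) K) L (X (p, q)) := rfl
  rw [map_mul, map_mul, map_natCast, map_pow, ← gL_det (L := L), ← h6]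
  calc _ = ((∏ i ∈ Finset.range t, (M + 1 + i) : ℕ) : L) * ((gL K (t+1) L).det ^ (M+1) * ((-1) ^ ((p : ℕ) + q) * ((gZ K (t+1) L).submatrix p.succAbove q.succAbove).det)) := by ring
    _ = ((∏ i ∈ Finset.range t, (M + 1 + i) : ℕ) : L) * (((gL K (t+1) L).det * (gZ K (t+1) L).det) * (gL K (t+1) L).det ^ M * gL K (t+1) L p q) := by rw [← h2]; ring
    _ = _ := by rw [h5]; ring
end capelli2
end CH
end

section
universe u v
set_option linter.unusedVariables false
set_option linter.unusedSectionVars false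
namespace CH
open MvPolynomial MA
section base
variable {K : Type u} [Field K] {t : ℕ}

/-- the residue functional -/
noncomputable def rphi (K : Type u) [Field K] (t M : ℕ) (g : MvPolynomial (Fin (t+1) × Fin (t+1)) K) : K :=
  constantCoeff (ev K _ g ((gA K (t+1)).det ^ M))

lemma rphi_add (M : ℕ) (g h : MvPolynomial (Fin (t+1) × Fin (t+1)) K) : rphi K t M (g + h) = rphi K t M g + rphi K t M h := by
  rw [rphi, ev_add, map_add]; rfl

lemma ev_nat (n : ℕ) (g h : MvPolynomial (Fin (t+1) × Fin (t+1)) K) : ev K _ g ((n : MvPolynomial (Fin (t+1) × Fin (t+1)) K) * h) = n * ev K _ g h := by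
  rw [← nsmul_eq_mul, map_nsmul, nsmul_eq_mul]

lemma rphi_neg (M : ℕ) (g : MvPolynomial (Fin (t+1) × Fin (t+1)) K) : rphi K t M (-g) = - rphi K t M g := by
  rw [rphi, map_neg, LinearMap.neg_apply, map_neg]; rfl

lemma rphi_natmul (M n : ℕ) (g : MvPolynomial (Fin (t+1) × Fin (t+1)) K) : rphi K t M (n * g) = n * rphi K t M g := by
  rw [rphi, ← nsmul_eq_mul, map_nsmul, LinearMap.smul_apply, map_nsmul, nsmul_eq_mul]; rfl

lemma rphi_det (M : ℕ) (g : MvPolynomial (Fin (t+1) × Fin (t+1)) K) :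
    rphi K t (M+1) ((gA K (t+1)).det * g) = ((∏ i ∈ Finset.range (t+1), (M + 1 + i) : ℕ) : K) * rphi K t M g := by
  rw [rphi, mul_comm, ev_mul, cap_det, ev_nat, map_mul, map_natCast]; rfl

lemma rphi_cof (M : ℕ) (s : Fin (t+1) × Fin (t+1)) (g : MvPolynomial (Fin (t+1) × Fin (t+1)) K) :
    rphi K t (M+1) (pderiv s (gA K (t+1)).det * g) = ((∏ i ∈ Finset.range t, (M + 1 + i) : ℕ) : K) * rphi K t M (pderiv s g) := by
  obtain ⟨p, q⟩ := s
  rw [rphi, mul_comm, ev_mul, cap_cof, ev_nat, ev_comm, map_mul, map_natCast, map_add, map_mul, constantCoeff_X, zero_mul, zero_add]; rfl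

lemma rphi_der (M : ℕ) (s : Fin (t+1) × Fin (t+1)) (g : MvPolynomial (Fin (t+1) × Fin (t+1)) K) :
    rphi K t (M+1) ((gA K (t+1)).det * pderiv s g - ((M + (t+1) : ℕ) : MvPolynomial (Fin (t+1) × Fin (t+1)) K) * pderiv s (gA K (t+1)).det * g) = 0 := by
  rw [sub_eq_add_neg, rphi_add, rphi_neg, rphi_det, mul_assoc, rphi_natmul, rphi_cof, Finset.prod_range_succ]
  push_cast
  ring

lemma rphi_pow [CharZero K] (M : ℕ) : rphi K t M ((gA K (t+1)).det ^ M) ≠ 0 := by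
  induction M with
  | zero => simp [rphi]
  | succ M ih =>
    rw [pow_succ', rphi_det]
    refine mul_ne_zero ?_ ih
    rw [Nat.cast_ne_zero, Finset.prod_ne_zero_iff]
    intro i _
    omega

lemma rphi_raise {L : Type u} [Field L] [Algebra (MvPolynomial (Fin (t+1) × Fin (t+1)) K) L] (M : ℕ) (g : MvPolynomial (Fin (t+1) × Fin (t+1)) K)
    (y : L) (h : algebraMap (MvPolynomial (Fin (t+1) × Fin (t+1)) K) L (gA K (t+1)).det ^ (M + (t+1)) * y = algebraMap _ L g) (h0 : rphi K t M g = 0) (j : ℕ) :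
    ∃ g', algebraMap (MvPolynomial (Fin (t+1) × Fin (t+1)) K) L (gA K (t+1)).det ^ (M + j + (t+1)) * y = algebraMap _ L g' ∧ rphi K t (M + j) g' = 0 := by
  induction j with
  | zero => exact ⟨g, h, h0⟩
  | succ j ih =>
    obtain ⟨g', h1, h2⟩ := ih
    refine ⟨(gA K (t+1)).det * g', ?_, ?_⟩
    · rw [map_mul, ← h1]; ring
    · rw [← add_assoc, rphi_det, h2, mul_zero]

/-- the subgroup killed by the residue functional -/
noncomputable def rT (K : Type u) [Field K] (t : ℕ) (L : Type u) [Field L] [Algebra (MvPolynomial (Fin (t+1) × Fin (t+1)) K) L] : AddSubgroup L where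
  carrier := {y | ∃ M g, algebraMap (MvPolynomial (Fin (t+1) × Fin (t+1)) K) L (gA K (t+1)).det ^ (M + (t+1)) * y = algebraMap _ L g ∧ rphi K t M g = 0}
  zero_mem' := ⟨0, 0, by simp, by simp [rphi]⟩
  add_mem' := by
    rintro x y ⟨M, g, h, h0⟩ ⟨M', g', h', h0'⟩
    obtain ⟨a, ha, ha0⟩ := rphi_raise M g x h h0 M'
    obtain ⟨b, hb, hb0⟩ := rphi_raise M' g' y h' h0' M
    rw [add_comm M' M] at hb hb0
    exact ⟨M + M', a + b, by rw [mul_add, ha, hb, map_add], by rw [rphi_add, ha0, hb0, add_zero]⟩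
  neg_mem' := by
    rintro x ⟨M, g, h, h0⟩
    exact ⟨M, -g, by rw [mul_neg, h, map_neg], by rw [rphi_neg, h0, neg_zero]⟩

lemma NZ_base [CharZero K] (t : ℕ) : NZ K (t+1) (t+1) (t+1) := by
  refine ⟨Fin (t+1) × Fin (t+1), fun i j => (i, j), [(gA K (t+1)).det], ?_, ?_, ?_, ?_, ?_⟩
  · intro i j i' j' h
    exact Prod.ext_iff.1 h
  · intro f hf
    rw [List.mem_singleton] at hf
    rw [hf]; exact gA_det
  · congr 1
    have : {f | f ∈ [(gA K (t+1)).det]} = {(gA K (t+1)).det} := by ext; simp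
    rw [this]
    apply le_antisymm
    · rw [Ideal.span_singleton_le_iff_mem]
      exact Ideal.subset_span ⟨id, id, Function.injective_id, Function.injective_id, rfl⟩
    · apply Ideal.span_le.2
      rintro _ ⟨r, c, hr, hc, rfl⟩
      have e1 : (gA K (t+1)).submatrix r c = ((gA K (t+1)).submatrix (Equiv.ofBijective r (Finite.injective_iff_bijective.1 hr)) id).submatrix id
          (Equiv.ofBijective c (Finite.injective_iff_bijective.1 hc)) := rfl
      change ((gA K (t+1)).submatrix r c).det ∈ _
      rw [e1, Matrix.det_permute', Matrix.det_permute]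
      exact Ideal.mul_mem_left _ _ (Ideal.mul_mem_left _ _ (Ideal.mem_span_singleton_self _))
  · rw [List.length_singleton, pow_two]; omega
  · rw [EE_top rfl]
    intro hle
    let L := FractionRing (MvPolynomial (Fin (t+1) × Fin (t+1)) K)
    have hΔ : algebraMap (MvPolynomial (Fin (t+1) × Fin (t+1)) K) L (gA K (t+1)).det ≠ 0 := by
      rw [Ne, IsFractionRing.to_map_eq_zero_iff]; exact gA_det
    have hT := hle.trans (Bd_le (rT K t L) _ _ (by
      intro q hq c hc y hy
      rw [pr_cl, List.prod_singleton, one_mul] at hc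
      rw [mem_cl] at hq
      rcases hq with ⟨s, _, rfl⟩ | ⟨f, hf, rfl⟩
      · rw [mul_one] at hc
        subst hc
        obtain ⟨N, g, h⟩ := mem_SS.1 hy
        have h2 : algebraMap (MvPolynomial (Fin (t+1) × Fin (t+1)) K) L (gA K (t+1)).det ^ (N + (t+1)) * y = algebraMap _ L ((gA K (t+1)).det ^ (t+1) * g) := by
          rw [map_mul, ← h, map_pow]; ring
        have h3 := dL_frac (pderiv s) _ _ y _ h2
        refine ⟨N+1, _, ?_, rphi_der N s ((gA K (t+1)).det ^ (t+1) * g)⟩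
        rw [← h3]
        have e : N + 1 + (t+1) = N + (t+1) + 1 := by omega
        rw [e]; rfl
      · rw [List.mem_singleton] at hf
        subst hf
        have hc1 : c = 1 := mul_right_cancel₀ gA_det (hc.trans (one_mul _).symm)
        subst hc1
        obtain ⟨N, g, h⟩ := mem_SS.1 hy
        rw [map_one, one_pow, one_mul] at h
        refine ⟨0, (gA K (t+1)).det ^ (t+1) * g, ?_, ?_⟩
        · rw [map_mul, ← h, map_pow, zero_add]
          congr 1
        · rw [rphi, pow_zero, pow_succ, mul_assoc, mul_comm, mul_assoc, mul_comm, ev_mul, ev_mul, cap_det0 (by omega)]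
          simp))
    have hy : (algebraMap (MvPolynomial (Fin (t+1) × Fin (t+1)) K) L (gA K (t+1)).det ^ (t+1))⁻¹ ∈ SS (MvPolynomial (Fin (t+1) × Fin (t+1)) K) L [(gA K (t+1)).det].prod := by
      rw [List.prod_singleton]
      exact mem_SS.2 ⟨t+1, 1, by rw [mul_inv_cancel₀ (pow_ne_zero _ hΔ), map_one]⟩
    obtain ⟨M, g, h, h0⟩ := hT hy
    rw [pow_add, mul_assoc, mul_inv_cancel₀ (pow_ne_zero _ hΔ), mul_one, ← map_pow] at h
    have := IsFractionRing.injective (MvPolynomial (Fin (t+1) × Fin (t+1)) K) L h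
    subst this
    exact rphi_pow M h0
end base
end CH
end

/-- For a sparse generic `(m × n)`-matrix `X` with exactly `k` zero entries lying on
consecutive antidiagonals starting from the upper-left corner, where
`0 ≤ k ≤ min {2t+1, m+n-2t}`, whose remaining entries are pairwise distinct
indeterminates, over an algebraically closed field of characteristic zero:
`ara I_t(X) = cd I_t(X) = mn - t² - k + 1`. -/
theorem stmt4 {K : Type*} [Field K] [IsAlgClosed K] [CharZero K] (m n t k : ℕ)
    (ht1 : 1 ≤ t) (htm : t ≤ m) (hmn : m ≤ n)
    (hk2 : k ≤ 2 * t + 1) (hk3 : k ≤ m + n - 2 * t)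
    (X : Matrix (Fin m) (Fin n) (MvPolynomial (Fin (m * n - k)) K))
    (e : Fin m × Fin n ≃ (Fin k ⊕ Fin (m * n - k)))
    (hX : ∀ p : Fin m × Fin n,
      X p.1 p.2 = Sum.elim (fun _ => 0) (fun l => MvPolynomial.X l) (e p))
    (hdiag : ∀ h : Fin k,
      ((e.symm (Sum.inl h)).1 : ℕ) + ((e.symm (Sum.inl h)).2 : ℕ) ≤ (h : ℕ)) :
    araRank (minorsIdeal t X) = m * n - t ^ 2 - k + 1 ∧
      cohDim (minorsIdeal t X) = m * n - t ^ 2 - k + 1 := by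
  obtain ⟨s, rfl⟩ : ∃ s, t = s + 1 := ⟨t - 1, by omega⟩
  exact CH.stmt4_of K m n (s + 1) k ht1 htm hmn hk3 X e hX hdiag
    (CH.PJ0 htm (htm.trans hmn) (CH.NZ_all htm (htm.trans hmn) (CH.NZ_base s)))
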